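/- arXiv:2507.05615 — 5 statements merged into one kernel-verified Lean document; each statement's English description precedes it below -/
import Mathlib

section
/- Let Y be a random variable taking values in [0,∞) with distribution function G having finite moments ν_n = E[Y^n] of all positive integer orders, such that G is absolutely continuous on [x₀,∞) for some x₀ > 1, with density g(x) = G′(x) > 0 there. Let a > 0 and α ∈ [0,1]. If limsup_{x→∞} g(x + a·(log x)^α) / g(x) < 1, then both ∑_{n=1}^∞ ν_n^{−1/(2n)} = ∞ and ∑_{n=1}^∞ ν_{2n}^{−1/(2n)} = ∞, and the distributions of both Y and Y² are uniquely determined by their moments among all probability distributions on [0,∞). -/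
open MeasureTheory Filter Set

/-- Moment-determinacy on `ℝ₊` among all probability distributions on `[0,∞)`. -/
def IsMomentDetOnNonneg (μ : Measure ℝ) : Prop :=
  ∀ ν : Measure ℝ, IsProbabilityMeasure ν → ν (Set.Iio 0) = 0 →
    (∀ n : ℕ, 0 < n → Integrable (fun x => x ^ n) ν ∧
      ∫ x, x ^ n ∂ν = ∫ x, x ^ n ∂μ) → ν = μ

section QuasiAnalytic

variable {E : Type*} [NormedAddCommGroup E] [NormedSpace ℝ E]

/-- Bang's estimate: along a chain of derivatives `F n` dominated by `M n`, smallness at `x` relative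
to the weights `exp n * M n` propagates to the right of `x` at a controlled exponential rate. -/
lemma bang_propagation {F : ℕ → ℝ → E} {M : ℕ → ℝ} {R : ℝ} {N : ℕ} {β : ℝ}
    (hF : ∀ n x, HasDerivAt (F n) (F (n + 1) x) x) (hM : ∀ n, 0 ≤ M n)
    (hbound : ∀ x, ‖F N x‖ ≤ M N) (hR : 0 < R) (hMR : ∀ n < N, M (n + 1) ≤ R * M n)
    (hβ : Real.exp (-N) ≤ β) {x : ℝ} (hx : ∀ n, ‖F n x‖ ≤ β * Real.exp n * M n) :
    ∀ k ≤ N, ∀ y, x ≤ y →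
      ‖F (N - k) y‖ ≤ β * Real.exp (N - k : ℕ) * M (N - k) *
        Real.exp (Real.exp 1 * R * (y - x)) := by
  have hβ0 : 0 ≤ β := (Real.exp_pos _).le.trans hβ
  intro k
  induction k with
  | zero =>
    intro _ y hy
    have h1 : 1 ≤ Real.exp (Real.exp 1 * R * (y - x)) := by
      apply Real.one_le_exp
      have : 0 ≤ y - x := by linarith
      positivity
    have h2 : 1 ≤ β * Real.exp N := by
      calc (1 : ℝ) = Real.exp (-N) * Real.exp N := by rw [← Real.exp_add]; simp
        _ ≤ _ := by gcongr
    calc ‖F (N - 0) y‖ ≤ 1 * M N * 1 := by simpa using hbound y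
      _ ≤ _ := by
        have := hM N
        rw [Nat.sub_zero]
        gcongr
  | succ k ih =>
    intro hk y hy
    set n := N - (k + 1) with hn
    have hn1 : N - k = n + 1 := by omega
    have ih' := ih (by omega)
    rw [hn1] at ih'
    have hB : ∀ z, HasDerivAt (fun z => β * Real.exp n * M n *
        Real.exp (Real.exp 1 * R * (z - x)))
        (β * Real.exp n * M n * (Real.exp (Real.exp 1 * R * (z - x)) * (Real.exp 1 * R))) z := by
      intro z
      have h1 : HasDerivAt (fun z => Real.exp 1 * R * (z - x)) (Real.exp 1 * R) z := by
        simpa using ((hasDerivAt_id z).sub_const x).const_mul (Real.exp 1 * R)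
      exact h1.exp.const_mul _
    refine image_norm_le_of_norm_deriv_right_le_deriv_boundary (a := x) (b := y) (f := F n)
      (f' := F (n + 1)) (fun z _ => (hF n z).continuousAt.continuousWithinAt)
      (fun z _ => (hF n z).hasDerivWithinAt) ?_ hB ?_ ⟨hy, le_rfl⟩
    · simpa using hx n
    · intro z hz
      refine (ih' z hz.1).trans ?_
      have h3 := hMR n (by omega)
      calc β * Real.exp (n + 1 : ℕ) * M (n + 1) * Real.exp (Real.exp 1 * R * (z - x))
          ≤ β * Real.exp (n + 1 : ℕ) * (R * M n) * Real.exp (Real.exp 1 * R * (z - x)) := by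
            gcongr
        _ = _ := by
            push_cast
            rw [Real.exp_add]
            ring

/-- Bang's form of the Denjoy–Carleman theorem: a chain of derivatives dominated by weights `M n`
whose ratios `r n` are monotone with divergent sum of reciprocals vanishes to the right of `0` as
soon as it vanishes at `0`. -/
lemma quasiAnalytic_of_tendsto_sum_inv {F : ℕ → ℝ → E} {M r : ℕ → ℝ}
    (hF : ∀ n x, HasDerivAt (F n) (F (n + 1) x) x) (hM : ∀ n, 0 ≤ M n)
    (hbound : ∀ n x, ‖F n x‖ ≤ M n) (hr : ∀ n, 0 < r n) (hmono : Monotone r)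
    (hMr : ∀ n, M (n + 1) = r n * M n)
    (hdiv : Tendsto (fun N => ∑ n ∈ Finset.range N, (r n)⁻¹) atTop atTop)
    (h0 : ∀ n, F n 0 = 0) {x : ℝ} (hx : 0 ≤ x) : F 0 x = 0 := by
  have step : ∀ k : ℕ, ∀ u v : ℝ, u ≤ v → v ≤ u + (Real.exp 1 * r k)⁻¹ →
      (∀ n, ‖F n u‖ ≤ Real.exp (-(k + 1 : ℕ)) * Real.exp n * M n) →
      ∀ n, ‖F n v‖ ≤ Real.exp (-k) * Real.exp n * M n := by
    intro k u v huv hvu hu n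
    have hrk := hr k
    rcases le_or_gt n (k + 1) with hn | hn
    · have := bang_propagation (N := k + 1) (R := r k) hF hM (hbound _) hrk
        (fun n hn => by rw [hMr]; exact mul_le_mul_of_nonneg_right (hmono (by omega)) (hM n))
        le_rfl hu (k + 1 - n) (by omega) v huv
      rw [show k + 1 - (k + 1 - n) = n by omega] at this
      refine this.trans ?_
      have h1 : Real.exp 1 * r k * (v - u) ≤ 1 := by
        calc Real.exp 1 * r k * (v - u) ≤ Real.exp 1 * r k * (Real.exp 1 * r k)⁻¹ := by
              gcongr; linarith
          _ = 1 := mul_inv_cancel₀ (by positivity)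
      calc Real.exp (-(k + 1 : ℕ)) * Real.exp n * M n * Real.exp (Real.exp 1 * r k * (v - u))
          ≤ Real.exp (-(k + 1 : ℕ)) * Real.exp n * M n * Real.exp 1 := by
            have := hM n
            gcongr
        _ = (Real.exp (-(k + 1 : ℕ)) * Real.exp 1) * Real.exp n * M n := by ring
        _ = _ := by rw [← Real.exp_add]; push_cast; ring_nf
    · refine (hbound n v).trans ?_
      rw [← Real.exp_add]
      refine le_mul_of_one_le_left (hM n) (Real.one_le_exp ?_)
      have : (k : ℝ) + 1 < n := by exact_mod_cast hn
      linarith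
  have chain : ∀ k j : ℕ, ∀ y, 0 ≤ y →
      y ≤ ∑ i ∈ Finset.range j, (Real.exp 1 * r (k + i))⁻¹ →
      ∀ n, ‖F n y‖ ≤ Real.exp (-k) * Real.exp n * M n := by
    intro k j
    induction j generalizing k with
    | zero =>
      intro y hy hy' n
      have : y = 0 := le_antisymm (by simpa using hy') hy
      rw [this, h0]
      have := hM n
      simp only [norm_zero]
      positivity
    | succ j ih =>
      intro y hy hy'
      rw [Finset.sum_range_succ'] at hy'
      have hrk := hr k
      refine step k (max 0 (y - (Real.exp 1 * r k)⁻¹)) y ?_ ?_ ?_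
      · exact max_le hy (by simp; positivity)
      · have := le_max_right 0 (y - (Real.exp 1 * r k)⁻¹)
        linarith
      · refine ih (k + 1) _ (le_max_left _ _) (max_le ?_ ?_)
        · exact Finset.sum_nonneg fun i _ => by have := hr (k + 1 + i); positivity
        · have e : ∀ i, k + 1 + i = k + (i + 1) := fun i => by ring
          simp only [e]
          simp only [add_zero] at hy'
          linarith
  have small : ∀ k : ℕ, ‖F 0 x‖ ≤ Real.exp (-k) * M 0 := by
    intro k
    obtain ⟨N, hN⟩ := (hdiv.eventually_ge_atTop
      (Real.exp 1 * x + ∑ n ∈ Finset.range k, (r n)⁻¹)).and (eventually_ge_atTop k) |>.exists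
    obtain ⟨j, rfl⟩ := Nat.exists_eq_add_of_le hN.2
    have h1 := hN.1
    rw [Finset.sum_range_add] at h1
    have h2 : x ≤ ∑ i ∈ Finset.range j, (Real.exp 1 * r (k + i))⁻¹ := by
      simp only [mul_inv, ← Finset.mul_sum]
      rw [inv_mul_eq_div, le_div_iff₀ (Real.exp_pos 1)]
      linarith
    simpa using chain k j x hx h2 0
  have lim : Tendsto (fun k : ℕ => Real.exp (-k) * M 0) atTop (nhds 0) := by
    have h1 : Tendsto (fun k : ℕ => Real.exp (-(k : ℝ))) atTop (nhds 0) :=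
      Real.tendsto_exp_neg_atTop_nhds_zero.comp tendsto_natCast_atTop_atTop
    simpa using h1.mul_const (M 0)
  exact norm_le_zero_iff.1 (ge_of_tendsto' lim small)

end QuasiAnalytic

section MomentProblem

/-- Differentiation under the integral sign for Fourier transforms of polynomially weighted
measures. -/
lemma hasDerivAt_integral_pow_mul_cexp {P : Measure ℝ}
    (hint : ∀ n : ℕ, Integrable (fun x => x ^ n) P) (n : ℕ) (t : ℝ) :
    HasDerivAt (fun t : ℝ => ∫ x : ℝ, (x * Complex.I) ^ n * Complex.exp (t * x * Complex.I) ∂P)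
      (∫ x : ℝ, (x * Complex.I) ^ (n + 1) * Complex.exp (t * x * Complex.I) ∂P) t := by
  have hnorm : ∀ (n : ℕ) (t x : ℝ),
      ‖((x : ℂ) * Complex.I) ^ n * Complex.exp (t * x * Complex.I)‖ = ‖x ^ n‖ := by
    intro n t x
    have : ‖Complex.exp (t * x * Complex.I)‖ = 1 := by
      exact_mod_cast Complex.norm_exp_ofReal_mul_I (t * x)
    simp [this]
  have hmeas : ∀ (n : ℕ) (t : ℝ), AEStronglyMeasurable
      (fun x : ℝ => ((x : ℂ) * Complex.I) ^ n * Complex.exp (t * x * Complex.I)) P := fun n t =>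
    Continuous.aestronglyMeasurable (by fun_prop)
  refine (hasDerivAt_integral_of_dominated_loc_of_deriv_le (μ := P) (𝕜 := ℝ) (s := univ)
    (F' := fun (t : ℝ) (x : ℝ) => ((x : ℂ) * Complex.I) ^ (n + 1) * Complex.exp (t * x * Complex.I))
    (bound := fun x => ‖x ^ (n + 1)‖) univ_mem
    (Eventually.of_forall fun t => hmeas n t) ?_ (hmeas (n + 1) t) ?_ (hint (n + 1)).norm ?_).2
  · exact (hint n).norm.mono' (hmeas n t) (Eventually.of_forall fun x => (hnorm n t x).le)
  · exact Eventually.of_forall fun x t _ => (hnorm (n + 1) t x).le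
  · refine Eventually.of_forall fun x t _ => ?_
    have h1 : HasDerivAt (fun t : ℝ => (t : ℂ) * x * Complex.I) (x * Complex.I) t := by
      have := (Complex.ofRealCLM.hasDerivAt (x := t)).mul_const ((x : ℂ) * Complex.I)
      simpa [mul_assoc] using this
    have h2 := (h1.cexp).const_mul (((x : ℂ) * Complex.I) ^ n)
    convert! h2 using 1
    ring

/-- Carleman-type uniqueness for the Hamburger moment problem: moments dominated by weights
with monotone ratios and divergent sum of reciprocal ratios determine a finite measure. -/
lemma ext_of_moments_of_abs_moments_le {P Q : Measure ℝ} [IsFiniteMeasure P] [IsFiniteMeasure Q]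
    (hP : ∀ n : ℕ, Integrable (fun x => x ^ n) P) (hQ : ∀ n : ℕ, Integrable (fun x => x ^ n) Q)
    (hPQ : ∀ n : ℕ, ∫ x, x ^ n ∂P = ∫ x, x ^ n ∂Q) {M r : ℕ → ℝ}
    (hPM : ∀ n, ∫ x, |x| ^ n ∂P ≤ M n) (hQM : ∀ n, ∫ x, |x| ^ n ∂Q ≤ M n)
    (hr : ∀ n, 0 < r n) (hmono : Monotone r) (hMr : ∀ n, M (n + 1) = r n * M n)
    (hdiv : Tendsto (fun N => ∑ n ∈ Finset.range N, (r n)⁻¹) atTop atTop) : P = Q := by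
  have hM : ∀ n, 0 ≤ M n := fun n => (integral_nonneg fun x => by positivity).trans (hPM n)
  have hnorm : ∀ (S : Measure ℝ) (n : ℕ) (t : ℝ),
      ‖∫ x : ℝ, ((x : ℂ) * Complex.I) ^ n * Complex.exp (t * x * Complex.I) ∂S‖ ≤
        ∫ x, |x| ^ n ∂S := by
    intro S n t
    refine (norm_integral_le_integral_norm _).trans (le_of_eq (integral_congr_ae ?_))
    refine Eventually.of_forall fun x => ?_
    have : ‖Complex.exp (t * x * Complex.I)‖ = 1 := by
      exact_mod_cast Complex.norm_exp_ofReal_mul_I (t * x)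
    simp [this]
  have hzero : ∀ (S : Measure ℝ) (n : ℕ),
      ∫ x : ℝ, ((x : ℂ) * Complex.I) ^ n * Complex.exp ((0 : ℝ) * x * Complex.I) ∂S =
        Complex.I ^ n * ((∫ x, x ^ n ∂S : ℝ) : ℂ) := by
    intro S n
    rw [← integral_complex_ofReal, ← integral_const_mul]
    refine integral_congr_ae (Eventually.of_forall fun x => ?_)
    simp [mul_pow, mul_comm]
  have key : ∀ t : ℝ, 0 ≤ t → charFun P t = charFun Q t := by
    intro t ht
    have := quasiAnalytic_of_tendsto_sum_inv (E := ℂ) (M := fun n => 2 * M n) (r := r)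
      (F := fun n t => (∫ x : ℝ, ((x : ℂ) * Complex.I) ^ n * Complex.exp (t * x * Complex.I) ∂P) -
        ∫ x : ℝ, ((x : ℂ) * Complex.I) ^ n * Complex.exp (t * x * Complex.I) ∂Q)
      (fun n x => (hasDerivAt_integral_pow_mul_cexp hP n x).sub
        (hasDerivAt_integral_pow_mul_cexp hQ n x))
      (fun n => by have := hM n; positivity)
      (fun n x => (norm_sub_le _ _).trans (by
        have h1 := (hnorm P n x).trans (hPM n)
        have h2 := (hnorm Q n x).trans (hQM n)
        linarith))
      hr hmono (fun n => by simp only [hMr]; ring) hdiv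
      (fun n => by simp only [hzero, hPQ, sub_self]) ht
    simpa [charFun_apply_real, sub_eq_zero] using this
  refine Measure.ext_of_charFun (funext fun t => ?_)
  rcases le_total 0 t with ht | ht
  · exact key t ht
  · rw [← neg_neg t, charFun_neg (-t), charFun_neg (-t), key (-t) (by linarith)]

/-- The image of `ν` under `x ↦ √x`, symmetrized with respect to the origin. -/
noncomputable def symmSqrt (ν : Measure ℝ) : Measure ℝ :=
  ν.map Real.sqrt + ν.map (fun x => -Real.sqrt x)

instance (ν : Measure ℝ) [IsFiniteMeasure ν] : IsFiniteMeasure (symmSqrt ν) := by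
  unfold symmSqrt; infer_instance

lemma integrable_symmSqrt {ν : Measure ℝ} {f : ℝ → ℝ} (hf : Measurable f)
    (h1 : Integrable (fun x => f (Real.sqrt x)) ν)
    (h2 : Integrable (fun x => f (-Real.sqrt x)) ν) : Integrable f (symmSqrt ν) :=
  ((integrable_map_measure hf.aestronglyMeasurable (by fun_prop)).2 h1).add_measure
    ((integrable_map_measure hf.aestronglyMeasurable (by fun_prop)).2 h2)

lemma integral_symmSqrt {ν : Measure ℝ} {f : ℝ → ℝ} (hf : Measurable f)
    (h1 : Integrable (fun x => f (Real.sqrt x)) ν)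
    (h2 : Integrable (fun x => f (-Real.sqrt x)) ν) :
    ∫ x, f x ∂symmSqrt ν = ∫ x, f (Real.sqrt x) ∂ν + ∫ x, f (-Real.sqrt x) ∂ν := by
  rw [symmSqrt, integral_add_measure
    ((integrable_map_measure hf.aestronglyMeasurable (by fun_prop)).2 h1)
    ((integrable_map_measure hf.aestronglyMeasurable (by fun_prop)).2 h2),
    integral_map (by fun_prop) hf.aestronglyMeasurable,
    integral_map (by fun_prop) hf.aestronglyMeasurable]

lemma ae_nonneg_of_measure_Iio {ν : Measure ℝ} (h : ν (Iio 0) = 0) : ∀ᵐ x ∂ν, 0 ≤ x := by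
  rw [ae_iff]
  simpa [Iio] using h

lemma map_sq_symmSqrt {ν : Measure ℝ} (h : ν (Iio 0) = 0) :
    (symmSqrt ν).map (fun x => x ^ 2) = ν + ν := by
  have h0 := ae_nonneg_of_measure_Iio h
  have hm : Measurable fun x : ℝ => x ^ 2 := by fun_prop
  rw [symmSqrt, Measure.map_add _ _ hm, Measure.map_map hm (by fun_prop),
    Measure.map_map hm (by fun_prop)]
  have e1 : ν.map ((fun x : ℝ => x ^ 2) ∘ Real.sqrt) = ν := by
    rw [Measure.map_congr (g := id) (h0.mono fun x hx => by simp [Real.sq_sqrt hx]),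
      Measure.map_id]
  have e2 : ν.map ((fun x : ℝ => x ^ 2) ∘ fun x => -Real.sqrt x) = ν := by
    rw [Measure.map_congr (g := id) (h0.mono fun x hx => by simp [Real.sq_sqrt hx]),
      Measure.map_id]
  rw [e1, e2]

/-- Carleman-type uniqueness for the Stieltjes moment problem. -/
lemma ext_of_moments_of_moments_le_sq {P Q : Measure ℝ} [IsProbabilityMeasure P]
    [IsProbabilityMeasure Q] (hP0 : P (Iio 0) = 0) (hQ0 : Q (Iio 0) = 0)
    (hP : ∀ n : ℕ, Integrable (fun x => x ^ n) P) (hQ : ∀ n : ℕ, Integrable (fun x => x ^ n) Q)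
    (hPQ : ∀ n : ℕ, ∫ x, x ^ n ∂P = ∫ x, x ^ n ∂Q) {m r : ℕ → ℝ} (hm : ∀ n, 0 < m n)
    (hPm : ∀ n, ∫ x, x ^ n ∂P ≤ m n ^ 2)
    (hr : ∀ n, 0 < r n) (hmono : Monotone r) (hmr : ∀ n, m (n + 1) = r n * m n)
    (hdiv : Tendsto (fun N => ∑ n ∈ Finset.range N, (r n)⁻¹) atTop atTop) : P = Q := by
  have hdom : ∀ (n : ℕ) (x : ℝ), 0 ≤ x →
      Real.sqrt x ^ n ≤ (m n + x ^ n * (m n)⁻¹) / 2 := by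
    intro n x hx
    have h1 : x ^ n = (Real.sqrt x ^ n) ^ 2 := by
      rw [← pow_mul, mul_comm, pow_mul, Real.sq_sqrt hx]
    have h2 := hm n
    rw [h1, ← div_eq_mul_inv, le_div_iff₀ two_pos, ← sub_nonneg]
    have : m n + (Real.sqrt x ^ n) ^ 2 / m n - Real.sqrt x ^ n * 2 =
        (m n - Real.sqrt x ^ n) ^ 2 / m n := by field_simp; ring
    rw [this]
    positivity
  have hsqrt : ∀ (S : Measure ℝ) [IsProbabilityMeasure S], S (Iio 0) = 0 →
      (∀ n : ℕ, Integrable (fun x => x ^ n) S) → (∀ n, ∫ x, x ^ n ∂S ≤ m n ^ 2) →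
      ∀ n : ℕ, Integrable (fun x => Real.sqrt x ^ n) S ∧ ∫ x, Real.sqrt x ^ n ∂S ≤ m n := by
    intro S _ hS0 hS hSm n
    have h0 := ae_nonneg_of_measure_Iio hS0
    have hi : Integrable (fun x => (m n + x ^ n * (m n)⁻¹) / 2) S :=
      ((integrable_const _).add ((hS n).mul_const _)).div_const 2
    have hs : Integrable (fun x => Real.sqrt x ^ n) S := by
      refine hi.mono' (by fun_prop) (h0.mono fun x hx => ?_)
      rw [Real.norm_of_nonneg (by positivity)]
      exact hdom n x hx
    refine ⟨hs, (integral_mono_ae hs hi (h0.mono fun x hx => hdom n x hx)).trans ?_⟩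
    rw [integral_div, integral_add (integrable_const _) ((hS n).mul_const _), integral_mul_const]
    have h2 := hm n
    have h3 : (∫ x, x ^ n ∂S) * (m n)⁻¹ ≤ m n := by
      rw [← div_eq_mul_inv, div_le_iff₀ h2, ← sq]
      exact hSm n
    simp only [integral_const, probReal_univ, smul_eq_mul, one_mul]
    linarith
  have hcomb : ∀ (S : Measure ℝ) [IsProbabilityMeasure S], S (Iio 0) = 0 →
      (∀ n : ℕ, Integrable (fun x => x ^ n) S) → (∀ n, ∫ x, x ^ n ∂S ≤ m n ^ 2) →
      ∀ n : ℕ, Integrable (fun x => x ^ n) (symmSqrt S) ∧ ∫ x, |x| ^ n ∂symmSqrt S ≤ 2 * m n ∧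
        ∫ x, x ^ n ∂symmSqrt S =
          (1 + (-1) ^ n) * ∫ x, Real.sqrt x ^ n ∂S := by
    intro S _ hS0 hS hSm n
    obtain ⟨h1, h2⟩ := hsqrt S hS0 hS hSm n
    have h3 : Integrable (fun x => (-Real.sqrt x) ^ n) S := by
      simp only [neg_pow (Real.sqrt _)]
      exact h1.const_mul _
    refine ⟨integrable_symmSqrt (by fun_prop) h1 h3, ?_, ?_⟩
    · rw [integral_symmSqrt (f := fun x => |x| ^ n) (by fun_prop)
        (by simpa [abs_of_nonneg] using h1) (by simpa [abs_of_nonneg] using h1)]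
      simp only [abs_neg, abs_of_nonneg (Real.sqrt_nonneg _)]
      linarith
    · rw [integral_symmSqrt (f := fun x => x ^ n) (by fun_prop) h1 h3]
      simp only [neg_pow (Real.sqrt _)]
      rw [integral_const_mul]
      ring
  have hQm : ∀ n, ∫ x, x ^ n ∂Q ≤ m n ^ 2 := fun n => by rw [← hPQ]; exact hPm n
  have hcP := hcomb P hP0 hP hPm
  have hcQ := hcomb Q hQ0 hQ hQm
  have heq : symmSqrt P = symmSqrt Q := by
    refine ext_of_moments_of_abs_moments_le (fun n => (hcP n).1) (fun n => (hcQ n).1) ?_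
      (M := fun n => 2 * m n) (fun n => (hcP n).2.1) (fun n => (hcQ n).2.1) hr hmono
      (fun n => by simp only [hmr]; ring) hdiv
    intro n
    rw [(hcP n).2.2, (hcQ n).2.2]
    rcases Nat.even_or_odd n with ⟨k, rfl⟩ | hn
    · have e : ∀ (S : Measure ℝ), S (Iio 0) = 0 →
          ∫ x, Real.sqrt x ^ (k + k) ∂S = ∫ x, x ^ k ∂S := fun S hS =>
        integral_congr_ae ((ae_nonneg_of_measure_Iio hS).mono fun x hx => by
          simp only [← two_mul, pow_mul, Real.sq_sqrt hx])
      rw [e P hP0, e Q hQ0, hPQ]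
    · simp [hn.neg_one_pow]
  have h2 : P + P = Q + Q := by rw [← map_sq_symmSqrt hP0, ← map_sq_symmSqrt hQ0, heq]
  ext s hs
  have h3 : (P + P) s = (Q + Q) s := by rw [h2]
  simp only [Measure.add_apply, ← two_mul] at h3
  exact (ENNReal.mul_right_inj two_ne_zero ENNReal.ofNat_ne_top).1 h3

end MomentProblem

section LogGrowth

/-- The function `x ↦ log (x + e)`, which is at least `1` on `[0, ∞)`. -/
noncomputable def shiftedLog (x : ℝ) : ℝ := Real.log (x + Real.exp 1)

lemma shiftedLog_mono {x y : ℝ} (hx : 0 ≤ x) (hxy : x ≤ y) : shiftedLog x ≤ shiftedLog y :=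
  Real.log_le_log (by positivity) (by linarith)

lemma one_le_shiftedLog {x : ℝ} (hx : 0 ≤ x) : 1 ≤ shiftedLog x := by
  simpa [shiftedLog] using shiftedLog_mono le_rfl hx

lemma shiftedLog_pos {x : ℝ} (hx : 0 ≤ x) : 0 < shiftedLog x :=
  one_pos.trans_le (one_le_shiftedLog hx)

lemma shiftedLog_le_div_mul {x y : ℝ} (hx : 0 < x) (hxy : x ≤ y) :
    shiftedLog y ≤ y / x * shiftedLog x := by
  have he := Real.exp_pos 1
  have hy : 0 < y := hx.trans_le hxy
  have h1 : shiftedLog y - shiftedLog x ≤ y / x - 1 := by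
    rw [shiftedLog, shiftedLog, ← Real.log_div (by positivity) (by positivity)]
    refine (Real.log_le_sub_one_of_pos (by positivity)).trans ?_
    gcongr ?_ - 1
    rw [div_le_div_iff₀ (by positivity) hx]
    nlinarith
  have h2 : 1 ≤ y / x := (one_le_div hx).2 hxy
  nlinarith [one_le_shiftedLog hx.le]

lemma shiftedLog_sq_le {x : ℝ} (hx : 0 ≤ x) : shiftedLog (x ^ 2) ≤ 2 * shiftedLog x := by
  have he : 1 ≤ Real.exp 1 := Real.one_le_exp zero_le_one
  have h : 2 * Real.log (x + Real.exp 1) = Real.log ((x + Real.exp 1) ^ 2) := by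
    rw [Real.log_pow, Nat.cast_two]
  rw [shiftedLog, shiftedLog, h]
  exact Real.log_le_log (by positivity) (by nlinarith)

lemma shiftedLog_two_mul_le {x : ℝ} (hx : 0 ≤ x) : shiftedLog (2 * x) ≤ 2 * shiftedLog x := by
  rcases hx.eq_or_lt with rfl | h
  · simp only [mul_zero]
    linarith [shiftedLog_pos (le_refl (0 : ℝ))]
  · have := shiftedLog_le_div_mul h (show x ≤ 2 * x by linarith)
    rwa [mul_div_cancel_right₀ _ h.ne'] at this

lemma mul_shiftedLog_pow_le_prod (n : ℕ) :
    ((n : ℝ) * shiftedLog n) ^ n ≤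
      ∏ k ∈ Finset.range n, Real.exp 2 * (((k + 1 : ℕ) : ℝ) * shiftedLog ((k + 1 : ℕ) : ℝ)) := by
  have hfac : ∏ k ∈ Finset.range n, ((k + 1 : ℕ) : ℝ) = (n.factorial : ℝ) := by
    rw [← Finset.prod_range_add_one_eq_factorial]; push_cast; rfl
  have hf : (0 : ℝ) < n.factorial := by exact_mod_cast n.factorial_pos
  have h1 : (n : ℝ) ^ n ≤ Real.exp n * n.factorial :=
    (div_le_iff₀ hf).1 (Real.pow_div_factorial_le_exp _ (Nat.cast_nonneg n) n)
  have hL : ∀ k : ℕ, 0 < shiftedLog ((k + 1 : ℕ) : ℝ) := fun k => shiftedLog_pos (Nat.cast_nonneg _)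
  have hP : 0 < ∏ k ∈ Finset.range n, shiftedLog ((k + 1 : ℕ) : ℝ) :=
    Finset.prod_pos fun k _ => hL k
  have h2 : shiftedLog n ^ n ≤
      Real.exp n * ∏ k ∈ Finset.range n, shiftedLog ((k + 1 : ℕ) : ℝ) := by
    calc shiftedLog n ^ n = ∏ k ∈ Finset.range n, shiftedLog n := by simp
      _ ≤ ∏ k ∈ Finset.range n, ((n : ℝ) / (k + 1 : ℕ) * shiftedLog ((k + 1 : ℕ) : ℝ)) := by
        refine Finset.prod_le_prod (fun _ _ => (shiftedLog_pos (Nat.cast_nonneg n)).le) ?_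
        intro k hk
        have : ((k + 1 : ℕ) : ℝ) ≤ n := by
          exact_mod_cast Nat.succ_le_of_lt (Finset.mem_range.1 hk)
        exact shiftedLog_le_div_mul (by positivity) this
      _ = (n : ℝ) ^ n / n.factorial * ∏ k ∈ Finset.range n, shiftedLog ((k + 1 : ℕ) : ℝ) := by
        rw [Finset.prod_mul_distrib, Finset.prod_div_distrib, hfac]; simp
      _ ≤ _ := by
        gcongr
        rwa [div_le_iff₀ hf]
  calc ((n : ℝ) * shiftedLog n) ^ n = (n : ℝ) ^ n * shiftedLog n ^ n := mul_pow _ _ _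
    _ ≤ (Real.exp n * n.factorial) *
        (Real.exp n * ∏ k ∈ Finset.range n, shiftedLog ((k + 1 : ℕ) : ℝ)) :=
      mul_le_mul h1 h2 (pow_nonneg (shiftedLog_pos (Nat.cast_nonneg n)).le n) (by positivity)
    _ = _ := by
      rw [Finset.prod_mul_distrib, Finset.prod_mul_distrib, hfac, Finset.prod_const,
        Finset.card_range, ← Real.exp_nat_mul, mul_two, Real.exp_add]
      ring

lemma tendsto_sum_inv_mul_shiftedLog :
    Tendsto (fun N => ∑ n ∈ Finset.range N,
      (((n + 1 : ℕ) : ℝ) * shiftedLog ((n + 1 : ℕ) : ℝ))⁻¹) atTop atTop := by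
  have hL : ∀ n : ℕ, 0 < shiftedLog n := fun n => shiftedLog_pos (Nat.cast_nonneg n)
  have hnn : ∀ n : ℕ, 0 ≤ ((n : ℝ) * shiftedLog n)⁻¹ := fun n => by have := hL n; positivity
  rw [← not_summable_iff_tendsto_nat_atTop_of_nonneg fun n => hnn (n + 1)]
  intro h
  rw [summable_nat_add_iff (f := fun n : ℕ => ((n : ℝ) * shiftedLog n)⁻¹) 1] at h
  rw [← summable_condensed_iff_of_nonneg hnn] at h
  · have h2 : Summable fun k : ℕ => (((k + 2 : ℕ) : ℝ))⁻¹ := by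
      refine h.of_nonneg_of_le (fun k => by positivity) fun k => ?_
      have h3 := hL (2 ^ k)
      have h4 : shiftedLog ((2 ^ k : ℕ) : ℝ) ≤ ((k + 2 : ℕ) : ℝ) := by
        have h5 : ((2 ^ k : ℕ) : ℝ) + Real.exp 1 ≤ 2 ^ (k + 2) := by
          have : (1 : ℝ) ≤ 2 ^ k := one_le_pow₀ (by norm_num)
          have := Real.exp_one_lt_d9
          push_cast
          rw [pow_add]
          linarith
        calc shiftedLog ((2 ^ k : ℕ) : ℝ) ≤ Real.log (2 ^ (k + 2)) :=
              Real.log_le_log (by positivity) h5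
          _ = ((k + 2 : ℕ) : ℝ) * Real.log 2 := by rw [Real.log_pow]
          _ ≤ ((k + 2 : ℕ) : ℝ) * 1 := by
              gcongr
              linarith [Real.log_two_lt_d9]
          _ = _ := mul_one _
      rw [mul_inv]
      push_cast at h4 h3 ⊢
      rw [← mul_assoc, mul_inv_cancel₀ (by positivity), one_mul]
      gcongr
    exact Real.not_summable_natCast_inv ((summable_nat_add_iff 2).1 h2)
  · intro m n hm hmn
    have h1 := hL m
    have h2 : (0 : ℝ) < m := by exact_mod_cast hm
    have h3 : (m : ℝ) ≤ n := by exact_mod_cast hmn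
    have := shiftedLog_mono h2.le h3
    gcongr

/-- Powers are dominated by `x ↦ exp (c * x / log (x + e))` with constants of order
`(n * log n) ^ n`. -/
lemma exists_pow_le_mul_exp_div_shiftedLog {c : ℝ} (hc : 0 < c) :
    ∃ D : ℝ, 1 ≤ D ∧ ∀ (n : ℕ) (x : ℝ), 0 ≤ x →
      x ^ n ≤ (D * (n * shiftedLog n)) ^ n * Real.exp (c * (x / shiftedLog x)) := by
  set K : ℝ := 24 * (6 / c) ^ 4 with hK
  have hK0 : 0 < K := by positivity
  refine ⟨1 + 2 / c + K, by have : 0 < 2 / c := by positivity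
                            linarith, fun n x hx => ?_⟩
  have hD : 0 < 1 + 2 / c + K := by positivity
  have hLx := shiftedLog_pos hx
  rcases Nat.eq_zero_or_pos n with rfl | hn
  · simpa using (by positivity : 0 ≤ c * (x / shiftedLog x))
  have hn1 : (1 : ℝ) ≤ n := by exact_mod_cast hn
  have hn0 : (0 : ℝ) < n := by linarith
  have hLn := shiftedLog_pos hn0.le
  have hLn1 := one_le_shiftedLog hn0.le
  rcases le_or_gt x ((n : ℝ) ^ 2) with hxn | hxn
  · have h1 : shiftedLog x ≤ 2 * shiftedLog n :=
      (shiftedLog_mono hx hxn).trans (shiftedLog_sq_le hn0.le)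
    set y := c * (x / (2 * shiftedLog n)) with hy
    have hy0 : 0 ≤ y := by positivity
    have hyx : y ≤ c * (x / shiftedLog x) := by rw [hy]; gcongr
    have hf : (0 : ℝ) < n.factorial := by exact_mod_cast n.factorial_pos
    have h2 : y ^ n ≤ Real.exp y * n.factorial :=
      (div_le_iff₀ hf).1 (Real.pow_div_factorial_le_exp _ hy0 n)
    have h3 : (n.factorial : ℝ) ≤ (n : ℝ) ^ n := by exact_mod_cast Nat.factorial_le_pow n
    have hxy : x = y * (2 / c * shiftedLog n) := by rw [hy]; field_simp
    calc x ^ n = y ^ n * (2 / c * shiftedLog n) ^ n := by rw [← mul_pow, ← hxy]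
      _ ≤ (Real.exp (c * (x / shiftedLog x)) * (n : ℝ) ^ n) * (2 / c * shiftedLog n) ^ n := by
        gcongr
        refine h2.trans ?_
        gcongr
      _ = (2 / c * (n * shiftedLog n)) ^ n * Real.exp (c * (x / shiftedLog x)) := by
        rw [mul_pow, mul_pow, mul_pow]; ring
      _ ≤ _ := by
        gcongr
        linarith
  · have hx1 : 1 < x := lt_of_le_of_lt (by nlinarith) hxn
    set s := Real.sqrt x with hs
    set w := Real.sqrt s with hw
    have hs2 : s ^ 2 = x := Real.sq_sqrt hx
    have hs0 : 0 ≤ s := Real.sqrt_nonneg _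
    have hw2 : w ^ 2 = s := Real.sq_sqrt hs0
    have hw0 : 0 ≤ w := Real.sqrt_nonneg _
    have hns : n ≤ s := by
      rw [hs]; exact Real.le_sqrt_of_sq_le hxn.le
    have hw1 : 1 ≤ w := by
      rw [hw]; exact Real.le_sqrt_of_sq_le (by linarith)
    have hlog : shiftedLog x ≤ 6 * w := by
      have hx4 : x = w ^ 4 := by rw [← hs2, ← hw2]; ring
      have h1 : x + Real.exp 1 ≤ 4 * w ^ 4 := by
        have := Real.exp_one_lt_d9
        have : 1 ≤ w ^ 4 := one_le_pow₀ hw1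
        linarith
      have h2 : shiftedLog x ≤ Real.log (4 * w ^ 4) := Real.log_le_log (by positivity) h1
      have h3 : Real.log (4 * w ^ 4) = 2 * Real.log 2 + 4 * Real.log w := by
        rw [Real.log_mul (by norm_num) (by positivity), Real.log_pow,
          show (4 : ℝ) = 2 ^ 2 by norm_num, Real.log_pow]
        norm_num
      have h4 := Real.log_le_sub_one_of_pos (show 0 < w by linarith)
      have := Real.log_two_lt_d9
      linarith
    have hxK : x ≤ K * Real.exp (c * w / 6) := by
      have h1 := Real.pow_div_factorial_le_exp _ (show 0 ≤ c * w / 6 by positivity) 4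
      have hx4 : x = w ^ 4 := by rw [← hs2, ← hw2]; ring
      calc x = K * ((c * w / 6) ^ 4 / (Nat.factorial 4 : ℕ)) := by
            rw [hx4, hK]; simp [Nat.factorial]; field_simp
        _ ≤ _ := by gcongr
    have hexp : (n : ℝ) * (c * w / 6) ≤ c * (x / shiftedLog x) := by
      calc (n : ℝ) * (c * w / 6) ≤ s * (c * w / 6) := by gcongr
        _ = c * (x / (6 * w)) := by
          rw [← hs2, ← hw2]; field_simp
        _ ≤ _ := by gcongr
    calc x ^ n ≤ (K * Real.exp (c * w / 6)) ^ n := by gcongr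
      _ = K ^ n * Real.exp (n * (c * w / 6)) := by rw [mul_pow, ← Real.exp_nat_mul]
      _ ≤ (1 + 2 / c + K) ^ n * Real.exp (c * (x / shiftedLog x)) := by
        gcongr
        have : 0 < 2 / c := by positivity
        linarith
      _ ≤ _ := by
        gcongr
        exact le_mul_of_one_le_right hD.le (one_le_mul_of_one_le_of_one_le hn1 hLn1)

/-- Divergence of Carleman-type sums for sequences growing at most like `(n * log n) ^ n`. -/
lemma tendsto_sum_rpow_of_le_mul_shiftedLog_pow {v : ℕ → ℝ} {A D : ℝ} (hA : 1 ≤ A) (hD : 1 ≤ D)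
    (hv0 : ∀ n, 0 < v n) (hv : ∀ n, v n ≤ A * (D * (n * shiftedLog n)) ^ (2 * n)) :
    Tendsto (fun N : ℕ => ∑ n ∈ Finset.Icc 1 N, v n ^ (-(1 : ℝ) / (2 * n))) atTop atTop := by
  have h := tendsto_sum_inv_mul_shiftedLog.const_mul_atTop (show 0 < (A * D)⁻¹ by positivity)
  refine tendsto_atTop_mono (fun N => ?_) h
  rw [Finset.range_eq_Ico, Finset.sum_Ico_add' (fun n : ℕ => ((n : ℝ) * shiftedLog n)⁻¹) 0 N 1,
    Finset.mul_sum]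
  refine Finset.sum_le_sum fun n hn => ?_
  have hn1 : 1 ≤ n := by simpa using (Finset.mem_Ico.1 hn).1
  have hn1' : (1 : ℝ) ≤ n := by exact_mod_cast hn1
  have hL := shiftedLog_pos (show (0 : ℝ) ≤ n by linarith)
  set B := D * (n * shiftedLog n) with hB
  have hB0 : 0 < B := by positivity
  have h1 : v n ≤ (A * B) ^ (2 * n) := by
    refine (hv n).trans ?_
    rw [mul_pow A B]
    gcongr
    exact le_self_pow₀ hA (by omega)
  have he : (-(1 : ℝ) / (2 * n)) ≤ 0 := div_nonpos_of_nonpos_of_nonneg (by norm_num) (by positivity)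
  calc (A * D)⁻¹ * ((n : ℝ) * shiftedLog n)⁻¹ = (A * B)⁻¹ := by
        rw [← mul_inv, hB]; ring_nf
    _ = ((A * B) ^ (2 * n)) ^ (-(1 : ℝ) / (2 * n)) := by
        rw [← Real.rpow_natCast, ← Real.rpow_mul (by positivity)]
        push_cast
        rw [mul_div_cancel₀ _ (by positivity), Real.rpow_neg_one]
    _ ≤ _ := Real.rpow_le_rpow_of_nonpos (hv0 n) h1 he

end LogGrowth

section MomentGrowth

/-- Moments growing at most like `(n * log n) ^ (2 * n)` determine a distribution on `[0, ∞)`. -/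
lemma isMomentDetOnNonneg_of_moments_le {P : Measure ℝ} [IsProbabilityMeasure P]
    (hP0 : P (Iio 0) = 0) (hP : ∀ n : ℕ, Integrable (fun x => x ^ n) P) {A D : ℝ} (hA : 1 ≤ A)
    (hD : 1 ≤ D) (hPm : ∀ n : ℕ, ∫ x, x ^ n ∂P ≤ A * (D * (n * shiftedLog n)) ^ (2 * n)) :
    IsMomentDetOnNonneg P := by
  intro Q _ hQ0 hQ
  set r : ℕ → ℝ := fun k =>
    D * (Real.exp 2 * (((k + 1 : ℕ) : ℝ) * shiftedLog ((k + 1 : ℕ) : ℝ))) with hr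
  have hL : ∀ k : ℕ, 0 < shiftedLog (k : ℝ) := fun k => shiftedLog_pos (Nat.cast_nonneg k)
  have hD0 : 0 < D := by linarith
  have hA0 : 0 < A := by linarith
  have hr0 : ∀ k, 0 < r k := fun k => by
    have := hL (k + 1)
    simp only [hr]
    positivity
  have hprod : ∀ n, 0 < ∏ k ∈ Finset.range n, r k := fun n => Finset.prod_pos fun k _ => hr0 k
  refine (ext_of_moments_of_moments_le_sq (P := P) (Q := Q)
    (m := fun n => A * ∏ k ∈ Finset.range n, r k) (r := r) hP0 hQ0 hP ?_ ?_ ?_ ?_ hr0 ?_ ?_ ?_).symm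
  · intro n
    rcases Nat.eq_zero_or_pos n with rfl | hn
    · simp
    · exact (hQ n hn).1
  · intro n
    rcases Nat.eq_zero_or_pos n with rfl | hn
    · simp
    · exact (hQ n hn).2.symm
  · intro n
    have := hprod n
    positivity
  · intro n
    refine (hPm n).trans ?_
    have h1 : (D * (n * shiftedLog n)) ^ n ≤ ∏ k ∈ Finset.range n, r k := by
      simp only [hr, Finset.prod_mul_distrib (f := fun _ => D), Finset.prod_const,
        Finset.card_range]
      rw [mul_pow]
      gcongr
      exact mul_shiftedLog_pow_le_prod n
    have h2 := hL n
    rw [mul_comm 2 n, pow_mul, mul_pow A]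
    gcongr
    exact le_self_pow₀ hA two_ne_zero
  · intro i j hij
    have h1 : ((i + 1 : ℕ) : ℝ) ≤ ((j + 1 : ℕ) : ℝ) := by exact_mod_cast Nat.succ_le_succ hij
    have h2 := shiftedLog_mono (Nat.cast_nonneg (i + 1)) h1
    have h3 := hL (i + 1)
    simp only [hr]
    gcongr
  · intro n
    simp only [Finset.prod_range_succ]
    ring
  · have h := tendsto_sum_inv_mul_shiftedLog.const_mul_atTop
      (show 0 < (D * Real.exp 2)⁻¹ by positivity)
    refine h.congr fun N => ?_
    rw [Finset.mul_sum]
    refine Finset.sum_congr rfl fun k _ => ?_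
    simp only [hr]
    rw [← mul_inv, mul_assoc]

lemma measurable_exp_mul_div_shiftedLog (c : ℝ) :
    Measurable fun x => Real.exp (c * (x / shiftedLog x)) := by
  unfold shiftedLog
  fun_prop

/-- A finite exponential moment of `x / log (x + e)` bounds the `n`-th moment by
`A * (D * n * log n) ^ n`. -/
lemma exists_moment_le_of_lintegral_exp {P : Measure ℝ} (hP0 : P (Iio 0) = 0)
    (hP : ∀ n : ℕ, Integrable (fun x => x ^ n) P) {c : ℝ} (hc : 0 < c)
    (hexp : ∫⁻ x, ENNReal.ofReal (Real.exp (c * (x / shiftedLog x))) ∂P ≠ ⊤) :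
    ∃ A D : ℝ, 1 ≤ A ∧ 1 ≤ D ∧ ∀ n : ℕ, ∫ x, x ^ n ∂P ≤ A * (D * (n * shiftedLog n)) ^ n := by
  obtain ⟨D, hD, h⟩ := exists_pow_le_mul_exp_div_shiftedLog hc
  have hi : Integrable (fun x => Real.exp (c * (x / shiftedLog x))) P :=
    (lintegral_ofReal_ne_top_iff_integrable
      (measurable_exp_mul_div_shiftedLog c).aestronglyMeasurable
      (Eventually.of_forall fun x => (Real.exp_pos _).le)).1 hexp
  refine ⟨max 1 (∫ x, Real.exp (c * (x / shiftedLog x)) ∂P), D, le_max_left _ _, hD, fun n => ?_⟩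
  have hL := shiftedLog_pos (Nat.cast_nonneg (α := ℝ) n)
  calc ∫ x, x ^ n ∂P
      ≤ ∫ x, (D * (n * shiftedLog n)) ^ n * Real.exp (c * (x / shiftedLog x)) ∂P :=
        integral_mono_ae (hP n) (hi.const_mul _)
          ((ae_nonneg_of_measure_Iio hP0).mono fun x hx => h n x hx)
    _ = (∫ x, Real.exp (c * (x / shiftedLog x)) ∂P) * (D * (n * shiftedLog n)) ^ n := by
        rw [integral_const_mul, mul_comm]
    _ ≤ _ := by
        gcongr
        exact le_max_right _ _

end MomentGrowth

section TailDecay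

variable {x₀ a α : ℝ} {μ : Measure ℝ} {g : ℝ → ℝ}

lemma setLIntegral_Ici_eq_of_density (hg_meas : Measurable g)
    (hg_ac : μ.restrict (Ici x₀) =
      (volume.restrict (Ici x₀)).withDensity (fun x => ENNReal.ofReal (g x)))
    {x₁ : ℝ} (hx₁ : x₀ ≤ x₁) {f : ℝ → ENNReal} (hf : Measurable f) :
    ∫⁻ x in Ici x₁, f x ∂μ = ∫⁻ x in Ici x₁, ENNReal.ofReal (g x) * f x := by
  have h1 : μ.restrict (Ici x₁) =
      (volume.restrict (Ici x₁)).withDensity (fun x => ENNReal.ofReal (g x)) := by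
    rw [← Measure.restrict_restrict_of_subset (Ici_subset_Ici.2 hx₁), hg_ac,
      restrict_withDensity measurableSet_Ici,
      Measure.restrict_restrict_of_subset (Ici_subset_Ici.2 hx₁)]
  rw [h1, lintegral_withDensity_eq_lintegral_mul _ hg_meas.ennreal_ofReal hf]
  rfl

lemma measure_Ici_pos_of_density (hg_meas : Measurable g)
    (hg_ac : μ.restrict (Ici x₀) =
      (volume.restrict (Ici x₀)).withDensity (fun x => ENNReal.ofReal (g x)))
    (hg_pos : ∀ x ∈ Ici x₀, 0 < g x) : 0 < μ (Ici x₀) := by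
  have h1 := setLIntegral_Ici_eq_of_density hg_meas hg_ac le_rfl (f := fun _ => 1)
    measurable_const
  simp only [mul_one, lintegral_one, Measure.restrict_apply MeasurableSet.univ, univ_inter] at h1
  rw [h1, setLIntegral_pos_iff hg_meas.ennreal_ofReal]
  have h2 : (Function.support fun x => ENNReal.ofReal (g x)) ∩ Ici x₀ = Ici x₀ :=
    inter_eq_right.2 fun x hx => by simpa using hg_pos x hx
  rw [h2]
  simp

/-- The limsup condition gives a uniform geometric contraction of the density along the shift. -/
lemma exists_eventually_le_pow_mul (hg_pos : ∀ x ∈ Ici x₀, 0 < g x) {T : ℝ → ℝ}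
    (hlimsup : Filter.limsup (fun x => ENNReal.ofReal (g (T x) / g x)) atTop < 1) :
    ∃ s : ℝ, 0 < s ∧ s < 1 ∧ ∀ᶠ x in atTop, g (T x) ≤ s ^ 3 * g x := by
  obtain ⟨b, hb1, hb2⟩ := exists_between hlimsup
  have hbt : b ≠ ⊤ := (hb2.trans ENNReal.one_lt_top).ne
  set q := b.toReal with hq
  have hq0 : 0 ≤ q := ENNReal.toReal_nonneg
  have hq1 : q < 1 := by
    rw [hq, ← ENNReal.toReal_one]
    exact (ENNReal.toReal_lt_toReal hbt ENNReal.one_ne_top).2 hb2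
  refine ⟨1 - (1 - q) / 3, by linarith, by linarith, ?_⟩
  filter_upwards [eventually_lt_of_limsup_lt hb1, eventually_ge_atTop x₀] with x hx hx0
  have hgx := hg_pos x hx0
  have h1 : g (T x) / g x ≤ q := by
    rw [hq]
    exact (ENNReal.ofReal_le_iff_le_toReal hbt).1 hx.le
  rw [div_le_iff₀ hgx] at h1
  refine h1.trans ?_
  gcongr
  nlinarith [mul_nonneg (sub_nonneg.2 hq1.le) (sub_nonneg.2 hq1.le),
    pow_nonneg (sub_nonneg.2 hq1.le) 3, mul_nonneg hq0 (sq_nonneg (1 - q))]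

lemma exp_mul_div_shiftedLog_shift_le (ha : 0 < a) (hα : α ∈ Icc (0 : ℝ) 1) {c x : ℝ} (hc : 0 < c)
    (hx : Real.exp 1 ≤ x) :
    Real.exp (c * ((x + a * Real.log x ^ α) / shiftedLog (x + a * Real.log x ^ α))) ≤
      Real.exp (c * a) * Real.exp (c * (x / shiftedLog x)) := by
  have he := Real.exp_pos 1
  have hx0 : 0 < x := he.trans_le hx
  have hlog : 1 ≤ Real.log x := (Real.le_log_iff_exp_le hx0).2 hx
  have hpow : Real.log x ^ α ≤ Real.log x := by
    simpa using Real.rpow_le_rpow_of_exponent_le hlog hα.2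
  have hpow0 : 0 ≤ Real.log x ^ α := Real.rpow_nonneg (by linarith) _
  have hL := shiftedLog_pos hx0.le
  have hlogL : Real.log x ≤ shiftedLog x := Real.log_le_log hx0 (by linarith)
  have hT : x ≤ x + a * Real.log x ^ α := by
    have : 0 ≤ a * Real.log x ^ α := by positivity
    linarith
  rw [← Real.exp_add, ← mul_add]
  gcongr
  calc (x + a * Real.log x ^ α) / shiftedLog (x + a * Real.log x ^ α)
      ≤ (x + a * Real.log x ^ α) / shiftedLog x := by
        have := shiftedLog_mono hx0.le hT
        gcongr
    _ ≤ (x + a * shiftedLog x) / shiftedLog x := by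
        gcongr
        exact hpow.trans hlogL
    _ = a + x / shiftedLog x := by field_simp; ring

lemma hasDerivAt_add_mul_log_rpow {x : ℝ} (hx : 1 < x) :
    HasDerivAt (fun x => x + a * Real.log x ^ α)
      (1 + a * (x⁻¹ * α * Real.log x ^ (α - 1))) x := by
  have h1 := (Real.hasDerivAt_log (by linarith : x ≠ 0)).rpow_const (p := α)
    (Or.inl (Real.log_pos hx).ne')
  exact (hasDerivAt_id x).add (h1.const_mul a)

lemma strictMonoOn_add_mul_log_rpow (ha : 0 < a) (hα : 0 ≤ α) :
    StrictMonoOn (fun x => x + a * Real.log x ^ α) (Ici 1) := by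
  intro x hx y _ hxy
  have hx1 : (1 : ℝ) ≤ x := hx
  have h0 := Real.log_nonneg hx1
  have h1 : Real.log x ≤ Real.log y := Real.log_le_log (by linarith) hxy.le
  have h2 := Real.rpow_le_rpow h0 h1 hα
  exact add_lt_add_of_lt_of_le hxy (by gcongr)

lemma Ici_subset_image_add_mul_log_rpow (ha : 0 < a) {x₁ : ℝ} (hx₁ : 1 < x₁) :
    Ici (x₁ + a * Real.log x₁ ^ α) ⊆ (fun x => x + a * Real.log x ^ α) '' Ici x₁ := by
  intro y hy
  have hge : ∀ x, 1 < x → x ≤ x + a * Real.log x ^ α := fun x hx => by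
    have := Real.rpow_nonneg (Real.log_pos hx).le α
    have : 0 ≤ a * Real.log x ^ α := by positivity
    linarith
  have hxy : x₁ ≤ y := (hge x₁ hx₁).trans hy
  have hcont : ContinuousOn (fun x => x + a * Real.log x ^ α) (Icc x₁ y) := fun x hx =>
    (hasDerivAt_add_mul_log_rpow (hx₁.trans_le hx.1)).continuousAt.continuousWithinAt
  obtain ⟨x, hx, hxe⟩ := intermediate_value_Icc hxy hcont ⟨hy, hge y (hx₁.trans_le hxy)⟩
  exact ⟨x, hx.1, hxe⟩

/-- If a function contracts by a factor `s < 1` under an expanding change of variables, its integral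
is controlled by the integral over one fundamental domain. -/
lemma lintegral_Ici_le_of_contraction {T T' : ℝ → ℝ} {F : ℝ → ENNReal} {x₁ s : ℝ}
    (hs0 : 0 ≤ s) (hs1 : s < 1) (hT : ∀ x ∈ Ici x₁, HasDerivAt T (T' x) x)
    (hinj : InjOn T (Ici x₁)) (hsurj : Ici (T x₁) ⊆ T '' Ici x₁)
    (hF : ∀ x ∈ Ici x₁, ENNReal.ofReal |T' x| * F (T x) ≤ ENNReal.ofReal s * F x)
    (hfin : ∫⁻ x in Ici x₁, F x ≠ ⊤) {C : ENNReal} (hC : C ≠ ⊤)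
    (hdom : ∫⁻ x in Ico x₁ (T x₁), F x ≤ C) :
    ∫⁻ x in Ici x₁, F x ≤ ENNReal.ofReal (C.toReal / (1 - s)) := by
  set J := ∫⁻ x in Ici x₁, F x with hJ
  have h1 : ∫⁻ x in Ici (T x₁), F x ≤ ENNReal.ofReal s * J := by
    calc ∫⁻ x in Ici (T x₁), F x ≤ ∫⁻ x in T '' Ici x₁, F x := lintegral_mono_set hsurj
      _ = ∫⁻ x in Ici x₁, ENNReal.ofReal |T' x| * F (T x) :=
        lintegral_image_eq_lintegral_abs_deriv_mul measurableSet_Ici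
          (fun x hx => (hT x hx).hasDerivWithinAt) hinj F
      _ ≤ ∫⁻ x in Ici x₁, ENNReal.ofReal s * F x := setLIntegral_mono' measurableSet_Ici hF
      _ = ENNReal.ofReal s * J := lintegral_const_mul' _ _ ENNReal.ofReal_ne_top
  have h2 : J ≤ C + ENNReal.ofReal s * J := by
    calc J ≤ ∫⁻ x in Ico x₁ (T x₁) ∪ Ici (T x₁), F x :=
          lintegral_mono_set fun x hx => by
            rcases lt_or_ge x (T x₁) with h | h
            · exact Or.inl ⟨hx, h⟩
            · exact Or.inr h
      _ ≤ _ := (lintegral_union_le _ _ _).trans (add_le_add hdom h1)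
  have h3 : J.toReal ≤ C.toReal + s * J.toReal := by
    have h4 := ENNReal.toReal_mono (by finiteness) h2
    rwa [ENNReal.toReal_add hC (by finiteness), ENNReal.toReal_mul, ENNReal.toReal_ofReal hs0] at h4
  rw [ENNReal.le_ofReal_iff_toReal_le hfin (div_nonneg ENNReal.toReal_nonneg (by linarith)),
    le_div_iff₀ (by linarith)]
  linarith

/-- Contraction of the density along shifts of order `(log x) ^ α` with `α ≤ 1` yields a finite
exponential moment of `x / log (x + e)`. -/
lemma exists_lintegral_exp_ne_top [IsProbabilityMeasure μ] (hx₀ : 1 < x₀) (ha : 0 < a)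
    (hα : α ∈ Icc (0 : ℝ) 1) (hsupp : μ (Iio 0) = 0) (hg_meas : Measurable g)
    (hg_ac : μ.restrict (Ici x₀) =
      (volume.restrict (Ici x₀)).withDensity (fun x => ENNReal.ofReal (g x)))
    (hg_pos : ∀ x ∈ Ici x₀, 0 < g x)
    (hlimsup : Filter.limsup
        (fun x => ENNReal.ofReal (g (x + a * (Real.log x) ^ α) / g x)) atTop < 1) :
    ∃ c : ℝ, 0 < c ∧ ∫⁻ x, ENNReal.ofReal (Real.exp (c * (x / shiftedLog x))) ∂μ ≠ ⊤ := by
  obtain ⟨s, hs0, hs1, hev⟩ := exists_eventually_le_pow_mul hg_pos hlimsup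
  have hsinv : 1 < s⁻¹ := (one_lt_inv₀ hs0).2 hs1
  set c := -Real.log s / a with hc
  have hc0 : 0 < c := div_pos (neg_pos.2 (Real.log_neg hs0 hs1)) ha
  have hca : Real.exp (c * a) = s⁻¹ := by
    rw [hc, div_mul_cancel₀ _ ha.ne', Real.exp_neg, Real.exp_log hs0]
  refine ⟨c, hc0, ?_⟩
  obtain ⟨x₁, hx₁⟩ := eventually_atTop.1 (hev.and ((eventually_ge_atTop x₀).and
    ((eventually_ge_atTop (Real.exp 1)).and (eventually_ge_atTop (a * α / (s⁻¹ - 1))))))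
  obtain ⟨-, h01, he1, -⟩ := hx₁ x₁ le_rfl
  have h11 : 1 < x₁ := hx₀.trans_le h01
  set T : ℝ → ℝ := fun x => x + a * Real.log x ^ α with hT
  set T' : ℝ → ℝ := fun x => 1 + a * (x⁻¹ * α * Real.log x ^ (α - 1)) with hT'
  set φ : ℝ → ℝ := fun x => Real.exp (c * (x / shiftedLog x)) with hφ
  have hφm : Measurable φ := measurable_exp_mul_div_shiftedLog c
  have hφle : ∀ x y, 0 ≤ x → x ≤ y → φ x ≤ Real.exp (c * y) := by
    intro x y h hxy
    simp only [hφ]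
    gcongr
    exact (div_le_self h (one_le_shiftedLog h)).trans hxy
  have hT'0 : ∀ x ∈ Ici x₁, 0 ≤ T' x ∧ T' x ≤ s⁻¹ := by
    intro x hx
    obtain ⟨-, -, hxe, hxa⟩ := hx₁ x hx
    have hx0 : 0 < x := (Real.exp_pos 1).trans_le hxe
    have hlog : 1 ≤ Real.log x := (Real.le_log_iff_exp_le hx0).2 hxe
    have hp1 : Real.log x ^ (α - 1) ≤ 1 :=
      Real.rpow_le_one_of_one_le_of_nonpos hlog (by linarith [hα.2])
    have hp0 : 0 ≤ Real.log x ^ (α - 1) := Real.rpow_nonneg (by linarith) _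
    have hα0 := hα.1
    refine ⟨by simp only [hT']; positivity, ?_⟩
    have h1 : a * (x⁻¹ * α * Real.log x ^ (α - 1)) ≤ a * (x⁻¹ * α * 1) := by gcongr
    have h2 : a * (x⁻¹ * α * 1) ≤ s⁻¹ - 1 := by
      rw [div_le_iff₀ (by linarith)] at hxa
      calc a * (x⁻¹ * α * 1) = a * α / x := by field_simp
        _ ≤ s⁻¹ - 1 := by rw [div_le_iff₀ hx0]; linarith
    simp only [hT']
    linarith
  have hmass : ∫⁻ x in Ici x₁, ENNReal.ofReal (g x) ≤ 1 := by
    have := setLIntegral_Ici_eq_of_density hg_meas hg_ac h01 (f := fun _ => 1) measurable_const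
    simp only [mul_one] at this
    rw [← this]
    simpa using prob_le_one
  set C : ENNReal := ENNReal.ofReal (Real.exp (c * T x₁)) with hC
  have hbound : ∀ K : ℕ, ∫⁻ x in Ici x₁, ENNReal.ofReal (min (φ x) K) ∂μ ≤
      ENNReal.ofReal (C.toReal / (1 - s)) := by
    intro K
    have hFm : Measurable fun x => ENNReal.ofReal (min (φ x) K) :=
      (hφm.min measurable_const).ennreal_ofReal
    rw [setLIntegral_Ici_eq_of_density hg_meas hg_ac h01 hFm]
    have hdomin : ∀ (S : Set ℝ) (hS : MeasurableSet S) (B : ℝ), S ⊆ Ici x₁ →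
        (∀ x ∈ S, min (φ x) K ≤ B) →
        ∫⁻ x in S, ENNReal.ofReal (g x) * ENNReal.ofReal (min (φ x) K) ≤ ENNReal.ofReal B := by
      intro S hS B hSx hB
      calc ∫⁻ x in S, ENNReal.ofReal (g x) * ENNReal.ofReal (min (φ x) K)
          ≤ ∫⁻ x in S, ENNReal.ofReal (g x) * ENNReal.ofReal B :=
            setLIntegral_mono' hS fun x hx => by
              gcongr
              exact hB x hx
        _ = (∫⁻ x in S, ENNReal.ofReal (g x)) * ENNReal.ofReal B :=
            lintegral_mul_const' _ _ ENNReal.ofReal_ne_top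
        _ ≤ 1 * ENNReal.ofReal B := by
            gcongr
            exact (lintegral_mono_set hSx).trans hmass
        _ = _ := one_mul _
    refine lintegral_Ici_le_of_contraction (T := T) (T' := T') hs0.le hs1
      (fun x hx => hasDerivAt_add_mul_log_rpow (h11.trans_le hx))
      ((strictMonoOn_add_mul_log_rpow ha hα.1).injOn.mono (Ici_subset_Ici.2 h11.le))
      (Ici_subset_image_add_mul_log_rpow ha h11) ?_ ?_ ENNReal.ofReal_ne_top ?_
    · intro x hx
      obtain ⟨hgx, hx0, hxe, -⟩ := hx₁ x hx
      obtain ⟨hT0, hT1⟩ := hT'0 x hx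
      have hgx0 := hg_pos x hx0
      have hφx : φ (T x) ≤ s⁻¹ * φ x := by
        rw [← hca]; exact exp_mul_div_shiftedLog_shift_le ha hα hc0 hxe
      have hφ0 : ∀ y, 0 < φ y := fun y => Real.exp_pos _
      have hmin : min (φ (T x)) K ≤ s⁻¹ * min (φ x) K := by
        rw [mul_min_of_nonneg _ _ (by positivity)]
        exact min_le_min hφx (le_mul_of_one_le_left (Nat.cast_nonneg K) hsinv.le)
      have hmin0 : ∀ y, 0 ≤ min (φ y) K := fun y => le_min (hφ0 y).le (Nat.cast_nonneg K)
      rw [abs_of_nonneg hT0, ← ENNReal.ofReal_mul' (hmin0 _), ← ENNReal.ofReal_mul hT0,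
        ← ENNReal.ofReal_mul' (hmin0 _), ← ENNReal.ofReal_mul hs0.le]
      refine ENNReal.ofReal_le_ofReal ?_
      have h0 := hmin0 (T x)
      have h0' := hmin0 x
      have hTx : x ≤ T x := by
        have := Real.rpow_nonneg (Real.log_pos (hx₀.trans_le hx0)).le α
        have : 0 ≤ a * Real.log x ^ α := by positivity
        simp only [hT]
        linarith
      have hgT := hg_pos (T x) (hx0.trans hTx)
      calc T' x * (g (T x) * min (φ (T x)) K)
          ≤ s⁻¹ * ((s ^ 3 * g x) * (s⁻¹ * min (φ x) K)) := by
            gcongr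
        _ = s * (g x * min (φ x) K) := by field_simp
    · exact ((hdomin _ measurableSet_Ici K subset_rfl fun x _ => min_le_right _ _).trans_lt
        ENNReal.ofReal_lt_top).ne
    · exact hdomin _ measurableSet_Ico _ Ico_subset_Ici_self fun x hx =>
        (min_le_left _ _).trans (hφle x _ (by linarith [hx.1]) hx.2.le)
  have htail : ∫⁻ x in Ici x₁, ENNReal.ofReal (φ x) ∂μ ≤ ENNReal.ofReal (C.toReal / (1 - s)) := by
    refine le_of_tendsto' (lintegral_tendsto_of_tendsto_of_monotone
      (f := fun (K : ℕ) x => ENNReal.ofReal (min (φ x) K)) (μ := μ.restrict (Ici x₁))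
      (fun K => (hφm.min measurable_const).ennreal_ofReal.aemeasurable) ?_ ?_) hbound
    · refine Eventually.of_forall fun x i j hij => ENNReal.ofReal_le_ofReal ?_
      have : (i : ℝ) ≤ j := by exact_mod_cast hij
      exact min_le_min_left _ this
    · refine Eventually.of_forall fun x => tendsto_const_nhds.congr' ?_
      obtain ⟨k, hk⟩ := exists_nat_ge (φ x)
      filter_upwards [eventually_ge_atTop k] with i hi
      have : (k : ℝ) ≤ i := by exact_mod_cast hi
      rw [min_eq_left (hk.trans this)]
  have hhead : ∫⁻ x in Iio x₁, ENNReal.ofReal (φ x) ∂μ ≤ ENNReal.ofReal (Real.exp (c * x₁)) := by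
    calc ∫⁻ x in Iio x₁, ENNReal.ofReal (φ x) ∂μ
        ≤ ∫⁻ x in Iio x₁, ENNReal.ofReal (Real.exp (c * x₁)) ∂μ := by
          refine lintegral_mono_ae ?_
          filter_upwards [ae_restrict_mem measurableSet_Iio,
            ae_restrict_of_ae (ae_nonneg_of_measure_Iio hsupp)] with x hx hx0
          exact ENNReal.ofReal_le_ofReal (hφle x x₁ hx0 (le_of_lt hx))
      _ ≤ ENNReal.ofReal (Real.exp (c * x₁)) * 1 := by
          rw [setLIntegral_const]
          gcongr
          exact prob_le_one
      _ = _ := mul_one _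
  rw [← lintegral_add_compl _ (measurableSet_Ici (a := x₁)), compl_Ici]
  exact (ENNReal.add_lt_top.2 ⟨htail.trans_lt ENNReal.ofReal_lt_top,
    hhead.trans_lt ENNReal.ofReal_lt_top⟩).ne

lemma integral_pow_pos (hmom : ∀ n : ℕ, Integrable (fun x => x ^ n) μ) (hsupp : μ (Iio 0) = 0)
    (hx₀ : 0 < x₀) (hμ : 0 < μ (Ici x₀)) (n : ℕ) : 0 < ∫ x, x ^ n ∂μ := by
  rw [integral_pos_iff_support_of_nonneg_ae
    ((ae_nonneg_of_measure_Iio hsupp).mono fun x hx => pow_nonneg hx n) (hmom n)]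
  refine hμ.trans_le (measure_mono fun x hx => ?_)
  have : 0 < x := hx₀.trans_le hx
  exact (pow_pos this n).ne'

end TailDecay

/-- Corollary 7: if `limsup_{x→∞} g(x + a (log x)^α)/g(x) < 1` with `a > 0`,
`α ∈ [0,1]`, `x₀ > 1`, then `∑ ν_n^{-1/(2n)} = ∞`, `∑ ν_{2n}^{-1/(2n)} = ∞`,
and both `Y` and `Y²` are M-det on `[0,∞)`. -/
theorem corollary7
    (x₀ : ℝ) (hx₀ : 1 < x₀)
    (a α : ℝ) (ha : 0 < a) (hα : α ∈ Icc (0 : ℝ) 1)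
    (μ : Measure ℝ) [IsProbabilityMeasure μ]
    (hsupp : μ (Iio 0) = 0)
    (hmom : ∀ n : ℕ, Integrable (fun x => x ^ n) μ)
    (g : ℝ → ℝ) (hg_meas : Measurable g)
    (hg_ac : μ.restrict (Ici x₀) =
      (volume.restrict (Ici x₀)).withDensity (fun x => ENNReal.ofReal (g x)))
    (hg_pos : ∀ x ∈ Ici x₀, 0 < g x)
    (hlimsup : Filter.limsup
        (fun x => ENNReal.ofReal (g (x + a * (Real.log x) ^ α) / g x)) atTop < 1) :
    Tendsto (fun N : ℕ => ∑ n ∈ Finset.Icc 1 N,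
        (∫ x, x ^ n ∂μ) ^ (-(1 : ℝ) / (2 * n))) atTop atTop ∧
    Tendsto (fun N : ℕ => ∑ n ∈ Finset.Icc 1 N,
        (∫ x, x ^ (2 * n) ∂μ) ^ (-(1 : ℝ) / (2 * n))) atTop atTop ∧
    IsMomentDetOnNonneg μ ∧
    IsMomentDetOnNonneg (μ.map (fun x => x ^ 2)) := by
  obtain ⟨c, hc, hexp⟩ :=
    exists_lintegral_exp_ne_top hx₀ ha hα hsupp hg_meas hg_ac hg_pos hlimsup
  obtain ⟨A, D, hA, hD, hAD⟩ := exists_moment_le_of_lintegral_exp hsupp hmom hc hexp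
  have hpos := integral_pow_pos hmom hsupp (by linarith)
    (measure_Ici_pos_of_density hg_meas hg_ac hg_pos)
  have hL : ∀ n : ℕ, 1 ≤ shiftedLog n := fun n => one_le_shiftedLog (Nat.cast_nonneg n)
  have hbound : ∀ n : ℕ, ∫ x, x ^ n ∂μ ≤ A * (D * (n * shiftedLog n)) ^ (2 * n) := by
    intro n
    refine (hAD n).trans ?_
    rcases Nat.eq_zero_or_pos n with rfl | hn
    · simp
    · have hn1 : (1 : ℝ) ≤ n := by exact_mod_cast hn
      have h1 : 1 ≤ D * (n * shiftedLog n) :=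
        one_le_mul_of_one_le_of_one_le hD (one_le_mul_of_one_le_of_one_le hn1 (hL n))
      gcongr ?_ * ?_
      exact pow_le_pow_right₀ h1 (by omega)
  have hbound_two_mul : ∀ n : ℕ,
      ∫ x, x ^ (2 * n) ∂μ ≤ A * (4 * D * (n * shiftedLog n)) ^ (2 * n) := by
    intro n
    refine (hAD (2 * n)).trans ?_
    have h1 := shiftedLog_two_mul_le (Nat.cast_nonneg (α := ℝ) n)
    have h2 := shiftedLog_pos (show (0 : ℝ) ≤ 2 * n by positivity)
    push_cast
    gcongr ?_ * ?_ ^ _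
    calc D * (2 * n * shiftedLog (2 * n)) ≤ D * (2 * n * (2 * shiftedLog n)) := by gcongr
      _ = _ := by ring
  have hm : Measurable fun x : ℝ => x ^ 2 := by fun_prop
  refine ⟨tendsto_sum_rpow_of_le_mul_shiftedLog_pow hA hD hpos hbound,
    tendsto_sum_rpow_of_le_mul_shiftedLog_pow hA (by linarith) (fun n => hpos (2 * n))
      hbound_two_mul,
    isMomentDetOnNonneg_of_moments_le hsupp hmom hA hD hbound, ?_⟩
  have : IsProbabilityMeasure (μ.map fun x => x ^ 2) :=
    Measure.isProbabilityMeasure_map hm.aemeasurable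
  refine isMomentDetOnNonneg_of_moments_le ?_ (fun n => ?_) hA (D := 4 * D) (by linarith)
    fun n => ?_
  · rw [Measure.map_apply hm measurableSet_Iio]
    convert! measure_empty (μ := μ)
    ext x
    simp [sq_nonneg]
  · rw [integrable_map_measure (by fun_prop) hm.aemeasurable]
    simpa [Function.comp_def, ← pow_mul] using hmom (2 * n)
  · rw [integral_map hm.aemeasurable (by fun_prop)]
    simpa only [← pow_mul] using hbound_two_mul n
end

section
/- Let Y be a random variable taking values in [0,∞) with distribution function G having finite moments of all positive integer orders, such that G is absolutely continuous on [x₀,∞) for some x₀ > e, with density g(x) = G′(x) > 0 there. Let a > 0 and α ∈ [0,1). If limsup_{x→∞} g(x + a·(log x)^α + log log x) / g(x) < 1, then the distributions of both Y and Y² are uniquely determined by their moments among all probability distributions on [0,∞). -/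
open MeasureTheory Filter Set

/-- A Bang-type propagation step: if all derivatives are small at `t`, they stay small nearby. -/
theorem bang_step {F : ℕ → ℝ → ℂ} {A : ℝ} {r : ℕ → ℝ} (hA : 0 ≤ A) (hr : ∀ n, 0 < r n)
    (hmono : Monotone r) (hF : ∀ n t, HasDerivAt (F n) (F (n + 1) t) t)
    (hbound : ∀ n t, ‖F n t‖ ≤ A * ∏ j ∈ Finset.range n, r j) {N : ℕ} {t s : ℝ}
    (hs : 0 ≤ s) (hsr : s * (Real.exp 1 * r N) ≤ 1)
    (ht : ∀ n : ℕ, ‖F n t‖ ≤ Real.exp ((n : ℝ) - (N + 1)) * (A * ∏ j ∈ Finset.range n, r j)) (n : ℕ) :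
    ‖F n (t + s)‖ ≤ Real.exp ((n : ℝ) - N) * (A * ∏ j ∈ Finset.range n, r j) := by
  set M : ℕ → ℝ := fun n => A * ∏ j ∈ Finset.range n, r j with hM
  have hM0 : ∀ n, 0 ≤ M n := fun n => mul_nonneg hA (Finset.prod_nonneg fun j _ => (hr j).le)
  have hMsucc : ∀ n, M (n + 1) = M n * r n := fun n => by
    simp only [hM, Finset.prod_range_succ, mul_assoc]
  set c : ℝ := Real.exp 1 * r N with hc
  have hc0 : 0 ≤ c := mul_nonneg (Real.exp_pos _).le (hr N).le
  have key : ∀ d n : ℕ, n + d = N + 1 → ∀ σ, 0 ≤ σ →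
      ‖F n (t + σ)‖ ≤ Real.exp ((n : ℝ) - (N + 1)) * M n * Real.exp (c * σ) := by
    intro d
    induction d with
    | zero =>
      intro n hn σ hσ
      have : (n : ℝ) = N + 1 := by exact_mod_cast hn
      rw [this, sub_self, Real.exp_zero, one_mul]
      exact (hbound n _).trans
        (le_mul_of_one_le_right (hM0 n) (Real.one_le_exp (mul_nonneg hc0 hσ)))
    | succ d ih =>
      intro n hn σ hσ
      have hd : ∀ x, HasDerivAt (fun σ => F n (t + σ)) (F (n + 1) (t + x)) x := fun x => by
        simpa using HasDerivAt.comp_const_add t x (hF n (t + x))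
      have hB : ∀ x, HasDerivAt
          (fun σ => Real.exp ((n : ℝ) - (N + 1)) * M n * Real.exp (c * σ))
          (Real.exp ((n : ℝ) - (N + 1)) * M n * (Real.exp (c * x) * c)) x := fun x => by
        have := ((hasDerivAt_id x).const_mul c).exp
        simpa using this.const_mul (Real.exp ((n : ℝ) - (N + 1)) * M n)
      refine image_norm_le_of_norm_deriv_right_le_deriv_boundary (a := 0) (b := σ)
        (f := fun σ => F n (t + σ))
        (fun x _ => (hd x).continuousAt.continuousWithinAt)
        (fun x _ => (hd x).hasDerivWithinAt) ?_ hB ?_ ⟨hσ, le_rfl⟩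
      · simpa using ht n
      · intro x hx
        refine (ih (n + 1) (by omega) x hx.1).trans ?_
        have hrn : r n ≤ r N := hmono (by omega)
        rw [hMsucc, hc, Nat.cast_succ,
          show ((n : ℝ) + 1 - (N + 1)) = ((n : ℝ) - (N + 1)) + 1 by ring, Real.exp_add]
        have h1 := mul_le_mul_of_nonneg_left hrn
          (mul_nonneg (mul_nonneg (mul_nonneg (Real.exp_pos ((n : ℝ) - (N + 1))).le (hM0 n))
            (Real.exp_pos (Real.exp 1 * r N * x)).le) (Real.exp_pos 1).le)
        linarith
  rcases le_or_gt n (N + 1) with hn | hn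
  · refine (key (N + 1 - n) n (by omega) s hs).trans ?_
    have h1 : Real.exp (c * s) ≤ Real.exp 1 := Real.exp_le_exp.2 (by linarith)
    have h2 := mul_le_mul_of_nonneg_left h1
      (mul_nonneg (Real.exp_pos ((n : ℝ) - (N + 1))).le (hM0 n))
    refine h2.trans (le_of_eq ?_)
    rw [mul_right_comm, ← Real.exp_add]
    congr 2
    ring
  · refine (hbound n _).trans (le_mul_of_one_le_left (hM0 n) (Real.one_le_exp ?_))
    have : (N : ℝ) + 1 < n := by exact_mod_cast hn
    linarith

/-- A quasi-analyticity theorem of Denjoy and Carleman. -/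
theorem eq_zero_of_quasianalytic {F : ℕ → ℝ → ℂ} {A : ℝ} {r : ℕ → ℝ} (hA : 0 ≤ A)
    (hr : ∀ n, 0 < r n) (hmono : Monotone r)
    (hdiv : Tendsto (fun n => ∑ j ∈ Finset.range n, (r j)⁻¹) atTop atTop)
    (hF : ∀ n t, HasDerivAt (F n) (F (n + 1) t) t)
    (hbound : ∀ n t, ‖F n t‖ ≤ A * ∏ j ∈ Finset.range n, r j) (hzero : ∀ n, F n 0 = 0)
    {t : ℝ} (ht : 0 ≤ t) : F 0 t = 0 := by
  have step : ∀ k d : ℕ, ∀ t₀ s : ℝ, 0 ≤ s →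
      s * Real.exp 1 ≤ ∑ j ∈ Finset.range d, (r (k + j))⁻¹ →
      (∀ n : ℕ, ‖F n t₀‖ ≤
        Real.exp ((n : ℝ) - (k + d : ℕ)) * (A * ∏ j ∈ Finset.range n, r j)) →
      ∀ n : ℕ, ‖F n (t₀ + s)‖ ≤
        Real.exp ((n : ℝ) - k) * (A * ∏ j ∈ Finset.range n, r j) := by
    intro k d
    induction d with
    | zero =>
      intro t₀ s hs hsum h n
      have : s = 0 := by
        have := Real.exp_pos 1
        simp only [Finset.range_zero, Finset.sum_empty] at hsum
        nlinarith
      simpa [this] using h n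
    | succ d ih =>
      intro t₀ s hs hsum h n
      have hpos := mul_pos (Real.exp_pos 1) (hr (k + d))
      have hmin : 0 ≤ min s (Real.exp 1 * r (k + d))⁻¹ := le_min hs (inv_pos.2 hpos).le
      have h1 := bang_step hA hr hmono hF hbound (N := k + d) (t := t₀) hmin
        (by
          calc _ ≤ (Real.exp 1 * r (k + d))⁻¹ * (Real.exp 1 * r (k + d)) :=
                mul_le_mul_of_nonneg_right (min_le_right _ _) hpos.le
            _ = 1 := inv_mul_cancel₀ hpos.ne')
        (by intro n; convert h n using 4; push_cast; ring)
      have h2 := ih (t₀ + min s (Real.exp 1 * r (k + d))⁻¹)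
        (s - min s (Real.exp 1 * r (k + d))⁻¹) (sub_nonneg.2 (min_le_left _ _)) ?_ h1 n
      · simpa using h2
      · rcases min_cases s (Real.exp 1 * r (k + d))⁻¹ with ⟨h3, -⟩ | ⟨h3, -⟩
        · rw [h3, sub_self, zero_mul]
          exact Finset.sum_nonneg fun j _ => (inv_pos.2 (hr _)).le
        · rw [h3, sub_mul]
          rw [Finset.sum_range_succ] at hsum
          have : (Real.exp 1 * r (k + d))⁻¹ * Real.exp 1 = (r (k + d))⁻¹ := by
            have := Real.exp_ne_zero 1
            have := (hr (k + d)).ne'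
            field_simp
          linarith
  have small : ∀ k : ℕ, ‖F 0 t‖ ≤ Real.exp (-(k : ℝ)) * A := by
    intro k
    obtain ⟨d, hd⟩ := (hdiv.eventually_ge_atTop
      (t * Real.exp 1 + ∑ j ∈ Finset.range k, (r j)⁻¹)).exists_forall_of_atTop
    have hd' := hd (k + d) (by omega)
    rw [Finset.sum_range_add] at hd'
    have := step k d 0 t ht (by linarith) (fun n => by
      rw [hzero, norm_zero]
      exact mul_nonneg (Real.exp_pos _).le
        (mul_nonneg hA (Finset.prod_nonneg fun j _ => (hr j).le))) 0
    simpa using this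
  have hlim : Tendsto (fun k : ℕ => Real.exp (-(k : ℝ)) * A) atTop (nhds 0) := by
    simpa using (Real.tendsto_exp_neg_atTop_nhds_zero.comp
      tendsto_natCast_atTop_atTop).mul_const A
  exact norm_le_zero_iff.1 (ge_of_tendsto' hlim small)

/-- Carleman's criterion on the real line, for a regular sequence of moment bounds. -/
theorem Measure.eq_of_moments_eq_of_carleman {P Q : Measure ℝ} [IsProbabilityMeasure P]
    [IsProbabilityMeasure Q] {A : ℝ} {r : ℕ → ℝ} (hr : ∀ n, 0 < r n) (hmono : Monotone r)
    (hdiv : Tendsto (fun n => ∑ j ∈ Finset.range n, (r j)⁻¹) atTop atTop)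
    (hP : ∀ n : ℕ, Integrable (fun x => x ^ n) P) (hQ : ∀ n : ℕ, Integrable (fun x => x ^ n) Q)
    (hPQ : ∀ n : ℕ, ∫ x, x ^ n ∂P = ∫ x, x ^ n ∂Q)
    (hPA : ∀ n : ℕ, ∫ x, |x| ^ n ∂P ≤ A * ∏ j ∈ Finset.range n, r j)
    (hQA : ∀ n : ℕ, ∫ x, |x| ^ n ∂Q ≤ A * ∏ j ∈ Finset.range n, r j) : P = Q := by
  have memLp : ∀ (ρ : Measure ℝ) [IsProbabilityMeasure ρ],
      (∀ n : ℕ, Integrable (fun x => x ^ n) ρ) → ∀ n : ℕ, MemLp id n ρ := by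
    intro ρ _ hρ n
    rcases Nat.eq_zero_or_pos n with rfl | hn
    · simpa using aestronglyMeasurable_id
    · refine (integrable_norm_rpow_iff aestronglyMeasurable_id (by simpa using hn.ne') (by simp)).1 ?_
      simpa [norm_pow] using (hρ n).norm
  have hPm := memLp P hP
  have hQm := memLp Q hQ
  have smooth : ∀ (ρ : Measure ℝ) [IsProbabilityMeasure ρ], (∀ n : ℕ, MemLp id n ρ) →
      ∀ n t, HasDerivAt (iteratedDeriv n (charFun ρ)) (iteratedDeriv (n + 1) (charFun ρ) t) t := by
    intro ρ _ hρ n t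
    rw [iteratedDeriv_succ]
    refine DifferentiableAt.hasDerivAt ?_
    exact ((contDiff_charFun (hρ (n + 1))).differentiable_iteratedDeriv n
      (by exact_mod_cast Nat.lt_succ_self n)).differentiableAt
  have bd : ∀ (ρ : Measure ℝ) [IsProbabilityMeasure ρ], (∀ n : ℕ, MemLp id n ρ) →
      ∀ n t, ‖iteratedDeriv n (charFun ρ) t‖ ≤ ∫ x, |x| ^ n ∂ρ := by
    intro ρ _ hρ n t
    rw [iteratedDeriv_charFun (hρ n), norm_mul, norm_pow, Complex.norm_I, one_pow, one_mul]
    refine (norm_integral_le_integral_norm _).trans (le_of_eq ?_)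
    congr 1 with x
    rw [norm_mul, norm_pow, Complex.norm_real, Real.norm_eq_abs,
      ← Complex.ofReal_mul, Complex.norm_exp_ofReal_mul_I, mul_one]
  have hA : 0 ≤ A := by
    have := (integral_nonneg (μ := P) fun x => by positivity).trans (hPA 0)
    simpa using this
  have hpos : ∀ t : ℝ, 0 ≤ t → charFun P t = charFun Q t := by
    intro t ht
    have := eq_zero_of_quasianalytic
      (F := fun n t => iteratedDeriv n (charFun P) t - iteratedDeriv n (charFun Q) t)
      (A := A + A) (r := r) (by linarith) hr hmono hdiv
      (fun n t => (smooth P hPm n t).sub (smooth Q hQm n t))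
      (fun n t => (norm_sub_le _ _).trans (by
        rw [add_mul]
        exact add_le_add ((bd P hPm n t).trans (hPA n)) ((bd Q hQm n t).trans (hQA n))))
      (fun n => by
        rw [iteratedDeriv_charFun_zero (hPm n), iteratedDeriv_charFun_zero (hQm n)]
        simp [hPQ]) ht
    simpa [sub_eq_zero] using this
  refine Measure.ext_of_charFun (funext fun t => ?_)
  rcases le_total 0 t with ht | ht
  · exact hpos t ht
  · have := hpos (-t) (by linarith)
    rwa [charFun_neg, charFun_neg, (starRingEnd ℂ).injective.eq_iff] at this

/-- If a map `T` pushes the density `p` forward with a contraction that beats the growth of the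
weight `F` along `T`, then the weighted tail integral of `p` is finite. -/
theorem lintegral_lt_top_of_contraction {p F : ℝ → ENNReal} (hp : Measurable p) (hF : Measurable F)
    {T T' : ℝ → ℝ} {x₁ τ : ℝ} {ρ c b : ENNReal}
    (hT : ∀ x ∈ Ici x₁, HasDerivAt T (T' x) x) (hT'pos : ∀ x ∈ Ici x₁, 0 < T' x)
    (hT'le : ∀ x ∈ Ici x₁, T' x ≤ τ) (hTge : ∀ x ∈ Ici x₁, x ≤ T x)
    (hpT : ∀ x ∈ Ici x₁, p (T x) ≤ ρ * p x) (hFT : ∀ x ∈ Ici x₁, F (T x) ≤ c * F x)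
    (hc : 1 ≤ c) (hq : ENNReal.ofReal τ * c * ρ < 1) (hb : b ≠ ⊤)
    (hFb : ∀ x ∈ Icc x₁ (T x₁), F x ≤ b) (hpint : ∫⁻ x in Ici x₁, p x ≠ ⊤) :
    ∫⁻ x in Ici x₁, F x * p x < ⊤ := by
  set q := ENNReal.ofReal τ * c * ρ with hqdef
  set B := b * ∫⁻ x in Ici x₁, p x with hB
  have hcont : ContinuousOn T (Ici x₁) := fun x hx => (hT x hx).continuousAt.continuousWithinAt
  have hmono : StrictMonoOn T (Ici x₁) := by
    refine strictMonoOn_of_deriv_pos (convex_Ici _) hcont fun x hx => ?_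
    have hx' : x ∈ Ici x₁ := interior_subset hx
    rw [(hT x hx').deriv]
    exact hT'pos x hx'
  have hcover : Ici x₁ ⊆ Icc x₁ (T x₁) ∪ T '' Ici x₁ := by
    intro y hy
    rcases le_total y (T x₁) with h | h
    · exact Or.inl ⟨hy, h⟩
    · obtain ⟨z, hz, rfl⟩ := intermediate_value_Icc (mem_Ici.1 hy)
        (hcont.mono Icc_subset_Ici_self) ⟨h, hTge y hy⟩
      exact Or.inr ⟨z, hz.1, rfl⟩
  have hm : ∀ N : ℕ, Measurable fun x => min (F x) (N : ENNReal) * p x := fun N =>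
    (hF.min measurable_const).mul hp
  have bound : ∀ N : ℕ, ∫⁻ x in Ici x₁, min (F x) N * p x ≤ B / (1 - q) := by
    intro N
    set J := ∫⁻ x in Ici x₁, min (F x) N * p x with hJ
    have hJfin : J ≠ ⊤ := by
      refine ne_top_of_le_ne_top (ENNReal.mul_ne_top (ENNReal.natCast_ne_top N) hpint) ?_
      rw [← lintegral_const_mul _ hp]
      exact lintegral_mono fun x => mul_le_mul' (min_le_right _ _) le_rfl
    have h1 : ∫⁻ x in Icc x₁ (T x₁), min (F x) N * p x ≤ B := by
      calc _ ≤ ∫⁻ x in Icc x₁ (T x₁), b * p x :=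
            setLIntegral_mono' measurableSet_Icc fun x hx =>
              mul_le_mul' ((min_le_left _ _).trans (hFb x hx)) le_rfl
        _ ≤ ∫⁻ x in Ici x₁, b * p x := lintegral_mono_set Icc_subset_Ici_self
        _ = B := lintegral_const_mul _ hp
    have h2 : ∫⁻ x in T '' Ici x₁, min (F x) N * p x ≤ q * J := by
      rw [lintegral_image_eq_lintegral_abs_deriv_mul measurableSet_Ici
        (fun x hx => (hT x hx).hasDerivWithinAt) hmono.injOn, hJ,
        ← lintegral_const_mul _ (hm N)]
      refine setLIntegral_mono' measurableSet_Ici fun x hx => ?_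
      have h3 : min (F (T x)) N ≤ c * min (F x) N := by
        rw [mul_min]
        exact min_le_min (hFT x hx) (le_mul_of_one_le_left' hc)
      have h4 : ENNReal.ofReal |T' x| ≤ ENNReal.ofReal τ := by
        rw [abs_of_pos (hT'pos x hx)]
        exact ENNReal.ofReal_le_ofReal (hT'le x hx)
      calc _ ≤ ENNReal.ofReal τ * ((c * min (F x) N) * (ρ * p x)) :=
            mul_le_mul' h4 (mul_le_mul' h3 (hpT x hx))
        _ = q * (min (F x) N * p x) := by rw [hqdef]; ring
    have h5 : J ≤ B + q * J :=
      ((lintegral_mono_set hcover).trans (lintegral_union_le _ _ _)).trans (add_le_add h1 h2)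
    rw [ENNReal.le_div_iff_mul_le (Or.inl (tsub_pos_of_lt hq).ne')
      (Or.inl (ENNReal.sub_ne_top ENNReal.one_ne_top)), mul_comm,
      ENNReal.sub_mul fun _ _ => hJfin, one_mul]
    exact tsub_le_iff_right.2 h5
  have hsup : ∀ x, F x * p x = ⨆ N : ℕ, min (F x) N * p x := fun x => by
    rw [← ENNReal.iSup_mul, ← inf_iSup_eq, ENNReal.iSup_natCast, inf_top_eq]
  simp_rw [hsup]
  rw [lintegral_iSup hm fun m n hmn x =>
    mul_le_mul' (min_le_min le_rfl (Nat.cast_le.2 hmn)) le_rfl]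
  refine (iSup_le bound).trans_lt (ENNReal.div_lt_top ?_ (tsub_pos_of_lt hq).ne')
  exact ENNReal.mul_ne_top hb hpint

/-- The density condition yields a finite exponential moment of `x / log x`. -/
theorem exists_lintegral_exp_div_log_lt_top {x₀ a α : ℝ} (ha : 0 < a) (hα : α ∈ Ico (0 : ℝ) 1)
    {μ : Measure ℝ} [IsProbabilityMeasure μ] {g : ℝ → ℝ} (hg_meas : Measurable g)
    (hg_ac : μ.restrict (Ici x₀) =
      (volume.restrict (Ici x₀)).withDensity (fun x => ENNReal.ofReal (g x)))
    (hg_pos : ∀ x ∈ Ici x₀, 0 < g x)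
    (hlimsup : Filter.limsup
        (fun x => ENNReal.ofReal
          (g (x + a * (Real.log x) ^ α + Real.log (Real.log x)) / g x)) atTop < 1) :
    ∃ δ > 0, ∃ x₁, Real.exp 1 < x₁ ∧
      ∫⁻ x in Ici x₁, ENNReal.ofReal (Real.exp (δ * (x / Real.log x))) ∂μ < ⊤ := by
  obtain ⟨ρ, hρ, hρ1⟩ := exists_between hlimsup
  have hρtop : ρ ≠ ⊤ := (hρ1.trans ENNReal.one_lt_top).ne
  obtain ⟨η, hη, hηq⟩ : ∃ η : ℝ, 0 < η ∧ Real.exp (2 * η) * ρ.toReal < 1 := by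
    have hlim : Tendsto (fun η : ℝ => Real.exp (2 * η) * ρ.toReal) (nhdsWithin 0 (Ioi 0))
        (nhds (Real.exp (2 * 0) * ρ.toReal)) :=
      (Continuous.tendsto (by fun_prop) 0).mono_left nhdsWithin_le_nhds
    have hlt : Real.exp (2 * 0) * ρ.toReal < 1 := by
      simpa using (ENNReal.toReal_lt_toReal hρtop ENNReal.one_ne_top).2 hρ1
    obtain ⟨η, h1, h2⟩ := ((hlim.eventually_lt_const hlt).and self_mem_nhdsWithin).exists
    exact ⟨η, h2, h1⟩
  obtain ⟨X, hX⟩ := (eventually_lt_of_limsup_lt hρ).exists_forall_of_atTop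
  set x₁ := max (max x₀ X) (max (Real.exp 1 + 1) ((a + 1) / η)) with hx₁
  have hx₁0 : x₀ ≤ x₁ := (le_max_left _ _).trans (le_max_left _ _)
  have hx₁X : X ≤ x₁ := (le_max_right _ _).trans (le_max_left _ _)
  have hx₁e : Real.exp 1 < x₁ :=
    (lt_add_one _).trans_le ((le_max_left _ _).trans (le_max_right _ _))
  have hx₁η : (a + 1) / η ≤ x₁ := (le_max_right _ _).trans (le_max_right _ _)
  have hlog : ∀ x ∈ Ici x₁, 1 < Real.log x := fun x hx => by
    rw [Real.lt_log_iff_exp_lt ((Real.exp_pos 1).trans (hx₁e.trans_le hx))]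
    exact hx₁e.trans_le hx
  have hpos : ∀ x ∈ Ici x₁, 0 < x := fun x hx => (Real.exp_pos 1).trans (hx₁e.trans_le hx)
  have hδ : 0 < η / (a + 1) := by positivity
  refine ⟨η / (a + 1), hδ, x₁, hx₁e, ?_⟩
  set δ := η / (a + 1) with hδdef
  set T : ℝ → ℝ := fun x => x + a * (Real.log x) ^ α + Real.log (Real.log x) with hTdef
  have hTge : ∀ x ∈ Ici x₁, x ≤ T x := fun x hx => by
    have h1 := Real.rpow_nonneg (zero_le_one.trans (hlog x hx).le) α
    have h2 := Real.log_nonneg (hlog x hx).le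
    have := mul_nonneg ha.le h1
    simp only [hTdef]
    linarith
  have hμ : ∀ f : ℝ → ENNReal, Measurable f → ∫⁻ x in Ici x₁, f x ∂μ =
      ∫⁻ x in Ici x₁, f x * ENNReal.ofReal (g x) := by
    intro f hf
    have h1 : μ.restrict (Ici x₁) =
        (volume.restrict (Ici x₁)).withDensity (fun x => ENNReal.ofReal (g x)) := by
      have h2 := congrArg (fun m => Measure.restrict m (Ici x₁)) hg_ac
      simp only [restrict_withDensity measurableSet_Ici,
        Measure.restrict_restrict measurableSet_Ici,
        inter_eq_left.2 (Ici_subset_Ici.2 hx₁0)] at h2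
      exact h2
    rw [h1, lintegral_withDensity_eq_lintegral_mul _ hg_meas.ennreal_ofReal hf]
    simp [mul_comm]
  have hFm : Measurable fun x : ℝ => ENNReal.ofReal (Real.exp (δ * (x / Real.log x))) := by
    have := Real.measurable_log
    fun_prop
  rw [hμ _ hFm]
  refine lintegral_lt_top_of_contraction (T := T)
    (T' := fun x => 1 + a * (x⁻¹ * α * (Real.log x) ^ (α - 1)) + x⁻¹ / Real.log x)
    (τ := Real.exp η) (ρ := ρ) (c := ENNReal.ofReal (Real.exp η))
    (b := ENNReal.ofReal (Real.exp (δ * T x₁))) hg_meas.ennreal_ofReal hFm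
    ?_ ?_ ?_ hTge ?_ ?_ ?_ ?_ ENNReal.ofReal_ne_top ?_ ?_
  · intro x hx
    have h1 := Real.hasDerivAt_log (hpos x hx).ne'
    have h2 : Real.log x ≠ 0 := (zero_lt_one.trans (hlog x hx)).ne'
    exact ((hasDerivAt_id x).add ((h1.rpow_const (p := α) (Or.inl h2)).const_mul a)).add
      (h1.log h2)
  · intro x hx
    have h1 := Real.rpow_nonneg (zero_le_one.trans (hlog x hx).le) (α - 1)
    have h2 := hpos x hx
    have h3 := hlog x hx
    have h4 := hα.1
    positivity
  · intro x hx
    have h1 : Real.log x ^ (α - 1) ≤ 1 :=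
      Real.rpow_le_one_of_one_le_of_nonpos (hlog x hx).le (by linarith [hα.2])
    have h2 := inv_pos.2 (hpos x hx)
    have h3 : x⁻¹ / Real.log x ≤ x⁻¹ := div_le_self h2.le (hlog x hx).le
    have h4 : x⁻¹ * α * Real.log x ^ (α - 1) ≤ x⁻¹ := by
      rw [mul_assoc]
      exact mul_le_of_le_one_right h2.le (mul_le_one₀ hα.2.le
        (Real.rpow_nonneg (zero_le_one.trans (hlog x hx).le) _) h1)
    have h5 : (a + 1) * x⁻¹ ≤ η := by
      rw [← div_eq_mul_inv, div_le_iff₀ (hpos x hx)]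
      have := (div_le_iff₀ hη).1 (hx₁η.trans hx)
      linarith
    have h6 := mul_le_mul_of_nonneg_left h4 ha.le
    have h7 := Real.add_one_le_exp η
    linarith
  · intro x hx
    have h1 := hX x (hx₁X.trans hx)
    have h2 := hg_pos x (hx₁0.trans hx)
    rw [ENNReal.ofReal_div_of_pos h2] at h1
    exact (ENNReal.div_le_iff (by simpa using h2) ENNReal.ofReal_ne_top).1 h1.le
  · intro x hx
    rw [← ENNReal.ofReal_mul (Real.exp_pos _).le, ← Real.exp_add]
    refine ENNReal.ofReal_le_ofReal (Real.exp_le_exp.2 ?_)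
    have hl := hlog x hx
    have hl0 : 0 < Real.log x := by linarith
    have h1 : Real.log x ≤ Real.log (T x) := Real.log_le_log (hpos x hx) (hTge x hx)
    have h2 : Real.log x ^ α ≤ Real.log x := by
      simpa using Real.rpow_le_rpow_of_exponent_le hl.le hα.2.le
    have h3 : Real.log (Real.log x) ≤ Real.log x := Real.log_le_self hl0.le
    have h4 : T x / Real.log (T x) ≤ x / Real.log x + (a + 1) := by
      refine (div_le_div_of_nonneg_left ((hpos x hx).le.trans (hTge x hx)) hl0 h1).trans ?_
      rw [div_add' _ _ _ hl0.ne', div_le_div_iff_of_pos_right hl0]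
      have := mul_le_mul_of_nonneg_left h2 ha.le
      simp only [hTdef]
      linarith
    have h5 := mul_le_mul_of_nonneg_left h4 hδ.le
    have h6 : δ * (a + 1) = η := div_mul_cancel₀ _ (by positivity)
    linarith
  · simpa using hη.le
  · rw [← ENNReal.ofReal_mul (Real.exp_pos _).le, ← Real.exp_add, ← two_mul,
      ← ENNReal.ofReal_toReal hρtop, ← ENNReal.ofReal_mul (Real.exp_pos _).le]
    simpa using hηq
  · intro x hx
    refine ENNReal.ofReal_le_ofReal (Real.exp_le_exp.2 (mul_le_mul_of_nonneg_left ?_ hδ.le))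
    exact (div_le_self (hpos x hx.1).le (hlog x hx.1).le).trans hx.2
  · have h1 := hμ 1 measurable_one
    simp only [Pi.one_apply, one_mul] at h1
    rw [← h1]
    simp

/-- The regular sequence `(n + 2) log (n + 2)`. -/
noncomputable def regularSeq (n : ℕ) : ℝ := ((n : ℝ) + 2) * Real.log ((n : ℝ) + 2)

theorem half_le_log (n : ℕ) : 1 / 2 ≤ Real.log ((n : ℝ) + 2) := by
  have h1 := Real.log_two_gt_d9
  have h2 : Real.log 2 ≤ Real.log ((n : ℝ) + 2) :=
    Real.log_le_log (by norm_num) (by linarith [Nat.cast_nonneg (α := ℝ) n])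
  linarith

theorem log_succ_sub_le (n : ℕ) :
    Real.log ((n : ℝ) + 3) - Real.log ((n : ℝ) + 2) ≤ 1 / ((n : ℝ) + 2) := by
  have hn : (0 : ℝ) < (n : ℝ) + 2 := by positivity
  rw [← Real.log_div (by positivity) hn.ne']
  refine (Real.log_le_sub_one_of_pos (by positivity)).trans (le_of_eq ?_)
  field_simp
  ring

theorem one_le_regularSeq (n : ℕ) : 1 ≤ regularSeq n := by
  have h1 := half_le_log n
  have h2 := Nat.cast_nonneg (α := ℝ) n
  unfold regularSeq
  nlinarith

theorem monotone_regularSeq : Monotone regularSeq := by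
  intro m n hmn
  have h : (m : ℝ) ≤ n := by exact_mod_cast hmn
  have h1 := half_le_log m
  unfold regularSeq
  gcongr

theorem tendsto_sum_inv_regularSeq :
    Tendsto (fun n => ∑ j ∈ Finset.range n, (regularSeq j)⁻¹) atTop atTop := by
  have step : ∀ n : ℕ, Real.log (Real.log ((n : ℝ) + 2)) - Real.log (Real.log 2) ≤
      ∑ j ∈ Finset.range n, (regularSeq j)⁻¹ := by
    intro n
    induction n with
    | zero => simp
    | succ n ih =>
      rw [Finset.sum_range_succ]
      have h2 := half_le_log n
      have h3 : 1 / 2 ≤ Real.log ((n : ℝ) + 3) := by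
        have := half_le_log (n + 1)
        push_cast at this
        convert this using 2
        ring
      have h4 : Real.log (Real.log ((n : ℝ) + 3)) - Real.log (Real.log ((n : ℝ) + 2)) ≤
          (regularSeq n)⁻¹ := by
        rw [← Real.log_div (by linarith) (by linarith)]
        refine (Real.log_le_sub_one_of_pos (div_pos (by linarith) (by linarith))).trans ?_
        have : Real.log ((n : ℝ) + 3) / Real.log ((n : ℝ) + 2) - 1 =
            (Real.log ((n : ℝ) + 3) - Real.log ((n : ℝ) + 2)) / Real.log ((n : ℝ) + 2) := by
          field_simp
        rw [this, regularSeq, mul_inv, ← div_eq_mul_inv, ← one_div]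
        exact div_le_div_of_nonneg_right (log_succ_sub_le n) (by linarith)
      have h5 : ((n + 1 : ℕ) : ℝ) + 2 = n + 3 := by push_cast; ring
      rw [h5]
      linarith
  refine tendsto_atTop_mono step ?_
  refine tendsto_atTop_add_const_right _ _ ?_
  exact Real.tendsto_log_atTop.comp (Real.tendsto_log_atTop.comp
    (tendsto_atTop_add_const_right _ _ tendsto_natCast_atTop_atTop))

theorem regularSeq_succ_le (n : ℕ) :
    regularSeq (n + 1) ≤ Real.exp (3 / ((n : ℝ) + 2)) * regularSeq n := by
  have hn : (0 : ℝ) < (n : ℝ) + 2 := by positivity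
  have h1 := half_le_log n
  have h2 := log_succ_sub_le n
  have h3 : (n : ℝ) + 3 ≤ Real.exp (1 / ((n : ℝ) + 2)) * (n + 2) := by
    have := mul_le_mul_of_nonneg_right (Real.add_one_le_exp (1 / ((n : ℝ) + 2))) hn.le
    have h : (1 / ((n : ℝ) + 2) + 1) * (n + 2) = n + 3 := by field_simp; ring
    linarith
  have h4 : Real.log ((n : ℝ) + 3) ≤ Real.exp (2 / ((n : ℝ) + 2)) * Real.log ((n : ℝ) + 2) := by
    have := mul_le_mul_of_nonneg_right (Real.add_one_le_exp (2 / ((n : ℝ) + 2)))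
      (show (0 : ℝ) ≤ Real.log ((n : ℝ) + 2) by linarith)
    have h : 1 / ((n : ℝ) + 2) ≤ 2 / ((n : ℝ) + 2) * Real.log ((n : ℝ) + 2) := by
      rw [div_mul_eq_mul_div]
      exact div_le_div_of_nonneg_right (by linarith) hn.le
    linarith
  have h5 : ((n + 1 : ℕ) : ℝ) + 2 = n + 3 := by push_cast; ring
  have h6 : (0 : ℝ) ≤ Real.log ((n : ℝ) + 3) := Real.log_nonneg (by linarith)
  unfold regularSeq
  rw [h5]
  calc _ ≤ (Real.exp (1 / ((n : ℝ) + 2)) * (n + 2)) *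
        (Real.exp (2 / ((n : ℝ) + 2)) * Real.log ((n : ℝ) + 2)) :=
        mul_le_mul h3 h4 h6 (by positivity)
    _ = Real.exp (1 / ((n : ℝ) + 2) + 2 / ((n : ℝ) + 2)) * ((n + 2) * Real.log ((n : ℝ) + 2)) := by
        rw [Real.exp_add]; ring
    _ = _ := by rw [← add_div]; norm_num

theorem regularSeq_pow_le_prod (n : ℕ) :
    regularSeq n ^ n ≤ ∏ j ∈ Finset.range n, (Real.exp 3 * regularSeq j) := by
  induction n with
  | zero => simp
  | succ n ih =>
    have h0 := one_le_regularSeq n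
    have h0' := one_le_regularSeq (n + 1)
    have hn : (0 : ℝ) < (n : ℝ) + 2 := by positivity
    rw [Finset.prod_range_succ]
    calc regularSeq (n + 1) ^ (n + 1)
        ≤ (Real.exp (3 / ((n : ℝ) + 2)) * regularSeq n) ^ (n + 1) :=
          pow_le_pow_left₀ (by linarith) (regularSeq_succ_le n) _
      _ = Real.exp ((n + 1 : ℕ) * (3 / ((n : ℝ) + 2))) * (regularSeq n ^ n * regularSeq n) := by
          rw [mul_pow, ← Real.exp_nat_mul, pow_succ (regularSeq n)]
      _ ≤ Real.exp 3 * (regularSeq n ^ n * regularSeq n) := by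
          refine mul_le_mul_of_nonneg_right (Real.exp_le_exp.2 ?_) (by positivity)
          rw [← mul_div_assoc, div_le_iff₀ hn]
          push_cast
          linarith
      _ = regularSeq n ^ n * (Real.exp 3 * regularSeq n) := by ring
      _ ≤ _ := mul_le_mul_of_nonneg_right ih (by positivity)

theorem pow_le_regularSeq_pow_mul_exp {δ K y : ℝ} (hδ : 0 < δ) (hK1 : 1 ≤ K)
    (hK : 72 / δ ^ 2 ≤ K) (hy : Real.exp 1 < y) (n : ℕ) :
    y ^ n ≤ (K * regularSeq n) ^ n * Real.exp (δ * (y / Real.log y)) := by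
  have hy0 : 0 < y := (Real.exp_pos 1).trans hy
  have hly : 1 < Real.log y := by rwa [Real.lt_log_iff_exp_lt hy0]
  have hu := one_le_regularSeq n
  have hu0 : 0 < regularSeq n := by linarith
  have hyl : 0 ≤ δ * (y / Real.log y) := by positivity
  rcases le_or_gt y (regularSeq n) with h | h
  · have h1 : y ^ n ≤ (K * regularSeq n) ^ n :=
      pow_le_pow_left₀ hy0.le (h.trans (le_mul_of_one_le_left hu0.le hK1)) n
    exact h1.trans (le_mul_of_one_le_right (by positivity) (Real.one_le_exp hyl))
  set w := y / regularSeq n with hw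
  have hyw : y = regularSeq n * w := by rw [hw]; field_simp
  have hw1 : 1 < w := (one_lt_div hu0).2 h
  have hw0 : 0 < w := by linarith
  have hsq : √w * √w = w := Real.mul_self_sqrt hw0.le
  have hs1 : 1 ≤ √w := Real.one_le_sqrt.2 hw1.le
  have hl := half_le_log n
  set l := Real.log ((n : ℝ) + 2) with hldef
  have hn : (0 : ℝ) < (n : ℝ) + 2 := by positivity
  have hlogy : Real.log y ≤ 6 * l * √w := by
    have h1 : Real.log y = l + Real.log l + Real.log w := by
      rw [hyw, Real.log_mul hu0.ne' hw0.ne', regularSeq, Real.log_mul hn.ne' (by linarith)]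
    have h2 : Real.log l ≤ l := Real.log_le_self (by linarith)
    have h3 : Real.log w ≤ 2 * √w := by
      rw [← hsq, Real.log_mul (by positivity) (by positivity), hsq]
      have := Real.log_le_self (Real.sqrt_nonneg w)
      linarith
    nlinarith
  have hexp : (n : ℝ) * (δ * √w / 6) ≤ δ * (y / Real.log y) := by
    have h1 : ((n : ℝ) + 2) * √w / 6 ≤ y / Real.log y := by
      rw [le_div_iff₀ (by linarith)]
      calc ((n : ℝ) + 2) * √w / 6 * Real.log y ≤ ((n : ℝ) + 2) * √w / 6 * (6 * l * √w) :=
            mul_le_mul_of_nonneg_left hlogy (by positivity)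
        _ = ((n : ℝ) + 2) * l * (√w * √w) := by ring
        _ = y := by rw [hsq, hyw, regularSeq]
    have h2 := mul_le_mul_of_nonneg_left h1 hδ.le
    have h3 : 0 ≤ δ * √w := by positivity
    nlinarith
  have hwK : w ≤ K * Real.exp (δ * √w / 6) := by
    have h1 := Real.pow_div_factorial_le_exp (δ * √w / 6) (by positivity) 2
    have h2 : (δ * √w / 6) ^ 2 / (Nat.factorial 2 : ℝ) = δ ^ 2 / 72 * w := by
      rw [← hsq]; simp; ring
    rw [h2] at h1
    calc w = 72 / δ ^ 2 * (δ ^ 2 / 72 * w) := by field_simp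
      _ ≤ K * Real.exp (δ * √w / 6) := mul_le_mul hK h1 (by positivity) (by linarith)
  calc y ^ n = regularSeq n ^ n * w ^ n := by rw [hyw, mul_pow]
    _ ≤ regularSeq n ^ n * (K * Real.exp (δ * √w / 6)) ^ n := by gcongr
    _ = (K * regularSeq n) ^ n * Real.exp ((n : ℝ) * (δ * √w / 6)) := by
        rw [mul_pow, mul_pow, Real.exp_nat_mul]; ring
    _ ≤ _ := by gcongr

/-- A finite exponential moment of `x / log x` bounds the moments by a quasi-analytic sequence. -/
theorem exists_moment_bound {μ : Measure ℝ} [IsProbabilityMeasure μ] (hsupp : μ (Iio 0) = 0)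
    (hmom : ∀ n : ℕ, Integrable (fun x => x ^ n) μ) {δ x₁ : ℝ} (hδ : 0 < δ)
    (hx₁ : Real.exp 1 < x₁)
    (hexp : ∫⁻ x in Ici x₁, ENNReal.ofReal (Real.exp (δ * (x / Real.log x))) ∂μ < ⊤) :
    ∃ (A : ℝ) (r : ℕ → ℝ), (∀ n, 1 ≤ r n) ∧ Monotone r ∧
      Tendsto (fun n => ∑ j ∈ Finset.range n, (r j)⁻¹) atTop atTop ∧
      ∀ n : ℕ, ∫ x, x ^ n ∂μ ≤ A * ∏ j ∈ Finset.range n, r j := by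
  have hx₁1 : 1 ≤ x₁ := (Real.one_le_exp zero_le_one).trans hx₁.le
  have hint : IntegrableOn (fun x => Real.exp (δ * (x / Real.log x))) (Ici x₁) μ := by
    refine ⟨Measurable.aestronglyMeasurable ?_, ?_⟩
    · have := Real.measurable_log
      fun_prop
    · rw [hasFiniteIntegral_iff_ofReal (ae_of_all _ fun x => (Real.exp_pos _).le)]
      exact hexp
  set I := ∫ x in Ici x₁, Real.exp (δ * (x / Real.log x)) ∂μ with hI
  have hI0 : 0 ≤ I := integral_nonneg fun x => (Real.exp_pos _).le
  set K := max x₁ (72 / δ ^ 2) with hK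
  have hKx : x₁ ≤ K := le_max_left _ _
  have hK1 : 1 ≤ K := hx₁1.trans hKx
  have hCpos : 0 < K * Real.exp 3 := by positivity
  have hC1 : 1 ≤ K * Real.exp 3 :=
    one_le_mul_of_one_le_of_one_le hK1 (Real.one_le_exp (by norm_num))
  refine ⟨1 + I, fun j => K * Real.exp 3 * regularSeq j,
    fun n => one_le_mul_of_one_le_of_one_le hC1 (one_le_regularSeq n),
    monotone_regularSeq.const_mul hCpos.le, ?_, fun n => ?_⟩
  · simp_rw [mul_inv (K * Real.exp 3), ← Finset.mul_sum]
    exact tendsto_sum_inv_regularSeq.const_mul_atTop (inv_pos.2 hCpos)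
  have hu := one_le_regularSeq n
  have hlow : ∫ x in Iio x₁, x ^ n ∂μ ≤ (K * regularSeq n) ^ n := by
    have hnn : ∀ᵐ x ∂μ, 0 ≤ x := by
      rw [ae_iff]
      simpa [Iio, not_le] using hsupp
    have h1 : ∫ x in Iio x₁, x ^ n ∂μ ≤ ∫ _ in Iio x₁, x₁ ^ n ∂μ := by
      refine setIntegral_mono_on_ae (hmom n).integrableOn
        (integrable_const _) measurableSet_Iio ?_
      filter_upwards [hnn] with x hx hx'
      exact pow_le_pow_left₀ hx (le_of_lt hx') n
    have h2 : ∫ _ in Iio x₁, x₁ ^ n ∂μ ≤ x₁ ^ n := by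
      rw [setIntegral_const, smul_eq_mul]
      exact mul_le_of_le_one_left (by positivity) measureReal_le_one
    refine (h1.trans h2).trans (pow_le_pow_left₀ (by linarith) ?_ n)
    exact hKx.trans (le_mul_of_one_le_right (by linarith) hu)
  have hhigh : ∫ x in Ici x₁, x ^ n ∂μ ≤ (K * regularSeq n) ^ n * I := by
    rw [hI, ← integral_const_mul]
    exact setIntegral_mono_on (hmom n).integrableOn (hint.const_mul _) measurableSet_Ici
      fun x hx => pow_le_regularSeq_pow_mul_exp hδ hK1 (le_max_right _ _) (hx₁.trans_le hx) n
  have hsplit : ∫ x, x ^ n ∂μ = ∫ x in Iio x₁, x ^ n ∂μ + ∫ x in Ici x₁, x ^ n ∂μ := by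
    rw [← compl_Iio, integral_add_compl measurableSet_Iio (hmom n)]
  have hprod : (K * regularSeq n) ^ n ≤
      ∏ j ∈ Finset.range n, (K * Real.exp 3 * regularSeq j) := by
    simp_rw [mul_assoc K]
    rw [mul_pow, Finset.prod_mul_distrib (f := fun _ => K), Finset.prod_const, Finset.card_range]
    exact mul_le_mul_of_nonneg_left (regularSeq_pow_le_prod n) (by positivity)
  rw [hsplit]
  calc _ ≤ (1 + I) * (K * regularSeq n) ^ n := by linarith
    _ ≤ _ := mul_le_mul_of_nonneg_left hprod (by positivity)

/-- The symmetrization of a measure on the line. -/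
noncomputable def symmetrization (ρ : Measure ℝ) : Measure ℝ :=
  (2⁻¹ : ENNReal) • (ρ + ρ.map (fun x => -x))

instance (ρ : Measure ℝ) [IsProbabilityMeasure ρ] : IsProbabilityMeasure (symmetrization ρ) := by
  constructor
  rw [symmetrization, Measure.smul_apply, Measure.add_apply,
    Measure.map_apply measurable_neg MeasurableSet.univ]
  simp only [preimage_univ, measure_univ, smul_eq_mul, one_add_one_eq_two]
  exact ENNReal.inv_mul_cancel (by norm_num) (by norm_num)

theorem integrable_symmetrization {ρ : Measure ℝ} {f : ℝ → ℝ} (hfm : Measurable f)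
    (hf : Integrable f ρ) (hf' : Integrable (fun x => f (-x)) ρ) :
    Integrable f (symmetrization ρ) := by
  refine Integrable.smul_measure (Integrable.add_measure hf ?_) (by norm_num)
  exact (integrable_map_measure hfm.aestronglyMeasurable measurable_neg.aemeasurable).2 hf'

theorem integral_symmetrization {ρ : Measure ℝ} {f : ℝ → ℝ} (hfm : Measurable f)
    (hf : Integrable f ρ) (hf' : Integrable (fun x => f (-x)) ρ) :
    ∫ x, f x ∂(symmetrization ρ) = (∫ x, f x ∂ρ + ∫ x, f (-x) ∂ρ) / 2 := by
  rw [symmetrization, integral_smul_measure, integral_add_measure hf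
    ((integrable_map_measure hfm.aestronglyMeasurable measurable_neg.aemeasurable).2 hf'),
    integral_map measurable_neg.aemeasurable hfm.aestronglyMeasurable]
  simp
  ring

theorem map_sq_symmetrization (ρ : Measure ℝ) :
    (symmetrization ρ).map (fun x => x ^ 2) = ρ.map (fun x => x ^ 2) := by
  have h : Measurable fun x : ℝ => x ^ 2 := by fun_prop
  rw [symmetrization, Measure.map_smul, Measure.map_add _ _ h, Measure.map_map h measurable_neg]
  have : ((fun x : ℝ => x ^ 2) ∘ fun x => -x) = fun x => x ^ 2 := by
    ext x
    simp
  rw [this, ← two_smul ENNReal, smul_smul, ENNReal.inv_mul_cancel (by norm_num) (by norm_num),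
    one_smul]

theorem integrable_neg_pow {ρ : Measure ℝ} (hρ : ∀ n : ℕ, Integrable (fun x => x ^ n) ρ) (n : ℕ) :
    Integrable (fun x => (-x) ^ n) ρ := by
  have h : (fun x : ℝ => (-x) ^ n) = fun x => (-1) ^ n * x ^ n := funext fun x => neg_pow x n
  rw [h]
  exact (hρ n).const_mul _

theorem integral_pow_symmetrization {ρ : Measure ℝ}
    (hρ : ∀ n : ℕ, Integrable (fun x => x ^ n) ρ) (n : ℕ) :
    ∫ x, x ^ n ∂(symmetrization ρ) = (1 + (-1) ^ n) / 2 * ∫ x, x ^ n ∂ρ := by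
  have h : (fun x : ℝ => (-x) ^ n) = fun x => (-1) ^ n * x ^ n := funext fun x => neg_pow x n
  rw [integral_symmetrization (by fun_prop) (hρ n) (integrable_neg_pow hρ n), h,
    integral_const_mul]
  ring

theorem integral_abs_pow_of_nonneg {ρ : Measure ℝ} (hρ : ρ (Iio 0) = 0) (n : ℕ) :
    ∫ x, |x| ^ n ∂ρ = ∫ x, x ^ n ∂ρ := by
  refine integral_congr_ae ?_
  have hnn : ∀ᵐ x ∂ρ, 0 ≤ x := by
    rw [ae_iff]
    simpa [Iio, not_le] using hρ
  filter_upwards [hnn] with x hx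
  rw [abs_of_nonneg hx]

theorem integral_abs_pow_symmetrization {ρ : Measure ℝ} (hρ0 : ρ (Iio 0) = 0)
    (hρ : ∀ n : ℕ, Integrable (fun x => x ^ n) ρ) (n : ℕ) :
    ∫ x, |x| ^ n ∂(symmetrization ρ) = ∫ x, x ^ n ∂ρ := by
  have h : Integrable (fun x => |x| ^ n) ρ := by
    simpa [abs_pow] using (hρ n).abs
  rw [integral_symmetrization (by fun_prop) h (by simpa using h)]
  simp_rw [abs_neg]
  rw [integral_abs_pow_of_nonneg hρ0]
  ring

theorem Measure.eq_map_sq_of_carleman {P Q : Measure ℝ} [IsProbabilityMeasure P]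
    [IsProbabilityMeasure Q] {A : ℝ} {r : ℕ → ℝ} (hr : ∀ n, 0 < r n) (hmono : Monotone r)
    (hdiv : Tendsto (fun n => ∑ j ∈ Finset.range n, (r j)⁻¹) atTop atTop)
    (hP0 : P (Iio 0) = 0) (hQ0 : Q (Iio 0) = 0)
    (hP : ∀ n : ℕ, Integrable (fun x => x ^ n) P) (hQ : ∀ n : ℕ, Integrable (fun x => x ^ n) Q)
    (hPQ : ∀ k : ℕ, ∫ x, x ^ (2 * k) ∂P = ∫ x, x ^ (2 * k) ∂Q)
    (hPA : ∀ n : ℕ, ∫ x, x ^ n ∂P ≤ A * ∏ j ∈ Finset.range n, r j)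
    (hQA : ∀ n : ℕ, ∫ x, x ^ n ∂Q ≤ A * ∏ j ∈ Finset.range n, r j) :
    P.map (fun x => x ^ 2) = Q.map (fun x => x ^ 2) := by
  rw [← map_sq_symmetrization P, ← map_sq_symmetrization Q]
  congr 1
  refine Measure.eq_of_moments_eq_of_carleman (A := A) hr hmono hdiv
    (fun n => integrable_symmetrization (by fun_prop) (hP n) (integrable_neg_pow hP n))
    (fun n => integrable_symmetrization (by fun_prop) (hQ n) (integrable_neg_pow hQ n)) ?_
    (fun n => (integral_abs_pow_symmetrization hP0 hP n).trans_le (hPA n))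
    (fun n => (integral_abs_pow_symmetrization hQ0 hQ n).trans_le (hQA n))
  intro n
  rw [integral_pow_symmetrization hP, integral_pow_symmetrization hQ]
  rcases Nat.even_or_odd n with h | h
  · obtain ⟨k, rfl⟩ := h.exists_two_nsmul
    rw [smul_eq_mul, hPQ]
  · simp [h.neg_one_pow]

theorem isMomentDetOnNonneg_of_moment_bound {μ : Measure ℝ} [IsProbabilityMeasure μ]
    (hsupp : μ (Iio 0) = 0) (hmom : ∀ n : ℕ, Integrable (fun x => x ^ n) μ)
    {A : ℝ} {r : ℕ → ℝ} (hr : ∀ n, 0 < r n) (hmono : Monotone r)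
    (hdiv : Tendsto (fun n => ∑ j ∈ Finset.range n, (r j)⁻¹) atTop atTop)
    (hA : ∀ n : ℕ, ∫ x, x ^ n ∂μ ≤ A * ∏ j ∈ Finset.range n, r j) :
    IsMomentDetOnNonneg μ := by
  intro ν hν hν0 hνm
  have hν1 : ∀ n : ℕ, Integrable (fun x => x ^ n) ν := fun n => by
    rcases Nat.eq_zero_or_pos n with rfl | hn
    · simp
    · exact (hνm n hn).1
  have hν2 : ∀ n : ℕ, ∫ x, x ^ n ∂ν = ∫ x, x ^ n ∂μ := fun n => by
    rcases Nat.eq_zero_or_pos n with rfl | hn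
    · simp
    · exact (hνm n hn).2
  refine Measure.eq_of_moments_eq_of_carleman (A := A) hr hmono hdiv hν1 hmom hν2 ?_ ?_
  · intro n
    rw [integral_abs_pow_of_nonneg hν0, hν2]
    exact hA n
  · intro n
    rw [integral_abs_pow_of_nonneg hsupp]
    exact hA n

theorem isMomentDetOnNonneg_map_sq_of_moment_bound {μ : Measure ℝ} [IsProbabilityMeasure μ]
    (hsupp : μ (Iio 0) = 0) (hmom : ∀ n : ℕ, Integrable (fun x => x ^ n) μ)
    {A : ℝ} {r : ℕ → ℝ} (hr : ∀ n, 1 ≤ r n) (hmono : Monotone r)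
    (hdiv : Tendsto (fun n => ∑ j ∈ Finset.range n, (r j)⁻¹) atTop atTop)
    (hA : ∀ n : ℕ, ∫ x, x ^ n ∂μ ≤ A * ∏ j ∈ Finset.range n, r j) :
    IsMomentDetOnNonneg (μ.map (fun x => x ^ 2)) := by
  intro ν hν hν0 hνm
  have hr0 : ∀ n, 0 < r n := fun n => zero_lt_one.trans_le (hr n)
  have hsq : Measurable fun x : ℝ => x ^ 2 := by fun_prop
  have hsqrt : Measurable fun x : ℝ => √x := Real.continuous_sqrt.measurable
  have hνnn : ∀ᵐ x ∂ν, 0 ≤ x := by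
    rw [ae_iff]
    simpa [Iio, not_le] using hν0
  have hν1 : ∀ n : ℕ, Integrable (fun x => x ^ n) ν := fun n => by
    rcases Nat.eq_zero_or_pos n with rfl | hn
    · simp
    · exact (hνm n hn).1
  have hν2 : ∀ n : ℕ, ∫ x, x ^ n ∂ν = ∫ x, x ^ (2 * n) ∂μ := fun n => by
    rcases Nat.eq_zero_or_pos n with rfl | hn
    · simp
    · rw [(hνm n hn).2, integral_map hsq.aemeasurable (by fun_prop)]
      simp_rw [pow_mul]
  set σ := ν.map (fun x => √x) with hσ
  have : IsProbabilityMeasure σ := Measure.isProbabilityMeasure_map hsqrt.aemeasurable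
  have hσ0 : σ (Iio 0) = 0 := by
    rw [hσ, Measure.map_apply hsqrt measurableSet_Iio]
    convert measure_empty (μ := ν)
    ext x
    simp [Real.sqrt_nonneg]
  have hσint : ∀ k : ℕ, Integrable (fun x => x ^ (2 * k)) σ ∧
      ∫ x, x ^ (2 * k) ∂σ = ∫ x, x ^ (2 * k) ∂μ := by
    intro k
    have h : (fun x => √x ^ (2 * k)) =ᵐ[ν] fun x => x ^ k := by
      filter_upwards [hνnn] with x hx
      rw [pow_mul, Real.sq_sqrt hx]
    constructor
    · exact (integrable_map_measure (by fun_prop) hsqrt.aemeasurable).2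
        ((integrable_congr h).2 (hν1 k))
    · rw [hσ, integral_map hsqrt.aemeasurable (by fun_prop), integral_congr_ae h, hν2]
  have hσnn : ∀ᵐ x ∂σ, 0 ≤ x := by
    rw [ae_iff]
    simpa [Iio, not_le] using hσ0
  have hpow : ∀ {x : ℝ}, 0 ≤ x → ∀ {m n : ℕ}, m ≤ n → x ^ m ≤ 1 + x ^ n := by
    intro x hx m n hmn
    rcases le_total x 1 with h | h
    · linarith [pow_le_one₀ hx h (n := m), pow_nonneg hx n]
    · linarith [pow_le_pow_right₀ h hmn]
  have hσ1 : ∀ n : ℕ, Integrable (fun x => x ^ n) σ := fun n => by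
    refine Integrable.mono' ((integrable_const (1 : ℝ)).add (hσint n).1) (by fun_prop) ?_
    filter_upwards [hσnn] with x hx
    rw [Real.norm_eq_abs, abs_of_nonneg (pow_nonneg hx n)]
    exact hpow hx (by omega)
  have hprod1 : ∀ n, 1 ≤ ∏ j ∈ Finset.range n, r j := fun n =>
    Finset.prod_induction _ (fun x => 1 ≤ x)
      (fun _ _ => one_le_mul_of_one_le_of_one_le) le_rfl fun j _ => hr j
  have hA0 : 0 ≤ A := by
    have := hA 0
    simp at this
    linarith
  have hprods : ∀ n, ∏ j ∈ Finset.range n, r j ≤ ∏ j ∈ Finset.range (n + 1), r j := fun n => by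
    rw [Finset.prod_range_succ]
    exact le_mul_of_one_le_right (zero_le_one.trans (hprod1 n)) (hr n)
  have hshift : ∀ n, (1 + A) * r 0 * ∏ j ∈ Finset.range n, r (j + 1) =
      (1 + A) * ∏ j ∈ Finset.range (n + 1), r j := fun n => by
    rw [Finset.prod_range_succ']
    ring
  have hAsucc : ∀ n, A * ∏ j ∈ Finset.range n, r j ≤
      (1 + A) * ∏ j ∈ Finset.range (n + 1), r j := fun n =>
    mul_le_mul (by linarith) (hprods n) (zero_le_one.trans (hprod1 n)) (by linarith)
  have hσA : ∀ n : ℕ, ∫ x, x ^ n ∂σ ≤ (1 + A) * ∏ j ∈ Finset.range (n + 1), r j := by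
    intro n
    rcases Nat.even_or_odd' n with ⟨k, rfl | rfl⟩
    · rw [(hσint k).2]
      exact (hA _).trans (hAsucc _)
    · have h1 : ∫ x, x ^ (2 * k + 1) ∂σ ≤ ∫ x, (1 + x ^ (2 * (k + 1))) ∂σ := by
        refine integral_mono_ae (hσ1 _) ((integrable_const (1 : ℝ)).add (hσint (k + 1)).1) ?_
        filter_upwards [hσnn] with x hx
        exact hpow hx (by omega)
      rw [integral_add (integrable_const _) (hσint (k + 1)).1, (hσint (k + 1)).2] at h1
      simp only [integral_const, probReal_univ, smul_eq_mul, mul_one] at h1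
      have h2 := hA (2 * (k + 1))
      have h3 := hprod1 (2 * (k + 1))
      change _ ≤ (1 + A) * ∏ j ∈ Finset.range (2 * (k + 1)), r j
      linarith
  have hσν : σ.map (fun x => x ^ 2) = ν := by
    rw [hσ, Measure.map_map hsq hsqrt]
    have h : ((fun x : ℝ => x ^ 2) ∘ fun x => √x) =ᵐ[ν] id := by
      filter_upwards [hνnn] with x hx
      simp [Real.sq_sqrt hx]
    rw [Measure.map_congr h, Measure.map_id]
  rw [← hσν]
  refine Measure.eq_map_sq_of_carleman (A := (1 + A) * r 0) (r := fun n => r (n + 1))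
    (fun n => hr0 _) (fun m n h => hmono (by omega)) ?_ hσ0 hsupp hσ1 hmom
    (fun k => (hσint k).2) (fun n => (hσA n).trans_eq (hshift n).symm)
    (fun n => ((hA n).trans (hAsucc n)).trans_eq (hshift n).symm)
  have h := tendsto_atTop_add_const_right _ (-(r 0)⁻¹) (hdiv.comp (tendsto_add_atTop_nat 1))
  refine h.congr fun n => ?_
  simp [Finset.sum_range_succ']

/-- Corollary 8: if `limsup_{x→∞} g(x + a (log x)^α + log log x)/g(x) < 1` with
`a > 0`, `α ∈ [0,1)`, `x₀ > e`, then both `Y` and `Y²` are M-det on `[0,∞)`. -/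
theorem corollary8
    (x₀ : ℝ) (hx₀ : Real.exp 1 < x₀)
    (a α : ℝ) (ha : 0 < a) (hα : α ∈ Ico (0 : ℝ) 1)
    (μ : Measure ℝ) [IsProbabilityMeasure μ]
    (hsupp : μ (Iio 0) = 0)
    (hmom : ∀ n : ℕ, Integrable (fun x => x ^ n) μ)
    (g : ℝ → ℝ) (hg_meas : Measurable g)
    (hg_ac : μ.restrict (Ici x₀) =
      (volume.restrict (Ici x₀)).withDensity (fun x => ENNReal.ofReal (g x)))
    (hg_pos : ∀ x ∈ Ici x₀, 0 < g x)
    (hlimsup : Filter.limsup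
        (fun x => ENNReal.ofReal
          (g (x + a * (Real.log x) ^ α + Real.log (Real.log x)) / g x)) atTop < 1) :
    IsMomentDetOnNonneg μ ∧
    IsMomentDetOnNonneg (μ.map (fun x => x ^ 2)) := by
  obtain ⟨δ, hδ, x₁, hx₁, hexp⟩ :=
    exists_lintegral_exp_div_log_lt_top ha hα hg_meas hg_ac hg_pos hlimsup
  obtain ⟨A, r, hr, hmono, hdiv, hA⟩ := exists_moment_bound hsupp hmom hδ hx₁ hexp
  exact ⟨isMomentDetOnNonneg_of_moment_bound hsupp hmom (fun n => zero_lt_one.trans_le (hr n))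
      hmono hdiv hA,
    isMomentDetOnNonneg_map_sq_of_moment_bound hsupp hmom hr hmono hdiv hA⟩
end

section
/- Let Y be a random variable taking values in [0,∞) with distribution function G having finite moments of all positive integer orders, such that G is absolutely continuous on [x₀,∞) for some x₀ > e, with density g(x) = G′(x) > 0 there. Let a > 0 and α ∈ [0,1). If limsup_{x→∞} g(x + a·(log x)^α · log log x) / g(x) < 1, then the distributions of both Y and Y² are uniquely determined by their moments among all probability distributions on [0,∞). -/
open MeasureTheory Filter Set

/-- One step of Bang's argument: smallness of the first `n + 1` derivatives at `x` propagates to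
smallness of the first `n` derivatives on an interval of length `e⁻¹ M n / M (n + 1)`. -/
lemma bang_step_s12 {F : ℕ → ℝ → ℂ} {M : ℕ → ℝ}
    (hF : ∀ j t, HasDerivAt (F j) (F (j + 1) t) t) (hM : ∀ n, 0 < M n)
    (hlc : ∀ n, M (n + 1) ^ 2 ≤ M n * M (n + 2)) (hb : ∀ j t, ‖F j t‖ ≤ M j)
    (n : ℕ) (x h : ℝ) (hx : ∀ j ≤ n + 1, ‖F j x‖ ≤ M j * Real.exp (j - (n + 1 : ℕ)))
    (h0 : 0 ≤ h) (hh : h ≤ Real.exp (-1) * (M n / M (n + 1))) :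
    ∀ j ≤ n, ‖F j (x + h)‖ ≤ M j * Real.exp (j - n) := by
  set r := M (n + 1) / M n with hr
  have hrpos : 0 < r := div_pos (hM _) (hM _)
  have hmono : Monotone fun j => M (j + 1) / M j := by
    refine monotone_nat_of_le_succ fun j => ?_
    rw [div_le_div_iff₀ (hM _) (hM _)]
    linarith [hlc j]
  have hratio : ∀ j ≤ n, M (j + 1) ≤ r * M j := fun j hj =>
    (div_le_iff₀ (hM j)).1 (hmono hj)
  have key : ∀ d j, j + d = n + 1 → ∀ s, 0 ≤ s →
      ‖F j (x + s)‖ ≤ M j * Real.exp (j - (n + 1 : ℕ)) * Real.exp (Real.exp 1 * r * s) := by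
    intro d
    induction d with
    | zero =>
      intro j hj s hs
      have hj' : j = n + 1 := by omega
      subst hj'
      rw [sub_self, Real.exp_zero, mul_one]
      refine (hb _ _).trans (le_mul_of_one_le_right (hM _).le (Real.one_le_exp (by positivity)))
    | succ d ih =>
      intro j hj s hs
      have hB : ∀ u : ℝ, HasDerivAt
          (fun u => M j * Real.exp (j - (n + 1 : ℕ)) * Real.exp (Real.exp 1 * r * u))
          (M j * Real.exp (j - (n + 1 : ℕ)) *
            (Real.exp (Real.exp 1 * r * u) * (Real.exp 1 * r))) u := by
        intro u
        have h1 : HasDerivAt (fun u : ℝ => Real.exp 1 * r * u) (Real.exp 1 * r) u := by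
          simpa using (hasDerivAt_id u).const_mul (Real.exp 1 * r)
        exact h1.exp.const_mul _
      have hG : ∀ u : ℝ, HasDerivAt (fun u => F j (x + u)) (F (j + 1) (x + u)) u :=
        fun u => (hF j (x + u)).comp_const_add x u
      refine image_norm_le_of_norm_deriv_right_le_deriv_boundary (f := fun u => F j (x + u))
        (f' := fun u => F (j + 1) (x + u)) (a := 0) (b := s)
        (fun u _ => (hG u).continuousAt.continuousWithinAt)
        (fun u _ => (hG u).hasDerivWithinAt) ?_ hB ?_ ⟨hs, le_rfl⟩
      · simpa using hx j (by omega)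
      · intro u hu
        refine (ih (j + 1) (by omega) u hu.1).trans ?_
        have e1 : Real.exp (((j + 1 : ℕ) : ℝ) - (n + 1 : ℕ))
            = Real.exp (j - (n + 1 : ℕ)) * Real.exp 1 := by
          rw [← Real.exp_add]; congr 1; push_cast; ring
        rw [e1]
        have := hratio j (by omega)
        calc _ = M (j + 1) * (Real.exp (j - (n + 1 : ℕ)) * Real.exp 1
                * Real.exp (Real.exp 1 * r * u)) := by ring
          _ ≤ r * M j * (Real.exp (j - (n + 1 : ℕ)) * Real.exp 1
                * Real.exp (Real.exp 1 * r * u)) := by gcongr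
          _ = _ := by ring
  intro j hj
  refine (key (n + 1 - j) j (by omega) h h0).trans ?_
  rw [mul_assoc, ← Real.exp_add]
  refine mul_le_mul_of_nonneg_left (Real.exp_le_exp.2 ?_) (hM j).le
  have : Real.exp 1 * r * h ≤ 1 := by
    calc _ ≤ Real.exp 1 * r * (Real.exp (-1) * (M n / M (n + 1))) := by gcongr
      _ = (Real.exp 1 * Real.exp (-1)) * ((M (n + 1) / M n) * (M n / M (n + 1))) := by
        rw [hr]; ring
      _ = 1 := by
        rw [← Real.exp_add, div_mul_div_cancel₀ (hM n).ne', div_self (hM (n+1)).ne']; simp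
  push_cast
  linarith

/-- Denjoy–Carleman quasi-analyticity on the half-line, following Bang. -/
lemma denjoy_carleman {F : ℕ → ℝ → ℂ} {M : ℕ → ℝ}
    (hF : ∀ j t, HasDerivAt (F j) (F (j + 1) t) t) (hM : ∀ n, 0 < M n)
    (hlc : ∀ n, M (n + 1) ^ 2 ≤ M n * M (n + 2)) (hb : ∀ j t, ‖F j t‖ ≤ M j)
    (hzero : ∀ j, F j 0 = 0) (hdiv : ¬ Summable fun n => M n / M (n + 1))
    (t : ℝ) (ht : 0 ≤ t) : F 0 t = 0 := by
  have apos : ∀ n, 0 < M n / M (n + 1) := fun n => div_pos (hM _) (hM _)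
  have walk : ∀ d m x, 0 ≤ x →
      x ≤ Real.exp (-1) * ∑ i ∈ Finset.range d, M (i + m) / M (i + m + 1) →
      ∀ j ≤ m, ‖F j x‖ ≤ M j * Real.exp (j - m) := by
    intro d
    induction d with
    | zero =>
      intro m x h0 hx j _
      have : x = 0 := le_antisymm (by simpa using hx) h0
      rw [this, hzero, norm_zero]
      exact mul_nonneg (hM j).le (Real.exp_pos _).le
    | succ d ih =>
      intro m x h0 hx
      set S := Real.exp (-1) * ∑ i ∈ Finset.range d, M (i + (m + 1)) / M (i + (m + 1) + 1)
        with hS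
      have hS0 : 0 ≤ S := mul_nonneg (Real.exp_pos _).le
        (Finset.sum_nonneg fun i _ => (apos _).le)
      have hxS : x ≤ S + Real.exp (-1) * (M m / M (m + 1)) := by
        rw [Finset.sum_range_succ', mul_add] at hx
        simpa [hS, add_assoc, add_comm, add_left_comm] using hx
      have := bang_step_s12 hF hM hlc hb m (min x S) (x - min x S)
        (ih (m + 1) _ (le_min h0 hS0) (min_le_right _ _)) (by simp)
        (by rcases min_choice x S with h | h <;> rw [h]
            · rw [sub_self]; exact mul_nonneg (Real.exp_pos _).le (apos m).le
            · linarith)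
      simpa using this
  have small : ∀ m : ℕ, ‖F 0 t‖ ≤ M 0 * Real.exp (-m) := by
    intro m
    have h1 : ¬ Summable fun i => M (i + m) / M (i + m + 1) := fun h =>
      hdiv ((summable_nat_add_iff (f := fun n => M n / M (n + 1)) m).1 h)
    rw [not_summable_iff_tendsto_nat_atTop_of_nonneg fun i => (apos _).le] at h1
    obtain ⟨d, hd⟩ := (h1.eventually_ge_atTop (Real.exp 1 * t)).exists
    have := walk d m t ht (by
      calc t = Real.exp (-1) * (Real.exp 1 * t) := by
            rw [← mul_assoc, ← Real.exp_add]; simp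
        _ ≤ _ := by gcongr) 0 (Nat.zero_le _)
    simpa using this
  have hlim : Tendsto (fun m : ℕ => M 0 * Real.exp (-m)) atTop (nhds 0) := by
    simpa using (Real.tendsto_exp_neg_atTop_nhds_zero.comp
      tendsto_natCast_atTop_atTop).const_mul (M 0)
  exact norm_le_zero_iff.1 (ge_of_tendsto' hlim small)

/-- Carleman's inequality, in a form free of roots. -/
lemma carleman_inequality {a b : ℕ → ℝ} (ha : ∀ n, 0 ≤ a n) (hb : ∀ n, 0 ≤ b n)
    (hab : ∀ n, b n ^ (n + 1) ≤ ∏ j ∈ Finset.range (n + 1), a j) (N : ℕ) :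
    ∑ n ∈ Finset.range N, b n ≤ 2 * Real.exp 1 * ∑ n ∈ Finset.range N, a n := by
  set S : ℕ → ℝ := fun n => ∑ j ∈ Finset.range n, (j + 1 : ℝ) * a j with hS
  have S0 : ∀ n, 0 ≤ S n := fun n => Finset.sum_nonneg fun j _ => mul_nonneg (by positivity) (ha j)
  have hbS : ∀ n, b n ≤ Real.exp 1 * (S (n + 1) / (n + 1) ^ 2) := by
    intro n
    have amgm : ∏ j ∈ Finset.range (n + 1), ((j + 1 : ℝ) * a j) ≤ (S (n + 1) / (n + 1)) ^ (n + 1) := by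
      have h := Real.geom_mean_le_arith_mean (Finset.range (n + 1)) (fun _ => 1)
        (fun j => (j + 1 : ℝ) * a j) (by simp) (by simp; positivity)
        (fun j _ => mul_nonneg (by positivity) (ha j))
      simp only [Real.rpow_one, Finset.sum_const, Finset.card_range, nsmul_eq_mul, mul_one,
        one_mul] at h
      have hP : 0 ≤ ∏ j ∈ Finset.range (n + 1), ((j + 1 : ℝ) * a j) :=
        Finset.prod_nonneg fun j _ => mul_nonneg (by positivity) (ha j)
      have h2 := pow_le_pow_left₀ (Real.rpow_nonneg hP _) h (n + 1)
      rw [Real.rpow_inv_natCast_pow hP (by omega)] at h2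
      push_cast at h2
      exact h2
    have fact : ((n + 1 : ℝ) / Real.exp 1) ^ (n + 1) ≤ ((n + 1).factorial : ℝ) := by
      have h := Real.pow_div_factorial_le_exp ((n : ℝ) + 1) (by positivity) (n + 1)
      rw [div_le_iff₀ (by positivity)] at h
      rw [div_pow, div_le_iff₀ (by positivity), ← Real.exp_nat_mul]
      push_cast
      rw [mul_one]
      linarith
    have h3 : ((n + 1 : ℝ) / Real.exp 1 * b n) ^ (n + 1) ≤ (S (n + 1) / (n + 1)) ^ (n + 1) := by
      refine le_trans ?_ amgm
      rw [mul_pow, Finset.prod_mul_distrib]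
      have e : ∏ j ∈ Finset.range (n + 1), (j + 1 : ℝ) = ((n + 1).factorial : ℝ) := by
        rw [← Finset.prod_range_add_one_eq_factorial]; push_cast; rfl
      rw [e]
      exact mul_le_mul fact (hab n) (pow_nonneg (hb n) _) (by positivity)
    have h4 := le_of_pow_le_pow_left₀ (by omega)
      (div_nonneg (S0 _) (by positivity)) h3
    have : (0 : ℝ) < n + 1 := by positivity
    have he := Real.exp_pos 1
    calc b n = Real.exp 1 / (n + 1) * ((n + 1 : ℝ) / Real.exp 1 * b n) := by field_simp
      _ ≤ Real.exp 1 / (n + 1) * (S (n + 1) / (n + 1)) := by gcongr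
      _ = _ := by field_simp
  have pot : ∀ N, ∑ n ∈ Finset.range N, S (n + 1) / (n + 1 : ℝ) ^ 2
      ≤ 2 * ∑ n ∈ Finset.range N, a n - S N / N := by
    intro N
    induction N with
    | zero => simp
    | succ N ih =>
      rw [Finset.sum_range_succ, Finset.sum_range_succ]
      have hs : S (N + 1) = S N + (N + 1) * a N := Finset.sum_range_succ _ _
      have hcore : S (N + 1) / (N + 1 : ℝ) ^ 2 + S (N + 1) / ((N + 1 : ℕ) : ℝ)
          ≤ S N / N + 2 * a N := by
        rcases Nat.eq_zero_or_pos N with rfl | hN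
        · simp [hS]; linarith
        · have hN' : (0 : ℝ) < N := by exact_mod_cast hN
          have e : S (N + 1) / (N + 1 : ℝ) ^ 2 + S (N + 1) / ((N + 1 : ℕ) : ℝ)
              = S N * ((N + 2) / (N + 1) ^ 2) + a N * ((N + 2) / (N + 1)) := by
            rw [hs]; push_cast; field_simp; ring
          rw [e]
          have h1 : ((N : ℝ) + 2) / (N + 1) ^ 2 ≤ 1 / N := by
            rw [div_le_div_iff₀ (by positivity) hN']; nlinarith
          have h2 : ((N : ℝ) + 2) / (N + 1) ≤ 2 := by
            rw [div_le_iff₀ (by positivity)]; nlinarith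
          have := mul_le_mul_of_nonneg_left h1 (S0 N)
          have := mul_le_mul_of_nonneg_left h2 (ha N)
          rw [div_eq_mul_one_div (S N)]
          linarith
      linarith
  calc ∑ n ∈ Finset.range N, b n
      ≤ ∑ n ∈ Finset.range N, Real.exp 1 * (S (n + 1) / (n + 1 : ℝ) ^ 2) :=
        Finset.sum_le_sum fun n _ => hbS n
    _ = Real.exp 1 * ∑ n ∈ Finset.range N, S (n + 1) / (n + 1 : ℝ) ^ 2 := by
        rw [Finset.mul_sum]
    _ ≤ Real.exp 1 * (2 * ∑ n ∈ Finset.range N, a n) := by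
        refine mul_le_mul_of_nonneg_left ((pot N).trans ?_) (Real.exp_pos 1).le
        linarith [div_nonneg (S0 N) (Nat.cast_nonneg N)]
    _ = _ := by ring

lemma not_summable_one_div_mul_log :
    ¬ Summable fun n : ℕ => 1 / ((n : ℝ) * Real.log (n + 2)) := by
  have hlog : ∀ n : ℕ, 0 < Real.log ((n : ℝ) + 2) := fun n =>
    Real.log_pos (by have : (0 : ℝ) ≤ n := Nat.cast_nonneg n; linarith)
  rw [← summable_condensed_iff_of_nonneg]
  · intro h
    have h2 : Summable fun k : ℕ => (1 / Real.log 2) * (1 / ((k + 2 : ℕ) : ℝ)) := by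
      refine Summable.of_nonneg_of_le (fun k => ?_) (fun k => ?_) h
      · have := Real.log_pos (show (1 : ℝ) < 2 by norm_num)
        positivity
      · have hl := hlog (2 ^ k)
        have e : (2 : ℝ) ^ k * (1 / (((2 ^ k : ℕ) : ℝ) * Real.log (((2 ^ k : ℕ) : ℝ) + 2)))
            = 1 / Real.log (((2 ^ k : ℕ) : ℝ) + 2) := by
          push_cast
          push_cast at hl
          field_simp
        rw [e, one_div_mul_one_div, mul_comm]
        refine one_div_le_one_div_of_le hl ?_
        rw [← Real.log_pow]
        refine Real.log_le_log (by positivity) ?_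
        push_cast
        have : (1 : ℝ) ≤ 2 ^ k := one_le_pow₀ (by norm_num)
        rw [pow_add]
        linarith
    rw [summable_mul_left_iff (by have := Real.log_pos (show (1 : ℝ) < 2 by norm_num); positivity)]
      at h2
    exact Real.not_summable_one_div_natCast
      ((summable_nat_add_iff (f := fun n : ℕ => 1 / (n : ℝ)) 2).1 h2)
  · intro n
    have := hlog n
    positivity
  · intro m n hm hmn
    have hm' : (0 : ℝ) < m := by exact_mod_cast hm
    have hmn' : (m : ℝ) ≤ n := by exact_mod_cast hmn
    have := hlog m
    refine one_div_le_one_div_of_le (by positivity) ?_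
    gcongr

/-- Carleman's condition, for sequences whose even terms grow like `(n log n) ^ (2 n)`. -/
lemma not_summable_ratio {M : ℕ → ℝ} (hM : ∀ n, 0 < M n) {K : ℝ} (hK : 0 < K)
    (hgrowth : ∀ n : ℕ, 1 ≤ n → M (2 * n) ≤ M 0 * (K * (n * Real.log (n + 2))) ^ (2 * n)) :
    ¬ Summable fun n => M n / M (n + 1) := by
  intro hsum
  have hlog : ∀ n : ℕ, 0 < Real.log ((n : ℝ) + 2) := fun n =>
    Real.log_pos (by have : (0 : ℝ) ≤ n := Nat.cast_nonneg n; linarith)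
  set c : ℕ → ℝ := fun n => 1 / (K * (n * Real.log (n + 2))) with hc
  have hc0 : ∀ n, 0 ≤ c n := fun n => by have := hlog n; simp only [hc]; positivity
  set b : ℕ → ℝ := fun k => if Odd k then c ((k + 1) / 2) else 0 with hb
  have hb0 : ∀ k, 0 ≤ b k := fun k => by
    simp only [hb]; split_ifs
    · exact hc0 _
    · exact le_rfl
  have ha0 : ∀ n, 0 ≤ M n / M (n + 1) := fun n => (div_pos (hM _) (hM _)).le
  have hprod : ∀ n, ∏ j ∈ Finset.range n, M j / M (j + 1) = M 0 / M n := by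
    intro n
    induction n with
    | zero => simp [(hM 0).ne']
    | succ n ih => rw [Finset.prod_range_succ, ih, div_mul_div_cancel₀ (hM n).ne']
  have hab : ∀ n, b n ^ (n + 1) ≤ ∏ j ∈ Finset.range (n + 1), M j / M (j + 1) := by
    intro k
    rw [hprod]
    by_cases hk : Odd k
    · obtain ⟨n, rfl⟩ := hk
      have h1 : (2 * n + 1 + 1) / 2 = n + 1 := by omega
      have h2 : 2 * n + 1 + 1 = 2 * (n + 1) := by ring
      simp only [hb, if_pos (show Odd (2 * n + 1) from ⟨n, rfl⟩), h1]
      rw [h2]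
      have hl := hlog (n + 1)
      rw [le_div_iff₀ (hM _)]
      simp only [hc]
      rw [div_pow, one_pow, one_div_mul_eq_div, div_le_iff₀ (by positivity)]
      exact hgrowth (n + 1) (by omega)
    · simp only [hb, if_neg hk]
      rw [zero_pow (by omega)]
      exact (div_pos (hM _) (hM _)).le
  have hbs : Summable b := summable_of_sum_range_le hb0 fun N =>
    (carleman_inequality ha0 hb0 hab N).trans
      (mul_le_mul_of_nonneg_left (hsum.sum_le_tsum _ fun i _ => ha0 i) (by positivity))
  have h1 : Summable fun n : ℕ => c (n + 1) := by
    have := hbs.comp_injective (i := fun n : ℕ => 2 * n + 1) (fun x y h => by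
      simp only at h; omega)
    refine this.congr fun n => ?_
    have h1 : (2 * n + 1 + 1) / 2 = n + 1 := by omega
    simp only [hb, Function.comp, if_pos (show Odd (2 * n + 1) from ⟨n, rfl⟩), h1]
  rw [summable_nat_add_iff (f := c) 1] at h1
  refine not_summable_one_div_mul_log ((h1.mul_left K).congr fun n => ?_)
  simp only [hc]
  rw [mul_one_div, div_mul_eq_div_div, div_self hK.ne']

/-- Carleman's criterion for the Hamburger moment problem, in terms of the growth of the absolute
moments of `μ + ν`. -/
lemma measure_eq_of_moments {μ ν : Measure ℝ} [IsFiniteMeasure μ] [IsFiniteMeasure ν]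
    (hμ : ∀ n : ℕ, Integrable (fun x => x ^ n) μ) (hν : ∀ n : ℕ, Integrable (fun x => x ^ n) ν)
    (heq : ∀ n : ℕ, ∫ x, x ^ n ∂μ = ∫ x, x ^ n ∂ν)
    (hpos : ∀ n : ℕ, 0 < ∫ x, |x| ^ n ∂(μ + ν))
    (hdiv : ¬ Summable fun n : ℕ => (∫ x, |x| ^ n ∂(μ + ν)) / ∫ x, |x| ^ (n + 1) ∂(μ + ν)) :
    μ = ν := by
  have habs : ∀ {ρ : Measure ℝ}, (∀ n : ℕ, Integrable (fun x => x ^ n) ρ) →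
      ∀ n : ℕ, Integrable (fun x => |x| ^ n) ρ := fun h n => by
    simpa [abs_pow] using (h n).abs
  have hLp : ∀ {ρ : Measure ℝ} [IsFiniteMeasure ρ], (∀ n : ℕ, Integrable (fun x => x ^ n) ρ) →
      ∀ n : ℕ, MemLp id (n : ENNReal) ρ := by
    intro ρ _ h n
    rcases Nat.eq_zero_or_pos n with rfl | hn
    · simpa using aestronglyMeasurable_id
    · rw [← integrable_norm_rpow_iff aestronglyMeasurable_id (by simpa using hn.ne') (by simp)]
      simpa using habs h n
  have hder : ∀ {ρ : Measure ℝ} [IsFiniteMeasure ρ], (∀ n : ℕ, Integrable (fun x => x ^ n) ρ) →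
      ∀ (j : ℕ) (t : ℝ), HasDerivAt (iteratedDeriv j (charFun ρ))
        (iteratedDeriv (j + 1) (charFun ρ) t) t := by
    intro ρ _ h j t
    rw [iteratedDeriv_succ]
    have hd := (contDiff_charFun (hLp h (j + 1))).differentiable_iteratedDeriv j
      (by exact_mod_cast Nat.lt_succ_self j)
    exact (hd t).hasDerivAt
  have hbd : ∀ {ρ : Measure ℝ} [IsFiniteMeasure ρ], (∀ n : ℕ, Integrable (fun x => x ^ n) ρ) →
      ∀ (j : ℕ) (t : ℝ), ‖iteratedDeriv j (charFun ρ) t‖ ≤ ∫ x, |x| ^ j ∂ρ := by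
    intro ρ _ h j t
    rw [iteratedDeriv_charFun (hLp h j), norm_mul, norm_pow, Complex.norm_I, one_pow, one_mul]
    refine (norm_integral_le_integral_norm _).trans (le_of_eq (integral_congr_ae ?_))
    refine Eventually.of_forall fun x => ?_
    simp only [norm_mul, norm_pow, Complex.norm_real, Real.norm_eq_abs]
    rw [← Complex.ofReal_mul, Complex.norm_exp_ofReal_mul_I, mul_one]
  have hz : ∀ {ρ : Measure ℝ} [IsFiniteMeasure ρ], (∀ n : ℕ, Integrable (fun x => x ^ n) ρ) →
      ∀ (j : ℕ), iteratedDeriv j (charFun ρ) 0 = Complex.I ^ j * ((∫ x, x ^ j ∂ρ : ℝ) : ℂ) := by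
    intro ρ _ h j
    rw [iteratedDeriv_charFun (hLp h j), ← integral_complex_ofReal]
    simp
  have hlc : ∀ n : ℕ, (∫ x, |x| ^ (n + 1) ∂(μ + ν)) ^ 2
      ≤ (∫ x, |x| ^ n ∂(μ + ν)) * ∫ x, |x| ^ (n + 2) ∂(μ + ν) := by
    intro n
    have hi : ∀ n : ℕ, Integrable (fun x => |x| ^ n) (μ + ν) := fun n =>
      (habs hμ n).add_measure (habs hν n)
    set A := ∫ x, |x| ^ n ∂(μ + ν) with hA
    set B := ∫ x, |x| ^ (n + 1) ∂(μ + ν) with hB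
    set C := ∫ x, |x| ^ (n + 2) ∂(μ + ν) with hC
    have h0 : 0 ≤ ∫ x, |x| ^ n * (A * |x| - B) ^ 2 ∂(μ + ν) :=
      integral_nonneg fun x => by positivity
    have e : ∫ x, |x| ^ n * (A * |x| - B) ^ 2 ∂(μ + ν)
        = A ^ 2 * C - 2 * A * B * B + B ^ 2 * A := by
      have e1 : ∀ x : ℝ, |x| ^ n * (A * |x| - B) ^ 2
          = A ^ 2 * |x| ^ (n + 2) - 2 * A * B * |x| ^ (n + 1) + B ^ 2 * |x| ^ n := fun x => by ring
      have i1 : Integrable (fun x => A ^ 2 * |x| ^ (n + 2) - 2 * A * B * |x| ^ (n + 1)) (μ + ν) :=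
        ((hi _).const_mul _).sub ((hi _).const_mul _)
      simp only [e1]
      rw [integral_add i1 ((hi _).const_mul _),
        integral_sub ((hi _).const_mul _) ((hi _).const_mul _), integral_const_mul,
        integral_const_mul, integral_const_mul]
    rw [e] at h0
    have hApos : 0 < A := hpos n
    have : 0 ≤ A * (A * C - B ^ 2) := by linarith
    linarith [nonneg_of_mul_nonneg_right this hApos]
  have key : ∀ t, 0 ≤ t → charFun μ t = charFun ν t := by
    intro t ht
    have := denjoy_carleman
      (F := fun j t => iteratedDeriv j (charFun μ) t - iteratedDeriv j (charFun ν) t)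
      (M := fun n => ∫ x, |x| ^ n ∂(μ + ν))
      (fun j t => (hder hμ j t).sub (hder hν j t)) hpos hlc
      (fun j t => by
        rw [integral_add_measure (habs hμ j) (habs hν j)]
        exact (norm_sub_le _ _).trans (add_le_add (hbd hμ j t) (hbd hν j t)))
      (fun j => by simp only [hz hμ, hz hν, heq, sub_self]) hdiv t ht
    simpa [sub_eq_zero] using this
  refine Measure.ext_of_charFun (funext fun t => ?_)
  rcases le_total 0 t with ht | ht
  · exact key t ht
  · rw [← neg_neg t, charFun_neg (-t), charFun_neg (-t), key (-t) (by linarith)]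

lemma lintegral_Ici_eq_of_density {x₀ c : ℝ} {μ : Measure ℝ} {g : ℝ → ℝ} (hg_meas : Measurable g)
    (hg_ac : μ.restrict (Ici x₀) =
      (volume.restrict (Ici x₀)).withDensity (fun x => ENNReal.ofReal (g x)))
    (hc : x₀ ≤ c) {f : ℝ → ENNReal} (hf : Measurable f) :
    ∫⁻ x in Ici c, f x ∂μ = ∫⁻ x in Ici c, ENNReal.ofReal (g x) * f x := by
  have h : μ.restrict (Ici c) =
      (volume.restrict (Ici c)).withDensity (fun x => ENNReal.ofReal (g x)) := by
    have := congrArg (fun ρ : Measure ℝ => ρ.restrict (Ici c)) hg_ac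
    rwa [restrict_withDensity measurableSet_Ici, Measure.restrict_restrict measurableSet_Ici,
      Measure.restrict_restrict measurableSet_Ici,
      inter_eq_self_of_subset_left (Ici_subset_Ici.2 hc)] at this
  rw [h, lintegral_withDensity_eq_lintegral_mul _ hg_meas.ennreal_ofReal hf]
  rfl

/-- Change of variables `y = φ x` in the tail integral. -/
lemma lintegral_Ici_le_comp {x₀ x₁ q ε : ℝ} {μ : Measure ℝ} {g φ φ' : ℝ → ℝ}
    (hg_meas : Measurable g)
    (hg_ac : μ.restrict (Ici x₀) =
      (volume.restrict (Ici x₀)).withDensity (fun x => ENNReal.ofReal (g x)))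
    (hg_pos : ∀ x ∈ Ici x₀, 0 < g x) (hx : x₀ ≤ x₁) (hε : 0 ≤ ε)
    (hφ : ∀ x ∈ Ici x₁, HasDerivAt φ (φ' x) x) (hφ1 : ∀ x ∈ Ici x₁, 1 ≤ φ' x)
    (hφ2 : ∀ x ∈ Ici x₁, φ' x ≤ 1 + ε) (hφx : ∀ x ∈ Ici x₁, x ≤ φ x)
    (hgφ : ∀ x ∈ Ici x₁, g (φ x) ≤ q * g x) (hφm : Measurable φ)
    {f : ℝ → ENNReal} (hf : Measurable f) :
    ∫⁻ x in Ici (φ x₁), f x ∂μ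
      ≤ ENNReal.ofReal (q * (1 + ε)) * ∫⁻ x in Ici x₁, f (φ x) ∂μ := by
  have hcont : ContinuousOn φ (Ici x₁) := fun x hx => (hφ x hx).continuousAt.continuousWithinAt
  have hmono : StrictMonoOn φ (Ici x₁) := by
    refine strictMonoOn_of_deriv_pos (convex_Ici _) hcont fun x hx => ?_
    have hx' := interior_subset hx
    rw [(hφ x hx').deriv]
    linarith [hφ1 x hx']
  have himg : Ici (φ x₁) ⊆ φ '' Ici x₁ := by
    intro y hy
    have h1 : x₁ ≤ y := (hφx x₁ self_mem_Ici).trans hy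
    obtain ⟨z, hz, rfl⟩ := intermediate_value_Icc h1 (hcont.mono Icc_subset_Ici_self)
      ⟨hy, hφx y h1⟩
    exact ⟨z, hz.1, rfl⟩
  rw [lintegral_Ici_eq_of_density hg_meas hg_ac (hx.trans (hφx x₁ self_mem_Ici)) hf,
    lintegral_Ici_eq_of_density hg_meas hg_ac hx (f := fun x => f (φ x)) (hf.comp hφm),
    ← lintegral_const_mul (f := fun x => ENNReal.ofReal (g x) * f (φ x)) _
      (hg_meas.ennreal_ofReal.mul (hf.comp hφm))]
  refine (lintegral_mono_set himg).trans ?_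
  rw [lintegral_image_eq_lintegral_abs_deriv_mul measurableSet_Ici
    (fun x hx => (hφ x hx).hasDerivWithinAt) hmono.injOn]
  refine setLIntegral_mono' measurableSet_Ici fun x hx' => ?_
  have h1 := hφ1 x hx'
  have hgx := hg_pos x (hx.trans hx')
  have hgp := hg_pos (φ x) ((hx.trans hx').trans (hφx x hx'))
  rw [← mul_assoc, ← mul_assoc, abs_of_nonneg (by linarith), ← ENNReal.ofReal_mul (by linarith)]
  have hq : 0 ≤ q := by
    by_contra hq
    have := hgφ x hx'
    nlinarith
  rw [← ENNReal.ofReal_mul (by positivity)]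
  refine mul_le_mul' (ENNReal.ofReal_le_ofReal ?_) le_rfl
  calc φ' x * g (φ x) ≤ (1 + ε) * (q * g x) :=
        mul_le_mul (hφ2 x hx') (hgφ x hx') hgp.le (by linarith)
    _ = _ := by ring

/-- If the density contracts by a factor `q < 1` along the logarithmic shift `φ`, then
the `n`-th moment is at most `(D T) ^ n` as soon as `n log T` is small compared with `T`. -/
lemma moment_le {x₀ x₁ q ε C δ T : ℝ} {μ : Measure ℝ} [IsProbabilityMeasure μ] {g φ φ' : ℝ → ℝ}
    (hsupp : μ (Iio 0) = 0) (hmom : ∀ n : ℕ, Integrable (fun x => x ^ n) μ)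
    (hg_meas : Measurable g)
    (hg_ac : μ.restrict (Ici x₀) =
      (volume.restrict (Ici x₀)).withDensity (fun x => ENNReal.ofReal (g x)))
    (hg_pos : ∀ x ∈ Ici x₀, 0 < g x) (hx : x₀ ≤ x₁) (hε : 0 ≤ ε)
    (hφ : ∀ x ∈ Ici x₁, HasDerivAt φ (φ' x) x) (hφ1 : ∀ x ∈ Ici x₁, 1 ≤ φ' x)
    (hφ2 : ∀ x ∈ Ici x₁, φ' x ≤ 1 + ε) (hφx : ∀ x ∈ Ici x₁, x ≤ φ x)
    (hgφ : ∀ x ∈ Ici x₁, g (φ x) ≤ q * g x) (hφm : Measurable φ)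
    (hx₁ : Real.exp 1 ≤ x₁) (hC : 0 ≤ C) (hφC : ∀ x ∈ Ici x₁, φ x ≤ x + C * Real.log x)
    (hq : 0 ≤ q) (hδ1 : δ ≤ 1) (hθ : q * (1 + ε) * Real.exp δ < 1) (hθ1 : q * (1 + ε) ≤ 1)
    (n : ℕ) (hn : 1 ≤ n) (hT : x₁ ≤ T) (hnT : n * (C * Real.log T) ≤ δ * T) :
    ∫ x, x ^ n ∂μ ≤ (2 / (1 - q * (1 + ε) * Real.exp δ) * (2 * T)) ^ n := by
  set θ := q * (1 + ε) with hθdef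
  have hθ0 : 0 ≤ θ := by positivity
  have he := Real.exp_pos 1
  have hx₁0 : 0 < x₁ := by linarith
  have hT0 : 0 < T := by linarith
  have hnR : (1 : ℝ) ≤ n := by exact_mod_cast hn
  have hsmall : ∀ x, x₁ ≤ x → x ≤ T → φ x ≤ 2 * T := by
    intro x h1 h2
    have hl : Real.log x ≤ Real.log T := Real.log_le_log (by linarith) h2
    have hlT : 0 ≤ Real.log T := Real.log_nonneg (by linarith [Real.add_one_le_exp 1])
    have h3 := hφC x h1
    have h4 : C * Real.log x ≤ C * Real.log T := by gcongr
    have h5 : C * Real.log T ≤ n * (C * Real.log T) := le_mul_of_one_le_left (by positivity) hnR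
    have h6 : δ * T ≤ 1 * T := by gcongr
    linarith
  have hlarge : ∀ x, T ≤ x → φ x ^ n ≤ Real.exp δ * x ^ n := by
    intro x h1
    have hx0 : 0 < x := by linarith
    have h2 : φ x ≤ x * Real.exp (C * Real.log x / x) := by
      have := Real.add_one_le_exp (C * Real.log x / x)
      calc φ x ≤ x + C * Real.log x := hφC x (hT.trans h1)
        _ = x * (C * Real.log x / x + 1) := by field_simp; ring
        _ ≤ _ := by gcongr
    have h3 : (n : ℝ) * (C * Real.log x / x) ≤ δ := by
      have hanti := Real.log_div_self_antitoneOn (show T ∈ Ici (Real.exp 1) from hx₁.trans hT)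
        (show x ∈ Ici (Real.exp 1) from (hx₁.trans hT).trans h1) h1
      simp only at hanti
      calc (n : ℝ) * (C * Real.log x / x) = n * C * (Real.log x / x) := by ring
        _ ≤ n * C * (Real.log T / T) := by gcongr
        _ = n * (C * Real.log T) / T := by ring
        _ ≤ δ := by rwa [div_le_iff₀ hT0]
    have h0 : 0 ≤ φ x := hx0.le.trans (hφx x (hT.trans h1))
    calc φ x ^ n ≤ (x * Real.exp (C * Real.log x / x)) ^ n := by gcongr
      _ = Real.exp (n * (C * Real.log x / x)) * x ^ n := by
        rw [mul_pow, ← Real.exp_nat_mul, mul_comm]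
      _ ≤ _ := by gcongr
  set J := ∫ x, x ^ n ∂μ with hJ
  set c := φ x₁ with hc
  have hc0 : 0 < c := hx₁0.trans_le (hφx x₁ self_mem_Ici)
  have hnonneg : ∀ᵐ x ∂μ, 0 ≤ x := by
    rw [ae_iff]
    simpa [Iio] using hsupp
  have hIJ : ∀ b, ∫ x in Ici b, x ^ n ∂μ ≤ J := fun b =>
    setIntegral_le_integral (hmom n) (hnonneg.mono fun x hx => pow_nonneg hx n)
  have htail : ∫ x in Ici c, x ^ n ∂μ ≤ θ * ((2 * T) ^ n + Real.exp δ * J) := by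
    have hnn : 0 ≤ (2 * T) ^ n + Real.exp δ * J := by
      have : 0 ≤ J := integral_nonneg_of_ae (hnonneg.mono fun x hx => pow_nonneg hx n)
      positivity
    rw [← ENNReal.ofReal_le_ofReal_iff (by positivity), ENNReal.ofReal_mul hθ0,
      ofReal_integral_eq_lintegral_ofReal (hmom n).integrableOn
        (ae_restrict_of_ae (hnonneg.mono fun x hx => pow_nonneg hx n))]
    refine (lintegral_Ici_le_comp hg_meas hg_ac hg_pos hx hε hφ hφ1 hφ2 hφx hgφ hφm
      (f := fun x => ENNReal.ofReal (x ^ n)) (by fun_prop)).trans ?_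
    gcongr
    have hint : Integrable (fun x => (2 * T) ^ n + Real.exp δ * x ^ n) (μ.restrict (Ici x₁)) :=
      (integrable_const _).add ((hmom n).integrableOn.const_mul _)
    calc ∫⁻ x in Ici x₁, ENNReal.ofReal (φ x ^ n) ∂μ
        ≤ ∫⁻ x in Ici x₁, ENNReal.ofReal ((2 * T) ^ n + Real.exp δ * x ^ n) ∂μ := by
          refine setLIntegral_mono' measurableSet_Ici fun x hx' => ENNReal.ofReal_le_ofReal ?_
          have hx0 : 0 < x := hx₁0.trans_le hx'
          rcases le_total x T with h | h
          · have h0 : 0 ≤ φ x := hx0.le.trans (hφx x hx')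
            have := pow_le_pow_left₀ h0 (hsmall x hx' h) n
            have : 0 ≤ Real.exp δ * x ^ n := by positivity
            linarith
          · have := hlarge x h
            have : 0 ≤ (2 * T) ^ n := by positivity
            linarith
      _ = ENNReal.ofReal (∫ x in Ici x₁, ((2 * T) ^ n + Real.exp δ * x ^ n) ∂μ) := by
          rw [ofReal_integral_eq_lintegral_ofReal hint]
          exact ae_restrict_of_ae (hnonneg.mono fun x hx => by
            have := pow_nonneg hx n
            positivity)
      _ ≤ _ := by
          refine ENNReal.ofReal_le_ofReal ?_
          rw [integral_add (integrable_const _) ((hmom n).integrableOn.const_mul _),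
            integral_const_mul]
          refine add_le_add ?_ (mul_le_mul_of_nonneg_left (hIJ x₁) (Real.exp_pos _).le)
          rw [integral_const, smul_eq_mul]
          refine mul_le_of_le_one_left (by positivity) ?_
          rw [measureReal_restrict_apply_univ]
          exact measureReal_le_one
  have hsplit : J ≤ c ^ n + ∫ x in Ici c, x ^ n ∂μ := by
    rw [← integral_indicator measurableSet_Ici]
    have hind : Integrable ((Ici c).indicator fun x => x ^ n) μ :=
      (hmom n).indicator measurableSet_Ici
    calc J ≤ ∫ x, (c ^ n + (Ici c).indicator (fun x => x ^ n) x) ∂μ := by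
          refine integral_mono_ae (hmom n) ((integrable_const _).add hind) ?_
          filter_upwards [hnonneg] with x hx0
          by_cases h : x ∈ Ici c
          · rw [indicator_of_mem h]
            linarith [pow_pos hc0 n]
          · rw [indicator_of_notMem h, add_zero]
            exact pow_le_pow_left₀ hx0 (not_le.1 h).le n
      _ = _ := by
          rw [integral_add (integrable_const _) hind]
          simp
  have hcT : c ^ n ≤ (2 * T) ^ n := pow_le_pow_left₀ hc0.le (hsmall x₁ le_rfl hT) n
  have hD : 0 < 1 - θ * Real.exp δ := by linarith
  have hTn : 0 < (2 * T) ^ n := by positivity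
  have h1 : J ≤ 2 / (1 - θ * Real.exp δ) * (2 * T) ^ n := by
    rw [div_mul_eq_mul_div, le_div_iff₀ hD]
    have : θ * (2 * T) ^ n ≤ 1 * (2 * T) ^ n := by gcongr
    linarith
  refine h1.trans ?_
  rw [mul_pow _ (2 * T)]
  refine mul_le_mul_of_nonneg_right (le_self_pow₀ ?_ (Nat.one_le_iff_ne_zero.1 hn)) hTn.le
  rw [le_div_iff₀ hD]
  have : 0 ≤ θ * Real.exp δ := by positivity
  linarith

lemma hasDerivAt_shift (a α : ℝ) {x : ℝ} (hx : 1 < x) :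
    HasDerivAt (fun x => x + a * (Real.log x) ^ α * Real.log (Real.log x))
      (1 + (a * (x⁻¹ * α * Real.log x ^ (α - 1)) * Real.log (Real.log x)
        + a * Real.log x ^ α * (x⁻¹ / Real.log x))) x := by
  have hL := Real.log_pos hx
  have h1 := Real.hasDerivAt_log (show x ≠ 0 by linarith)
  exact (hasDerivAt_id x).add
    (((h1.rpow_const (p := α) (Or.inl hL.ne')).const_mul a).mul (h1.log hL.ne'))

lemma exists_moment_growth
    (x₀ : ℝ) (a α : ℝ) (ha : 0 < a) (hα : α ∈ Ico (0 : ℝ) 1)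
    (μ : Measure ℝ) [IsProbabilityMeasure μ]
    (hsupp : μ (Iio 0) = 0)
    (hmom : ∀ n : ℕ, Integrable (fun x => x ^ n) μ)
    (g : ℝ → ℝ) (hg_meas : Measurable g)
    (hg_ac : μ.restrict (Ici x₀) =
      (volume.restrict (Ici x₀)).withDensity (fun x => ENNReal.ofReal (g x)))
    (hg_pos : ∀ x ∈ Ici x₀, 0 < g x)
    (hlimsup : Filter.limsup
        (fun x => ENNReal.ofReal
          (g (x + a * (Real.log x) ^ α * Real.log (Real.log x)) / g x)) atTop < 1) :
    ∃ K : ℝ, 0 < K ∧ ∀ n : ℕ, 1 ≤ n →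
      ∫ x, x ^ n ∂μ ≤ (K * (n * Real.log (n + 2))) ^ n := by
  obtain ⟨hα0, hα1⟩ := hα
  obtain ⟨p, hp_gt, hp_lt⟩ := exists_between hlimsup
  set q := p.toReal with hq
  have hq0 : 0 ≤ q := ENNReal.toReal_nonneg
  have hp_top : p ≠ ⊤ := (hp_lt.trans ENNReal.one_lt_top).ne
  have hq1 : q < 1 := by
    have := (ENNReal.toReal_lt_toReal hp_top ENNReal.one_ne_top).2 hp_lt
    simpa using this
  set ε := (1 - q) / 2 with hε
  have hε0 : 0 < ε := by rw [hε]; linarith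
  have hθ1 : q * (1 + ε) < 1 := by rw [hε]; nlinarith
  set θ := q * (1 + ε) with hθ
  have hθ0 : 0 ≤ θ := by positivity
  set δ := (1 - θ) / 2 with hδ
  have hδ0 : 0 < δ := by rw [hδ]; linarith
  have hδ1 : δ ≤ 1 := by rw [hδ]; linarith
  have hθδ : θ * Real.exp δ < 1 := by
    have h1 : 1 - δ ≤ Real.exp (-δ) := by linarith [Real.add_one_le_exp (-δ)]
    have h2 : θ < Real.exp (-δ) := by rw [hδ] at *; linarith
    calc θ * Real.exp δ < Real.exp (-δ) * Real.exp δ := by gcongr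
      _ = 1 := by rw [← Real.exp_add]; simp
  have hlim : Tendsto (fun x : ℝ => 2 * a * (Real.log x / x)) atTop (nhds 0) := by
    have := (Real.isLittleO_log_id_atTop.tendsto_div_nhds_zero).const_mul (2 * a)
    simpa using this
  obtain ⟨x₁, hx₁⟩ := eventually_atTop.1
    ((eventually_ge_atTop (max x₀ (Real.exp 1))).and
      ((eventually_lt_of_limsup_lt hp_gt).and (hlim.eventually_le_const hε0)))
  have hx₀₁ : x₀ ≤ x₁ := (le_max_left _ _).trans (hx₁ x₁ le_rfl).1
  have hex : ∀ x ∈ Ici x₁, Real.exp 1 ≤ x := fun x hx => (le_max_right _ _).trans (hx₁ x hx).1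
  have h1x : ∀ x ∈ Ici x₁, 1 < x := fun x hx => by
    linarith [hex x hx, Real.add_one_lt_exp (one_ne_zero (α := ℝ))]
  have hL : ∀ x ∈ Ici x₁, 1 ≤ Real.log x := fun x hx => by
    rw [Real.le_log_iff_exp_le (by linarith [h1x x hx])]; exact hex x hx
  have hlogL : ∀ x ∈ Ici x₁, 0 ≤ Real.log (Real.log x) := fun x hx => Real.log_nonneg (hL x hx)
  set φ : ℝ → ℝ := fun x => x + a * (Real.log x) ^ α * Real.log (Real.log x) with hφ
  have hφx : ∀ x ∈ Ici x₁, x ≤ φ x := fun x hx => by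
    have := hlogL x hx
    have := hL x hx
    have : 0 ≤ a * (Real.log x) ^ α * Real.log (Real.log x) := by positivity
    simp only [hφ]; linarith
  have hφC : ∀ x ∈ Ici x₁, φ x ≤ x + a / (1 - α) * Real.log x := fun x hx => by
    have hLx := hL x hx
    have hLp : 0 < Real.log x := by linarith
    have h1 := Real.log_le_rpow_div hLp.le (show 0 < 1 - α by linarith)
    refine add_le_add le_rfl ?_
    calc a * (Real.log x) ^ α * Real.log (Real.log x)
        ≤ a * (Real.log x) ^ α * (Real.log x ^ (1 - α) / (1 - α)) := by gcongr
      _ = a / (1 - α) * (Real.log x ^ α * Real.log x ^ (1 - α)) := by ring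
      _ = _ := by rw [← Real.rpow_add hLp]; simp
  have hgφ : ∀ x ∈ Ici x₁, g (φ x) ≤ q * g x := fun x hx => by
    have h := (hx₁ x hx).2.1
    rw [ENNReal.ofReal_lt_iff_lt_toReal _ hp_top] at h
    · exact ((div_lt_iff₀ (hg_pos x (hx₀₁.trans hx))).1 h).le
    · exact div_nonneg (hg_pos _ ((hx₀₁.trans hx).trans (hφx x hx))).le
        (hg_pos x (hx₀₁.trans hx)).le
  set D := 2 / (1 - θ * Real.exp δ) with hD
  have hD0 : 0 < D := div_pos two_pos (by linarith)
  set C := a / (1 - α) with hC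
  have hC0 : 0 < C := div_pos ha (by linarith)
  -- the scale `A n log (n + 2)` satisfies `n C log T ≤ δ T`
  have hA : ∃ A : ℝ, x₁ ≤ A ∧ 1 ≤ A ∧ C * (Real.log A + 2) ≤ δ * A := by
    have h1 : Tendsto (fun A : ℝ => C * (Real.log A / A) + C * 2 * A⁻¹) atTop (nhds 0) := by
      have h2 := (Real.isLittleO_log_id_atTop.tendsto_div_nhds_zero).const_mul C
      have h3 := (tendsto_inv_atTop_zero (𝕜 := ℝ)).const_mul (C * 2)
      simpa using h2.add h3
    obtain ⟨A, hA1, hA2, hA3⟩ := ((eventually_ge_atTop x₁).and ((eventually_ge_atTop 1).and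
      (h1.eventually_le_const hδ0))).exists
    refine ⟨A, hA1, hA2, ?_⟩
    have hA0 : 0 < A := by linarith
    calc C * (Real.log A + 2) = (C * (Real.log A / A) + C * 2 * A⁻¹) * A := by field_simp
      _ ≤ δ * A := by gcongr
  obtain ⟨A, hAx, hA1, hAC⟩ := hA
  refine ⟨D * (2 * A), by positivity, fun n hn => ?_⟩
  have hnR : (1 : ℝ) ≤ n := by exact_mod_cast hn
  have hl1 : 1 ≤ Real.log ((n : ℝ) + 2) := by
    rw [Real.le_log_iff_exp_le (by positivity)]
    linarith [Real.exp_one_lt_d9]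
  have hnl : 1 ≤ n * Real.log ((n : ℝ) + 2) := one_le_mul_of_one_le_of_one_le hnR hl1
  have hres := moment_le (T := A * (n * Real.log (n + 2))) (δ := δ) hsupp hmom hg_meas hg_ac
    hg_pos hx₀₁ hε0.le (fun x hx => hasDerivAt_shift a α (h1x x hx))
    (fun x hx => ?_) (fun x hx => ?_) hφx hgφ (by fun_prop) (hex x₁ self_mem_Ici) hC0.le hφC
    hq0 hδ1 hθδ hθ1.le n hn ?_ ?_
  · refine hres.trans (le_of_eq ?_)
    rw [hD]
    ring
  · have := hlogL x hx
    have := hL x hx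
    have := h1x x hx
    have : 0 ≤ a * (x⁻¹ * α * Real.log x ^ (α - 1)) * Real.log (Real.log x)
        + a * Real.log x ^ α * (x⁻¹ / Real.log x) := by positivity
    linarith
  · have hll := hlogL x hx
    have hLx := hL x hx
    have h1 := h1x x hx
    have hlim' := (hx₁ x hx).2.2
    have e1 : Real.log x ^ (α - 1) ≤ 1 := Real.rpow_le_one_of_one_le_of_nonpos hLx (by linarith)
    have e2 : Real.log (Real.log x) ≤ Real.log x := Real.log_le_self (by linarith)
    have e3 : Real.log x ^ α ≤ Real.log x := Real.rpow_le_self_of_one_le hLx hα1.le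
    have e4 : x⁻¹ / Real.log x ≤ x⁻¹ := div_le_self (by positivity) hLx
    have : a * (x⁻¹ * α * Real.log x ^ (α - 1)) * Real.log (Real.log x)
        + a * Real.log x ^ α * (x⁻¹ / Real.log x)
        ≤ a * (x⁻¹ * 1 * 1) * Real.log x + a * Real.log x * x⁻¹ := by gcongr
    have e5 : a * (x⁻¹ * 1 * 1) * Real.log x + a * Real.log x * x⁻¹
      = 2 * a * (Real.log x / x) := by ring
    linarith
  · exact hAx.trans (le_mul_of_one_le_right (by linarith) hnl)
  · have hn0 : (0 : ℝ) < n := by linarith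
    have hl0 : 0 < Real.log ((n : ℝ) + 2) := by linarith
    have hlogT : Real.log (A * (n * Real.log (n + 2)))
        ≤ (Real.log A + 2) * Real.log (n + 2) := by
      rw [Real.log_mul (by positivity) (by positivity), Real.log_mul (by positivity) (by positivity)]
      have h1 : Real.log n ≤ Real.log (n + 2) := Real.log_le_log hn0 (by linarith)
      have h2 : Real.log (Real.log ((n : ℝ) + 2)) ≤ Real.log (n + 2) := Real.log_le_self hl0.le
      have h3 : 0 ≤ Real.log A := Real.log_nonneg hA1
      nlinarith
    calc (n : ℝ) * (C * Real.log (A * (n * Real.log (n + 2))))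
        ≤ n * (C * ((Real.log A + 2) * Real.log (n + 2))) := by gcongr
      _ = n * Real.log (n + 2) * (C * (Real.log A + 2)) := by ring
      _ ≤ n * Real.log (n + 2) * (δ * A) := by gcongr
      _ = _ := by ring

lemma measure_compl_zero_ne_zero {x₀ : ℝ} (hx₀ : 0 < x₀) {μ : Measure ℝ} {g : ℝ → ℝ}
    (hg_meas : Measurable g)
    (hg_ac : μ.restrict (Ici x₀) =
      (volume.restrict (Ici x₀)).withDensity (fun x => ENNReal.ofReal (g x)))
    (hg_pos : ∀ x ∈ Ici x₀, 0 < g x) : μ {0}ᶜ ≠ 0 := by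
  intro h0
  have h1 : μ (Ici x₀) = 0 :=
    measure_mono_null (fun x (hx : x₀ ≤ x) => (hx₀.trans_le hx).ne') h0
  have h2 := lintegral_Ici_eq_of_density hg_meas hg_ac le_rfl (measurable_const (a := (1 : ENNReal)))
  simp only [setLIntegral_const, h1, mul_zero, mul_one] at h2
  refine absurd h2 (ne_of_lt ?_)
  rw [setLIntegral_pos_iff hg_meas.ennreal_ofReal, inter_eq_self_of_subset_right]
  · simp
  · intro x hx
    simpa using hg_pos x hx

/-- Determinacy of the square, via symmetrization of square roots. -/
lemma isMomentDetOnNonneg_map_sq {μ : Measure ℝ} [IsProbabilityMeasure μ]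
    (hmom : ∀ n : ℕ, Integrable (fun x => x ^ n) μ) (hne : μ {0}ᶜ ≠ 0)
    {K : ℝ} (hK : 0 < K) (hgrowth : ∀ n : ℕ, 1 ≤ n →
      ∫ x, x ^ n ∂μ ≤ (K * (n * Real.log (n + 2))) ^ n) :
    IsMomentDetOnNonneg (μ.map (fun x => x ^ 2)) := by
  intro ν hνp hν0 hν
  have hsq : Measurable fun x : ℝ => x ^ 2 := by fun_prop
  have hνnonneg : ∀ᵐ x ∂ν, 0 ≤ x := by
    rw [ae_iff]
    simpa [Iio] using hν0
  set σ : Measure ℝ := ν.map Real.sqrt with hσ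
  have hsqrt : Measurable Real.sqrt := Real.continuous_sqrt.measurable
  have : IsProbabilityMeasure σ := Measure.isProbabilityMeasure_map hsqrt.aemeasurable
  have hσsq : σ.map (fun x => x ^ 2) = ν := by
    rw [hσ, Measure.map_map hsq hsqrt]
    conv_rhs => rw [← Measure.map_id (μ := ν)]
    refine Measure.map_congr (hνnonneg.mono fun x hx => ?_)
    simp [Real.sq_sqrt hx]
  -- the even moments of `σ` and `μ` agree
  have hνint : ∀ n : ℕ, Integrable (fun x => x ^ n) ν := fun n => by
    rcases Nat.eq_zero_or_pos n with rfl | hn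
    · simp
    · exact (hν n hn).1
  have hσeven : ∀ n : ℕ, Integrable (fun x => x ^ (2 * n)) σ ∧
      ∫ x, x ^ (2 * n) ∂σ = ∫ x, x ^ (2 * n) ∂μ := by
    intro n
    constructor
    · have := hνint n
      rw [← hσsq, integrable_map_measure (by fun_prop) hsq.aemeasurable] at this
      simpa [Function.comp_def, ← pow_mul] using this
    · rcases Nat.eq_zero_or_pos n with rfl | hn
      · simp
      · have := (hν n hn).2
        rw [integral_map hsq.aemeasurable (by fun_prop), ← hσsq,
          integral_map hsq.aemeasurable (by fun_prop)] at this
        simpa [← pow_mul] using this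
  have hσmom : ∀ n : ℕ, Integrable (fun x => x ^ n) σ := by
    intro n
    refine Integrable.mono' ((integrable_const (1 : ℝ)).add (hσeven n).1) (by fun_prop)
      (Eventually.of_forall fun x => ?_)
    simp only [Pi.add_apply, norm_pow, Real.norm_eq_abs]
    have : x ^ (2 * n) = (|x| ^ n) ^ 2 := by rw [← pow_mul, mul_comm n 2, pow_mul, pow_mul, sq_abs]
    rw [this]
    nlinarith [sq_nonneg (|x| ^ n - 1), sq_nonneg (|x| ^ n)]
  -- symmetrization
  have hneg : Measurable fun x : ℝ => -x := measurable_neg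
  have hmapint : ∀ {ρ : Measure ℝ}, (∀ n : ℕ, Integrable (fun x => x ^ n) ρ) →
      ∀ n : ℕ, Integrable (fun x => x ^ n) (ρ.map fun x => -x) := by
    intro ρ h n
    rw [integrable_map_measure (by fun_prop) hneg.aemeasurable]
    have : ((fun x : ℝ => x ^ n) ∘ fun x => -x) = fun x => (-1) ^ n * x ^ n := by
      funext x; simp [neg_pow x]
    rw [this]
    exact (h n).const_mul _
  have hsymint : ∀ {ρ : Measure ℝ}, (∀ n : ℕ, Integrable (fun x => x ^ n) ρ) →
      ∀ n : ℕ, Integrable (fun x => x ^ n) (ρ + ρ.map fun x => -x) := fun h n =>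
    (h n).add_measure (hmapint h n)
  have hsym : ∀ {ρ : Measure ℝ}, (∀ n : ℕ, Integrable (fun x => x ^ n) ρ) →
      ∀ n : ℕ, ∫ x, x ^ n ∂(ρ + ρ.map fun x => -x) = (1 + (-1) ^ n) * ∫ x, x ^ n ∂ρ := by
    intro ρ h n
    rw [integral_add_measure (h n) (hmapint h n), integral_map hneg.aemeasurable (by fun_prop)]
    have e : (fun x : ℝ => (-x) ^ n) = fun x => (-1) ^ n * x ^ n := funext fun x => neg_pow x n
    rw [e, integral_const_mul]
    ring
  have hmapsq : ∀ ρ : Measure ℝ, (ρ + ρ.map fun x => -x).map (fun x => x ^ 2)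
      = ρ.map (fun x => x ^ 2) + ρ.map fun x => x ^ 2 := by
    intro ρ
    rw [Measure.map_add _ _ hsq, Measure.map_map hsq hneg]
    congr 2
    funext x
    simp
  set μs := μ + μ.map fun x => -x with hμs
  set σs := σ + σ.map fun x => -x with hσs
  have heven : ∀ n : ℕ, ∫ x, |x| ^ (2 * n) ∂(μs + σs) = 4 * ∫ x, x ^ (2 * n) ∂μ := by
    intro n
    have e : ∀ x : ℝ, |x| ^ (2 * n) = x ^ (2 * n) := fun x => by rw [pow_mul, pow_mul, sq_abs]
    simp only [e]
    rw [integral_add_measure (hsymint hmom _) (hsymint hσmom _), hsym hmom, hsym hσmom,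
      (hσeven n).2, pow_mul]
    norm_num
    ring
  have hpos : ∀ n : ℕ, 0 < ∫ x, |x| ^ n ∂(μs + σs) := by
    intro n
    have hi : Integrable (fun x => |x| ^ n) (μs + σs) := by
      have h := ((hsymint hmom n).add_measure (hsymint hσmom n)).abs
      simpa only [abs_pow] using h
    rw [integral_pos_iff_support_of_nonneg (fun x => by positivity) hi]
    have hsub : ({0}ᶜ : Set ℝ) ⊆ Function.support fun x : ℝ => |x| ^ n := fun x hx => by
      simpa using pow_ne_zero n (abs_ne_zero.2 hx)
    refine lt_of_lt_of_le (pos_iff_ne_zero.2 hne) ((measure_mono hsub).trans ?_)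
    simp only [hμs, Measure.add_apply, add_assoc]
    exact le_self_add
  have hμσ : μs = σs := by
    refine measure_eq_of_moments (hsymint hmom) (hsymint hσmom) (fun n => ?_) hpos
      (not_summable_ratio (M := fun n => ∫ x, |x| ^ n ∂(μs + σs)) hpos
        (K := 4 * K) (by positivity) fun n hn => ?_)
    · rw [hsym hmom, hsym hσmom]
      rcases Nat.even_or_odd n with ⟨k, rfl⟩ | h
      · rw [← two_mul, (hσeven k).2]
      · simp [h.neg_one_pow]
    · have h0 : ∫ x, |x| ^ 0 ∂(μs + σs) = 4 := by
        have := heven 0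
        simpa using this
      rw [heven, h0]
      refine mul_le_mul_of_nonneg_left ((hgrowth (2 * n) (by omega)).trans ?_) (by norm_num)
      have hn0 : (0 : ℝ) < n := by exact_mod_cast hn
      have hl : Real.log (((2 * n : ℕ) : ℝ) + 2) ≤ 2 * Real.log ((n : ℝ) + 2) := by
        rw [← Real.log_rpow (by positivity)]
        refine Real.log_le_log (by positivity) ?_
        push_cast
        norm_num
        nlinarith
      have hl0 : 0 ≤ Real.log (((2 * n : ℕ) : ℝ) + 2) :=
        Real.log_nonneg (by push_cast; linarith)
      refine pow_le_pow_left₀ (by positivity) ?_ _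
      calc K * (((2 * n : ℕ) : ℝ) * Real.log (((2 * n : ℕ) : ℝ) + 2))
          ≤ K * (((2 * n : ℕ) : ℝ) * (2 * Real.log ((n : ℝ) + 2))) := by gcongr
        _ = 4 * K * (n * Real.log (n + 2)) := by push_cast; ring
  have h2 : ν + ν = μ.map (fun x => x ^ 2) + μ.map fun x => x ^ 2 := by
    rw [← hmapsq μ, ← hμs, hμσ, hσs, hmapsq, hσsq]
  ext s hs
  have h3 := congrArg (fun ρ : Measure ℝ => ρ s) h2
  simp only [Measure.add_apply, ← two_mul] at h3
  exact (ENNReal.mul_right_inj two_ne_zero ENNReal.ofNat_ne_top).1 h3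

/-- Determinacy of the square implies determinacy. -/
lemma IsMomentDetOnNonneg.of_map_sq {μ : Measure ℝ} (hsupp : μ (Iio 0) = 0)
    (h : IsMomentDetOnNonneg (μ.map (fun x => x ^ 2))) : IsMomentDetOnNonneg μ := by
  intro ν hνp hν0 hν
  have hsq : Measurable fun x : ℝ => x ^ 2 := by fun_prop
  have hsqrt : Measurable Real.sqrt := Real.continuous_sqrt.measurable
  have hinv : ∀ {ρ : Measure ℝ}, ρ (Iio 0) = 0 → (ρ.map (fun x => x ^ 2)).map Real.sqrt = ρ := by
    intro ρ hρ
    have hnonneg : ∀ᵐ x ∂ρ, 0 ≤ x := by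
      rw [ae_iff]
      simpa [Iio] using hρ
    rw [Measure.map_map hsqrt hsq]
    conv_rhs => rw [← Measure.map_id (μ := ρ)]
    refine Measure.map_congr (hnonneg.mono fun x hx => ?_)
    simp [Real.sqrt_sq hx]
  have key := h (ν.map (fun x => x ^ 2)) (Measure.isProbabilityMeasure_map hsq.aemeasurable)
    (by
      rw [Measure.map_apply hsq measurableSet_Iio]
      have : (fun x : ℝ => x ^ 2) ⁻¹' Iio 0 = ∅ := by
        ext x; simp [sq_nonneg]
      simp [this])
    (fun n hn => by
      constructor
      · rw [integrable_map_measure (by fun_prop) hsq.aemeasurable]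
        simpa [Function.comp_def, ← pow_mul] using (hν (2 * n) (by omega)).1
      · rw [integral_map hsq.aemeasurable (by fun_prop), integral_map hsq.aemeasurable
          (by fun_prop)]
        simpa [← pow_mul] using (hν (2 * n) (by omega)).2)
  rw [← hinv hν0, key, hinv hsupp]

/-- Corollary 9: if `limsup_{x→∞} g(x + a (log x)^α · log log x)/g(x) < 1` with
`a > 0`, `α ∈ [0,1)`, `x₀ > e`, then both `Y` and `Y²` are M-det on `[0,∞)`. -/
theorem corollary9
    (x₀ : ℝ) (hx₀ : Real.exp 1 < x₀)
    (a α : ℝ) (ha : 0 < a) (hα : α ∈ Ico (0 : ℝ) 1)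
    (μ : Measure ℝ) [IsProbabilityMeasure μ]
    (hsupp : μ (Iio 0) = 0)
    (hmom : ∀ n : ℕ, Integrable (fun x => x ^ n) μ)
    (g : ℝ → ℝ) (hg_meas : Measurable g)
    (hg_ac : μ.restrict (Ici x₀) =
      (volume.restrict (Ici x₀)).withDensity (fun x => ENNReal.ofReal (g x)))
    (hg_pos : ∀ x ∈ Ici x₀, 0 < g x)
    (hlimsup : Filter.limsup
        (fun x => ENNReal.ofReal
          (g (x + a * (Real.log x) ^ α * Real.log (Real.log x)) / g x)) atTop < 1) :
    IsMomentDetOnNonneg μ ∧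
    IsMomentDetOnNonneg (μ.map (fun x => x ^ 2)) := by
  obtain ⟨K, hK, hgrowth⟩ := exists_moment_growth x₀ a α ha hα μ hsupp hmom g hg_meas hg_ac
    hg_pos hlimsup
  have h := isMomentDetOnNonneg_map_sq hmom
    (measure_compl_zero_ne_zero ((Real.exp_pos 1).trans hx₀) hg_meas hg_ac hg_pos) hK hgrowth
  exact ⟨h.of_map_sq hsupp, h⟩
end

section
/- Let (a_n)_{n≥1} be a sequence of positive real numbers and let b, c > 0 be constants such that a_n ≤ c·(n·log n)·a_{n−1} + b^n for all n = 2, 3, …. Then a_n ≤ d₀·c^n·(n·log n)^n for all n = 2, 3, …, where d₀ = a₁/c + exp(b/c). -/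
theorem one_le_log_of_three_le {x : ℝ} (hx : 3 ≤ x) : 1 ≤ Real.log x := by
  rw [Real.le_log_iff_exp_le (by linarith)]
  linarith [Real.exp_one_lt_d9]

theorem sq_le_exp {x : ℝ} (hx : 0 ≤ x) : x ^ 2 ≤ Real.exp x := by
  have h_half : x / 2 ≤ Real.exp (x / 2 - 1) := by
    linarith [Real.add_one_le_exp (x / 2 - 1)]
  have h_le : x ≤ Real.exp (x / 2) := by
    have h_mul : Real.exp (x / 2) = Real.exp 1 * Real.exp (x / 2 - 1) := by
      rw [← Real.exp_add]; congr 1; ring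
    rw [h_mul]
    nlinarith [Real.exp_one_gt_d9, Real.exp_pos (x / 2 - 1)]
  calc x ^ 2 ≤ Real.exp (x / 2) ^ 2 := by gcongr
    _ = Real.exp x := by rw [← Real.exp_nat_mul]; congr 1; push_cast; ring

/-- Unrolling the recursion; `P` plays the role of `∏ j ∈ Icc 2 (m + 2), j log j`. -/
theorem exists_factor_le (a : ℕ → ℝ) (ha : 0 < a 1) (b c : ℝ) (hb : 0 < b) (hc : 0 < c)
    (h : ∀ n : ℕ, 2 ≤ n → a n ≤ c * ((n : ℝ) * Real.log n) * a (n - 1) + b ^ n) (m : ℕ) :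
    ∃ P : ℝ, 2 / 3 * ((m + 2).factorial : ℝ) ≤ P ∧
      P ≤ (((m + 2 : ℕ) : ℝ) * Real.log (m + 2 : ℕ)) ^ (m + 1) ∧
      a (m + 2) ≤ c ^ (m + 2) * P *
        (a 1 / c + 3 / 2 * ∑ k ∈ Finset.range (m + 3), (b / c) ^ k / (k.factorial : ℝ)) := by
  induction m with
  | zero =>
    have hlog := Real.log_two_gt_d9
    refine ⟨2 * Real.log 2, by norm_num [Nat.factorial]; linarith, by norm_num, ?_⟩
    have h_two := h 2 le_rfl
    norm_num at h_two
    refine h_two.trans ?_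
    have hx : 0 < b / c := by positivity
    have hbc : b = c * (b / c) := by field_simp
    have h_init : c * (2 * Real.log 2) * a 1 = c ^ 2 * (2 * Real.log 2) * (a 1 / c) := by
      field_simp
    have h_sum : (b / c) ^ 2 / 2 ≤
        ∑ k ∈ Finset.range (0 + 3), (b / c) ^ k / (k.factorial : ℝ) := by
      norm_num [Finset.sum_range_succ, Nat.factorial]
      positivity
    have h_main : b ^ 2 ≤ c ^ 2 * (2 * Real.log 2) * (3 / 2 * ((b / c) ^ 2 / 2)) := by
      have h_sq : b ^ 2 = c ^ 2 * (b / c) ^ 2 := by field_simp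
      rw [h_sq]
      nlinarith [mul_pos (pow_pos hc 2) (pow_pos hx 2)]
    rw [h_init, mul_add]
    refine add_le_add le_rfl (h_main.trans ?_)
    simp only [zero_add] at h_sum ⊢
    gcongr
  | succ m ih =>
    obtain ⟨P, hP_fact, hP_le, hP_a⟩ := ih
    have hP : 0 < P := lt_of_lt_of_le (by positivity) hP_fact
    have h_three : (3 : ℝ) ≤ ((m + 3 : ℕ) : ℝ) := by push_cast; linarith [m.cast_nonneg (α := ℝ)]
    have hlog := one_le_log_of_three_le h_three
    have h_step := h (m + 3) (by omega)
    rw [show m + 3 - 1 = m + 2 by omega] at h_step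
    rw [show m + 1 + 2 = m + 3 by omega, show m + 1 + 3 = m + 3 + 1 by omega,
      show m + 1 + 1 = m + 2 by omega]
    set L : ℝ := ((m + 3 : ℕ) : ℝ) * Real.log (m + 3 : ℕ) with hL
    have hL_ge : ((m + 3 : ℕ) : ℝ) ≤ L := by rw [hL]; nlinarith
    have hL_pos : 0 < L := by linarith
    have h_fact : 2 / 3 * ((m + 3).factorial : ℝ) ≤ L * P := by
      rw [Nat.factorial_succ, Nat.cast_mul]
      calc 2 / 3 * (((m + 2 + 1 : ℕ) : ℝ) * ((m + 2).factorial : ℝ))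
          = ((m + 3 : ℕ) : ℝ) * (2 / 3 * ((m + 2).factorial : ℝ)) := by ring
        _ ≤ L * P := by gcongr
    refine ⟨L * P, h_fact, ?_, ?_⟩
    · rw [pow_succ' L (m + 1)]
      gcongr
      refine hP_le.trans ?_
      have h_nonneg : 0 ≤ Real.log ((m + 2 : ℕ) : ℝ) := Real.log_natCast_nonneg _
      rw [hL]
      gcongr <;> norm_num
    · rw [Finset.sum_range_succ]
      set S := ∑ k ∈ Finset.range (m + 3), (b / c) ^ k / (k.factorial : ℝ)
      have h_pow : b ^ (m + 3) ≤
          c ^ (m + 3) * (L * P) * (3 / 2 * ((b / c) ^ (m + 3) / ((m + 3).factorial : ℝ))) := by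
        have hF : (0 : ℝ) < ((m + 3).factorial : ℝ) := by positivity
        calc b ^ (m + 3) = c ^ (m + 3) * (2 / 3 * ((m + 3).factorial : ℝ)) *
              (3 / 2 * ((b / c) ^ (m + 3) / ((m + 3).factorial : ℝ))) := by
              rw [div_pow]; field_simp
          _ ≤ _ := by gcongr
      calc a (m + 3) ≤ c * L * a (m + 2) + b ^ (m + 3) := h_step
        _ ≤ c * L * (c ^ (m + 2) * P * (a 1 / c + 3 / 2 * S)) +
            c ^ (m + 3) * (L * P) *
              (3 / 2 * ((b / c) ^ (m + 3) / ((m + 3).factorial : ℝ))) := by gcongr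
        _ = _ := by ring

/-- Lemma 2: if `a_n ≤ c (n log n) a_{n-1} + b^n` for all `n ≥ 2`, then
`a_n ≤ d₀ c^n (n log n)^n` for all `n ≥ 2`, where `d₀ = a₁/c + exp(b/c)`. -/
theorem lemma2 (a : ℕ → ℝ) (ha : ∀ n : ℕ, 1 ≤ n → 0 < a n)
    (b c : ℝ) (hb : 0 < b) (hc : 0 < c)
    (h : ∀ n : ℕ, 2 ≤ n → a n ≤ c * ((n : ℝ) * Real.log n) * a (n - 1) + b ^ n) :
    ∀ n : ℕ, 2 ≤ n →
      a n ≤ (a 1 / c + Real.exp (b / c)) * c ^ n * ((n : ℝ) * Real.log n) ^ n := by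
  intro n hn
  have ha_one := ha 1 le_rfl
  have hx : 0 < b / c := by positivity
  obtain rfl | hn_three := hn.eq_or_lt
  · have hlog := Real.log_two_gt_d9
    have h_two := h 2 le_rfl
    norm_num at h_two ⊢
    have h_init : c * (2 * Real.log 2) * a 1 = a 1 / c * c ^ 2 * (2 * Real.log 2) := by
      field_simp
    have h_sq : b ^ 2 ≤ Real.exp (b / c) * c ^ 2 := by
      calc b ^ 2 = (b / c) ^ 2 * c ^ 2 := by field_simp
        _ ≤ _ := by gcongr; exact sq_le_exp hx.le
    have hL : 2 * Real.log 2 ≤ (2 * Real.log 2) ^ 2 := by nlinarith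
    have hL_one : 1 ≤ (2 * Real.log 2) ^ 2 := by nlinarith
    calc a 2 ≤ a 1 / c * c ^ 2 * (2 * Real.log 2) + b ^ 2 := by rw [← h_init]; exact h_two
      _ ≤ a 1 / c * c ^ 2 * (2 * Real.log 2) ^ 2 +
          Real.exp (b / c) * c ^ 2 * (2 * Real.log 2) ^ 2 := by
        refine add_le_add (by gcongr) (h_sq.trans ?_)
        exact le_mul_of_one_le_right (by positivity) hL_one
      _ = _ := by ring
  · obtain ⟨m, rfl⟩ : ∃ m, n = m + 2 := ⟨n - 2, by omega⟩
    obtain ⟨P, hP_fact, hP_le, hP_a⟩ := exists_factor_le a ha_one b c hb hc h m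
    have hP : 0 < P := lt_of_lt_of_le (by positivity) hP_fact
    have h_three : (3 : ℝ) ≤ ((m + 2 : ℕ) : ℝ) := by exact_mod_cast hn_three
    have hlog := one_le_log_of_three_le h_three
    set L : ℝ := ((m + 2 : ℕ) : ℝ) * Real.log (m + 2 : ℕ) with hL
    have hL_ge : 3 ≤ L := by rw [hL]; nlinarith
    have h_exp := Real.sum_le_exp_of_nonneg hx.le (m + 3)
    have hLP : 3 / 2 * P ≤ L ^ (m + 2) := by
      rw [pow_succ' L (m + 1)]
      gcongr
      linarith
    calc a (m + 2) ≤ _ := hP_a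
      _ ≤ c ^ (m + 2) * P * (3 / 2 * (a 1 / c) + 3 / 2 * Real.exp (b / c)) := by
        gcongr
        linarith [div_pos ha_one hc]
      _ = (a 1 / c + Real.exp (b / c)) * c ^ (m + 2) * (3 / 2 * P) := by ring
      _ ≤ _ := by gcongr
end

section
/- Let x₀ > 0 and let φ be a nonnegative differentiable function on [x₀,∞) such that y(x) = x + φ(x) is strictly increasing, with inverse x(y) defined on [y₀,∞) where y₀ = y(x₀), and set ψ(y) = y − x(y). Assume there exist constants C > 0 and y* ≥ y₀ such that for all y ≥ y*: (a) ψ′(y) ∈ [0,1], (b) ψ(y) ≤ C·log y, and (c) y·ψ′(y) ≤ C. Let X be a real-valued random variable with distribution function F having finite moments of all positive integer orders, such that F is absolutely continuous on ℝ \ (−x₀, x₀) with density f(x) = F′(x) > 0 there, and suppose limsup_{x→∞} f(x+φ(x)) / f(x) < 1. Then there exist positive constants c₊ and b₊, independent of n, such that the one-sided absolute moments μ_n⁺ = ∫_{[0,∞)} x^n dF(x) satisfy μ_n⁺ ≤ c₊·(n·log n)·μ_{n−1}⁺ + b₊^n for all n = 2, 3, …. -/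
open MeasureTheory Filter Set

/-- The sequence `K n log n` dominates the threshold beyond which `n C log y ≤ ε y`. -/
theorem exists_const_forall_mul_log_le (C ε Y : ℝ) (hC : 0 < C) (hε : 0 < ε) :
    ∃ K : ℝ, 0 < K ∧ ∀ n : ℕ, 2 ≤ n → Y ≤ K * (n * Real.log n) ∧
      ∀ y, K * (n * Real.log n) ≤ y → n * (C * Real.log y) ≤ ε * y := by
  have hl2 : 0 < Real.log 2 := Real.log_pos (by norm_num)
  have hlog : ∀ᶠ K : ℝ in atTop, ‖Real.log K‖ ≤ (ε / 2 * Real.log 2 / C) * ‖id K‖ :=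
    Real.isLittleO_log_id_atTop.def (by positivity)
  obtain ⟨K, hK, hK1, hK2, hK3⟩ := (hlog.and ((eventually_gt_atTop 0).and
    ((eventually_ge_atTop (4 * C / ε)).and
      (eventually_ge_atTop (max Y (Real.exp 1) / (2 * Real.log 2)))))).exists
  refine ⟨K, hK1, fun n hn => ?_⟩
  have hn' : (2 : ℝ) ≤ n := by exact_mod_cast hn
  have hL : Real.log 2 ≤ Real.log n := Real.log_le_log (by norm_num) hn'
  have hLpos : 0 < Real.log n := hl2.trans_le hL
  have hA : max Y (Real.exp 1) ≤ K * (n * Real.log n) := by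
    rw [div_le_iff₀ (by positivity)] at hK3
    exact hK3.trans (by gcongr)
  refine ⟨(le_max_left _ _).trans hA, fun y hy => ?_⟩
  have hAe : Real.exp 1 ≤ K * (n * Real.log n) := (le_max_right _ _).trans hA
  have hApos : 0 < K * (n * Real.log n) := by positivity
  have hypos : 0 < y := hApos.trans_le hy
  have hanti := Real.log_div_self_antitoneOn hAe (hAe.trans hy) hy
  have hlogA : Real.log (K * (n * Real.log n)) ≤ Real.log K + 2 * Real.log n := by
    rw [Real.log_mul hK1.ne' (by positivity), Real.log_mul (by positivity) hLpos.ne']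
    linarith [Real.log_le_sub_one_of_pos hLpos]
  have h1 : C * Real.log K ≤ ε / 2 * Real.log 2 * K := by
    have h := (le_abs_self _).trans hK
    rw [id, Real.norm_eq_abs, abs_of_pos hK1, div_mul_eq_mul_div, le_div_iff₀ hC] at h
    linarith
  have h2 : 4 * C ≤ K * ε := by rwa [div_le_iff₀ hε] at hK2
  have h3 : C * Real.log (K * (n * Real.log n)) ≤ ε * K * Real.log n := by
    have h4 : ε / 2 * Real.log 2 * K ≤ ε / 2 * Real.log n * K := by gcongr
    nlinarith [mul_le_mul_of_nonneg_left hlogA hC.le, mul_le_mul_of_nonneg_right h2 hLpos.le]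
  have h5 : Real.log y / y ≤ ε / (n * C) := by
    refine hanti.trans ?_
    rw [div_le_div_iff₀ hApos (by positivity)]
    nlinarith [mul_le_mul_of_nonneg_left h3 (by positivity : (0 : ℝ) ≤ n)]
  rw [div_le_div_iff₀ hypos (by positivity)] at h5
  linarith

/-- A tail moment transported by a change of variables `u` along which the density `f`
contracts by the factor `q`. -/
theorem setLIntegral_Ici_pow_mul_le (f u u' : ℝ → ℝ) (n : ℕ) (A a q r : ℝ)
    (hr : 0 ≤ r) (hq : 0 ≤ q)
    (hu : ∀ y ∈ Ici A, HasDerivAt u (u' y) y) (hinj : InjOn u (Ici A))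
    (hmaps : MapsTo u (Ici A) (Ici a)) (hu' : ∀ y ∈ Ici A, r ≤ u' y)
    (hpow : ∀ y ∈ Ici A, r * y ^ n ≤ u y ^ n)
    (hf : ∀ y ∈ Ici A, f y ≤ q * f (u y)) :
    ENNReal.ofReal (r ^ 2) * ∫⁻ y in Ici A, ENNReal.ofReal (f y) * ENNReal.ofReal (y ^ n) ≤
      ENNReal.ofReal q * ∫⁻ x in Ici a, ENNReal.ofReal (f x) * ENNReal.ofReal (x ^ n) := by
  calc
    _ = ∫⁻ y in Ici A,
          ENNReal.ofReal (r ^ 2) * (ENNReal.ofReal (f y) * ENNReal.ofReal (y ^ n)) :=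
      (lintegral_const_mul' _ _ ENNReal.ofReal_ne_top).symm
    _ ≤ ∫⁻ y in Ici A, ENNReal.ofReal q * (ENNReal.ofReal |u' y| *
          (ENNReal.ofReal (f (u y)) * ENNReal.ofReal (u y ^ n))) := by
      refine setLIntegral_mono' measurableSet_Ici fun y hy => ?_
      have h1 : ENNReal.ofReal (f y) ≤ ENNReal.ofReal q * ENNReal.ofReal (f (u y)) := by
        rw [← ENNReal.ofReal_mul hq]
        exact ENNReal.ofReal_le_ofReal (hf y hy)
      have h2 : ENNReal.ofReal r * ENNReal.ofReal (y ^ n) ≤ ENNReal.ofReal (u y ^ n) := by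
        rw [← ENNReal.ofReal_mul hr]
        exact ENNReal.ofReal_le_ofReal (hpow y hy)
      have h3 : ENNReal.ofReal r ≤ ENNReal.ofReal |u' y| :=
        ENNReal.ofReal_le_ofReal ((hu' y hy).trans (le_abs_self _))
      rw [pow_two, ENNReal.ofReal_mul hr]
      calc
        _ = ENNReal.ofReal (f y) *
              (ENNReal.ofReal r * (ENNReal.ofReal r * ENNReal.ofReal (y ^ n))) := by ring
        _ ≤ ENNReal.ofReal q * ENNReal.ofReal (f (u y)) *
              (ENNReal.ofReal |u' y| * ENNReal.ofReal (u y ^ n)) := by gcongr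
        _ = _ := by ring
    _ = ENNReal.ofReal q *
          ∫⁻ x in u '' Ici A, ENNReal.ofReal (f x) * ENNReal.ofReal (x ^ n) := by
      rw [lintegral_const_mul' _ _ ENNReal.ofReal_ne_top,
        lintegral_image_eq_lintegral_abs_deriv_mul measurableSet_Ici
          (fun y hy => (hu y hy).hasDerivWithinAt) hinj]
    _ ≤ _ := by
      gcongr
      exact hmaps.image_subset

/-- Splitting a one-sided moment at `A`, when the tail beyond `A` carries at most the
proportion `q / p` of the whole moment. -/
theorem setIntegral_pow_le_of_tail_le (μ : Measure ℝ)
    (hmom : ∀ n : ℕ, Integrable (fun x => x ^ n) μ) (n : ℕ) (hn : n ≠ 0) (A p q : ℝ)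
    (hA : 0 ≤ A) (hp : 0 ≤ p) (hp1 : p ≤ 1)
    (htail : p * ∫ x in Ici A, x ^ n ∂μ ≤ q * ∫ x in Ici (0 : ℝ), x ^ n ∂μ) :
    (p - q) * ∫ x in Ici (0 : ℝ), x ^ n ∂μ ≤ A * ∫ x in Ici (0 : ℝ), x ^ (n - 1) ∂μ := by
  have hsplit : ∫ x in Ici (0 : ℝ), x ^ n ∂μ =
      (∫ x in Ico 0 A, x ^ n ∂μ) + ∫ x in Ici A, x ^ n ∂μ := by
    rw [← setIntegral_union (Set.disjoint_left.2 fun x hx hx' => hx.2.not_ge hx')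
      measurableSet_Ici (hmom n).integrableOn (hmom n).integrableOn, Ico_union_Ici_eq_Ici hA]
  have hhead : ∫ x in Ico 0 A, x ^ n ∂μ ≤ A * ∫ x in Ici (0 : ℝ), x ^ (n - 1) ∂μ := by
    calc
      _ ≤ ∫ x in Ico 0 A, A * x ^ (n - 1) ∂μ := by
        refine setIntegral_mono_on (hmom n).integrableOn
          ((hmom (n - 1)).const_mul A).integrableOn measurableSet_Ico fun x hx => ?_
        rw [← mul_pow_sub_one hn]
        exact mul_le_mul_of_nonneg_right hx.2.le (pow_nonneg hx.1 _)
      _ = A * ∫ x in Ico 0 A, x ^ (n - 1) ∂μ := integral_const_mul _ _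
      _ ≤ _ := by
        refine mul_le_mul_of_nonneg_left (setIntegral_mono_set (hmom (n - 1)).integrableOn ?_
          Ico_subset_Ici_self.eventuallyLE) hA
        exact (ae_restrict_mem measurableSet_Ici).mono fun x hx => pow_nonneg hx _
  have hhead0 : 0 ≤ ∫ x in Ico 0 A, x ^ n ∂μ :=
    setIntegral_nonneg measurableSet_Ico fun x hx => pow_nonneg hx.1 _
  nlinarith [mul_le_mul_of_nonneg_right hp1 hhead0]

/-- Key step in the proof of Theorem 1: the one-sided condition
`limsup_{x→∞} f(x+φ(x))/f(x) < 1` yields constants `c₊, b₊ > 0` with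
`μ_n⁺ ≤ c₊ (n log n) μ_{n-1}⁺ + b₊^n` for all `n ≥ 2`, where
`μ_n⁺ = ∫_{[0,∞)} x^n dF(x)`. -/
theorem onesided_moment_recursion
    (x₀ : ℝ) (hx₀ : 0 < x₀)
    (φ : ℝ → ℝ)
    (hφ_nonneg : ∀ x ∈ Ici x₀, 0 ≤ φ x)
    (hφ_diff : DifferentiableOn ℝ φ (Ici x₀))
    (hmono : StrictMonoOn (fun x => x + φ x) (Ici x₀))
    (xinv : ℝ → ℝ)
    (hinv₁ : ∀ x ∈ Ici x₀, xinv (x + φ x) = x)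
    (hinv₂ : ∀ y ∈ Ici (x₀ + φ x₀), xinv y ∈ Ici x₀ ∧ xinv y + φ (xinv y) = y)
    (ψ ψ' : ℝ → ℝ)
    (hψ : ∀ y, ψ y = y - xinv y)
    (C ystar : ℝ) (hC : 0 < C) (hystar : x₀ + φ x₀ ≤ ystar)
    (hψ_deriv : ∀ y ∈ Ici ystar, HasDerivAt ψ (ψ' y) y)
    (hcond_a : ∀ y ∈ Ici ystar, ψ' y ∈ Icc (0 : ℝ) 1)
    (hcond_b : ∀ y ∈ Ici ystar, ψ y ≤ C * Real.log y)
    (hcond_c : ∀ y ∈ Ici ystar, y * ψ' y ≤ C)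
    (μ : Measure ℝ) [IsProbabilityMeasure μ]
    (hmom : ∀ n : ℕ, Integrable (fun x => x ^ n) μ)
    (f : ℝ → ℝ) (hf_meas : Measurable f)
    (hf_ac : μ.restrict ((Ioo (-x₀) x₀)ᶜ) =
      (volume.restrict ((Ioo (-x₀) x₀)ᶜ)).withDensity (fun x => ENNReal.ofReal (f x)))
    (hf_pos : ∀ x ∈ (Ioo (-x₀) x₀)ᶜ, 0 < f x)
    (hlimsup : Filter.limsup
        (fun x => ENNReal.ofReal (f (x + φ x) / f x)) atTop < 1) :
    ∃ cp bp : ℝ, 0 < cp ∧ 0 < bp ∧ ∀ n : ℕ, 2 ≤ n →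
      (∫ x in Ici (0 : ℝ), x ^ n ∂μ) ≤
        cp * ((n : ℝ) * Real.log n) * (∫ x in Ici (0 : ℝ), x ^ (n - 1) ∂μ) +
        bp ^ n := by
  obtain ⟨b, hb, hb1⟩ := exists_between hlimsup
  set q : ℝ := b.toReal
  have hb_top : b ≠ ⊤ := (hb1.trans ENNReal.one_lt_top).ne
  have hq0 : 0 ≤ q := ENNReal.toReal_nonneg
  have hq1 : q < 1 := by
    simpa using (ENNReal.toReal_lt_toReal hb_top ENNReal.one_ne_top).2 hb1
  obtain ⟨x₁, hx₁⟩ := eventually_atTop.1 (eventually_lt_of_limsup_lt hb)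
  have hf_pos' : ∀ x, x₀ ≤ x → 0 < f x := fun x hx => hf_pos x fun h => h.2.not_ge hx
  have hcontr : ∀ x, x₀ ≤ x → x₁ ≤ x → f (x + φ x) ≤ q * f x := by
    intro x hx hx'
    have hfx := hf_pos' x hx
    have h := ENNReal.toReal_mono hb_top (hx₁ x hx').le
    have hfy := hf_pos' (x + φ x) (by linarith [hφ_nonneg x hx])
    rwa [ENNReal.toReal_ofReal (by positivity), div_le_iff₀ hfx] at h
  set x₂ := max x₀ x₁
  have hx₂ : x₀ ≤ x₂ := le_max_left _ _
  set ε : ℝ := (1 - q) / 4 with hε_def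
  have hε : 0 < ε := by rw [hε_def]; linarith
  obtain ⟨K, hK, hKn⟩ := exists_const_forall_mul_log_le C ε
    (max (max x₀ ystar) (max (C / ε) (x₂ + φ x₂))) hC hε
  have hgap : 0 < (1 - ε) ^ 2 - q := by rw [hε_def]; nlinarith
  refine ⟨K / ((1 - ε) ^ 2 - q), 1, by positivity, one_pos, fun n hn => ?_⟩
  obtain ⟨hAY, hAlog⟩ := hKn n hn
  set A : ℝ := K * (n * Real.log n)
  simp only [max_le_iff] at hAY
  obtain ⟨⟨hAx₀, hAys⟩, hACε, hAx₂⟩ := hAY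
  have hApos : 0 < A := hx₀.trans_le hAx₀
  have hxinv : ∀ y ∈ Ici A, xinv y ∈ Ici x₀ ∧ xinv y + φ (xinv y) = y := fun y hy =>
    hinv₂ y (hystar.trans (hAys.trans hy))
  have hψ_eq : xinv = fun y => y - ψ y := by
    funext y
    rw [hψ]
    ring
  have hderiv : ∀ y ∈ Ici A, HasDerivAt xinv (1 - ψ' y) y := by
    intro y hy
    rw [hψ_eq]
    exact (hasDerivAt_id y).sub (hψ_deriv y (hAys.trans hy))
  have hpow : ∀ y ∈ Ici A, (1 - ε) * y ^ n ≤ xinv y ^ n := by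
    intro y hy
    have hypos : 0 < y := hApos.trans_le hy
    have hx : 0 < xinv y := hx₀.trans_le (hxinv y hy).1
    have hbern : 1 + (n : ℝ) * (xinv y / y - 1) ≤ (1 + (xinv y / y - 1)) ^ n :=
      one_add_mul_le_pow (by linarith [div_pos hx hypos]) n
    rw [add_sub_cancel, div_pow] at hbern
    have hlow : 1 - ε ≤ 1 + (n : ℝ) * (xinv y / y - 1) := by
      have h1 : n * ψ y ≤ ε * y :=
        (mul_le_mul_of_nonneg_left (hcond_b y (hAys.trans hy)) (by positivity)).trans
          (hAlog y hy)
      have h2 : n * (xinv y / y - 1) = -(n * ψ y / y) := by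
        rw [hψ]
        field_simp
        ring
      have h3 : n * ψ y / y ≤ ε := (div_le_iff₀ hypos).2 h1
      linarith
    exact (le_div_iff₀ (by positivity)).1 (hlow.trans hbern)
  have hslope : ∀ y ∈ Ici A, 1 - ε ≤ 1 - ψ' y := by
    intro y hy
    have hypos : 0 < y := hApos.trans_le hy
    have h1 : C ≤ y * ε := (div_le_iff₀ hε).1 (hACε.trans hy)
    have h2 : y * ψ' y ≤ y * ε := (hcond_c y (hAys.trans hy)).trans h1
    linarith [le_of_mul_le_mul_left h2 hypos]
  have hfle : ∀ y ∈ Ici A, f y ≤ q * f (xinv y) := by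
    intro y hy
    obtain ⟨h1, h2⟩ := hxinv y hy
    have h3 : x₂ ≤ xinv y := by
      refine (hmono.le_iff_le hx₂ h1).1 ?_
      simp only [h2]
      exact hAx₂.trans hy
    simpa only [h2] using hcontr (xinv y) h1 ((le_max_right _ _).trans h3)
  have hinj : InjOn xinv (Ici A) := by
    intro y hy z hz hyz
    rw [← (hxinv y hy).2, ← (hxinv z hz).2, hyz]
  have hdens : ∀ S ⊆ Ici x₀, MeasurableSet S → ∫⁻ y in S, ENNReal.ofReal (y ^ n) ∂μ =
      ∫⁻ y in S, ENNReal.ofReal (f y) * ENNReal.ofReal (y ^ n) := by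
    intro S hS hSm
    have hS' : S ⊆ (Ioo (-x₀) x₀)ᶜ := fun y hy h => h.2.not_ge (hS hy)
    rw [← Measure.restrict_restrict_of_subset hS', hf_ac, restrict_withDensity hSm,
      Measure.restrict_restrict_of_subset hS',
      lintegral_withDensity_eq_lintegral_mul _ hf_meas.ennreal_ofReal (by fun_prop)]
    rfl
  have hint : ∀ a : ℝ, 0 ≤ a → ∫⁻ y in Ici a, ENNReal.ofReal (y ^ n) ∂μ =
      ENNReal.ofReal (∫ y in Ici a, y ^ n ∂μ) := by
    intro a ha
    refine (ofReal_integral_eq_lintegral_ofReal (hmom n).integrableOn ?_).symm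
    exact (ae_restrict_mem measurableSet_Ici).mono fun y hy => pow_nonneg (ha.trans hy) n
  have hmain := setLIntegral_Ici_pow_mul_le f xinv (fun y => 1 - ψ' y) n A x₀ q (1 - ε)
    (by rw [hε_def]; linarith) hq0 hderiv hinj (fun y hy => (hxinv y hy).1)
    hslope hpow hfle
  rw [← hdens _ (Ici_subset_Ici.2 hAx₀) measurableSet_Ici,
    ← hdens _ Subset.rfl measurableSet_Ici] at hmain
  have hmain' := hmain.trans (mul_le_mul_right (lintegral_mono_set (Ici_subset_Ici.2 hx₀.le)) _)
  have hnonneg : 0 ≤ ∫ x in Ici (0 : ℝ), x ^ n ∂μ :=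
    setIntegral_nonneg measurableSet_Ici fun x hx => pow_nonneg hx _
  rw [hint A hApos.le, hint 0 le_rfl, ← ENNReal.ofReal_mul (by positivity),
    ← ENNReal.ofReal_mul hq0, ENNReal.ofReal_le_ofReal_iff (by positivity)] at hmain'
  have hfinal := setIntegral_pow_le_of_tail_le μ hmom n (by lia) A ((1 - ε) ^ 2) q hApos.le
    (by positivity) (by rw [hε_def]; nlinarith) hmain'
  rw [mul_comm, ← le_div_iff₀ hgap] at hfinal
  refine hfinal.trans ((le_of_eq ?_).trans (le_add_of_nonneg_right (by positivity)))
  simp only [A]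
  ring
end
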